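/- For every integer r ≥ 4, the sequence f^(r)(n; 8r−14, 8)/n² converges as n → ∞, and its limit equals 1/(r²−r). -/

import Mathlib

/-- An `(s,k)`-configuration in `G`: `k` distinct edges whose union has at most `s` vertices. -/
def HasConfig {n : ℕ} (G : Finset (Finset (Fin n))) (s k : ℕ) : Prop :=
  ∃ S ⊆ G, S.card = k ∧ (S.sup id).card ≤ s

/-- `fBES r n s k` is the maximum number of edges in an `r`-uniform hypergraph on `n`
vertices containing no `(s,k)`-configuration. -/
noncomputable def fBES (r n s k : ℕ) : ℕ :=
  sSup {m : ℕ | ∃ G : Finset (Finset (Fin n)),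
    (∀ e ∈ G, e.card = r) ∧ ¬ HasConfig G s k ∧ G.card = m}

namespace BES
open Finset

variable {α : Type*} [DecidableEq α]

/-- vertex set spanned by a set of edges -/
def vs (S : Finset (Finset α)) : Finset α := S.sup id

theorem mem_vs {S : Finset (Finset α)} {v : α} : v ∈ vs S ↔ ∃ e ∈ S, v ∈ e := by
  simp [vs, Finset.mem_sup]

theorem vs_union (S T : Finset (Finset α)) : vs (S ∪ T) = vs S ∪ vs T := by
  simp [vs, Finset.sup_union]

@[simp] theorem vs_singleton (e : Finset α) : vs {e} = e := by simp [vs]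

theorem vs_mono {S T : Finset (Finset α)} (h : S ⊆ T) : vs S ⊆ vs T := Finset.sup_mono h

theorem subset_vs {S : Finset (Finset α)} {e : Finset α} (h : e ∈ S) : e ⊆ vs S :=
  fun _ hv => mem_vs.2 ⟨e, h, hv⟩

/-- the size patterns of dense configurations -/
def sz (a b : ℕ) : Prop :=
  (a = 2 ∧ b = 2) ∨ (a = 3 ∧ b = 2) ∨ (a = 4 ∧ b = 4) ∨ (a = 5 ∧ b = 3) ∨ (a = 6 ∧ b = 2) ∨
    (a = 7 ∧ b = 1)

structure Loc (G : Finset (Finset α)) (t : ℕ) : Prop where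
  ht : 2 ≤ t
  card : ∀ e ∈ G, e.card = t + 2
  no8 : ∀ S ⊆ G, S.card = 8 → 8 * t + 2 < (vs S).card
  nd : ∀ T S, T ⊆ S → S ⊆ G → (vs T).card ≤ T.card * t + 2 → sz S.card T.card →
    S.card * t + 2 ≤ (vs S).card

def Dense (G : Finset (Finset α)) (t : ℕ) (S : Finset (Finset α)) : Prop :=
  S ⊆ G ∧ ∃ T ⊆ S, (vs T).card ≤ T.card * t + 2 ∧ sz S.card T.card ∧ (vs S).card < S.card * t + 2

theorem glue {A B : Finset (Finset α)} {v : α} (ha : v ∈ vs A) (hb : v ∈ vs B) :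
    (vs (A ∪ B)).card + 1 ≤ (vs A).card + (vs B).card := by
  rw [vs_union, ← card_union_add_card_inter]
  have : 0 < (vs A ∩ vs B).card := card_pos.2 ⟨v, mem_inter.2 ⟨ha, hb⟩⟩
  omega

theorem removal [Fintype α] (G : Finset (Finset α)) (t : ℕ) (ht : 2 ≤ t)
    (hc : ∀ e ∈ G, e.card = t + 2) (h8 : ∀ S ⊆ G, S.card = 8 → 8 * t + 2 < (vs S).card) :
    ∃ G' ⊆ G, Loc G' t ∧ G.card ≤ G'.card + 7 * (3 * (Fintype.card α * 8)) := by
  classical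
  let D : Finset (Finset (Finset α)) := G.powerset.filter (Dense G t)
  let Fam : Finset (Finset (Finset (Finset α))) := D.powerset.filter (fun M => (M : Set (Finset (Finset α))).PairwiseDisjoint id)
  have hne : Fam.Nonempty := ⟨∅, by simp [Fam]⟩
  obtain ⟨M, hM, hmax⟩ := Finset.exists_max_image Fam card hne
  obtain ⟨hMD, hMdis⟩ : M ⊆ D ∧ (M : Set (Finset (Finset α))).PairwiseDisjoint id := by
    simpa [Fam] using hM
  have hdense : ∀ S ∈ M, Dense G t S := fun S hS => (mem_filter.1 (hMD hS)).2
  have hszc : ∀ S, Dense G t S → 2 ≤ S.card ∧ S.card ≤ 7 := by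
    rintro S ⟨_, T, _, _, h, _⟩
    unfold sz at h; omega
  refine ⟨G \ M.biUnion id, sdiff_subset, ⟨ht, fun e he => hc e (mem_sdiff.1 he).1,
    fun S hS => h8 S (hS.trans sdiff_subset), ?_⟩, ?_⟩
  · intro T S hTS hS hT hsz
    by_contra hcon
    push Not at hcon
    have hSG : S ⊆ G := hS.trans sdiff_subset
    have hd : Dense G t S := ⟨hSG, T, hTS, hT, hsz, hcon⟩
    have hdis : ∀ S' ∈ M, Disjoint S S' := by
      intro S' hS'
      rw [Finset.disjoint_left]
      intro e he he'
      exact (mem_sdiff.1 (hS he)).2 (mem_biUnion.2 ⟨S', hS', he'⟩)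
    have hSM : S ∉ M := by
      intro h
      have := hdis S h
      rw [disjoint_self] at this
      have h2 := (hszc S hd).1
      rw [this] at h2; simp at h2
    have : insert S M ∈ Fam := by
      simp only [Fam, mem_filter, mem_powerset]
      refine ⟨insert_subset (by simp [D, hSG, hd]) hMD, ?_⟩
      rw [coe_insert, Set.pairwiseDisjoint_insert]
      exact ⟨hMdis, fun S' hS' _ => hdis S' hS'⟩
    have := hmax _ this
    rw [card_insert_of_notMem hSM] at this
    omega
  · have hcard : (M.biUnion id).card ≤ 7 * M.card := by
      rw [mul_comm]
      exact card_biUnion_le_card_mul _ _ _ fun S hS => (hszc S (hdense S hS)).2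
    have h1 : G.card ≤ (G \ M.biUnion id).card + (M.biUnion id).card := by
      have := Finset.le_card_sdiff (M.biUnion id) G
      omega
    suffices M.card ≤ 3 * (Fintype.card α * 8) by omega
    by_contra hbig
    push Not at hbig
    have hT : ∀ S ∈ M, ∃ T ⊆ S, ∃ v, v ∈ vs T ∧ (vs T).card ≤ T.card * t + 2 ∧
        sz S.card T.card ∧ (vs S).card < S.card * t + 2 := by
      intro S hS
      obtain ⟨hSG, T, hTS, h1, h2, h3⟩ := hdense S hS
      have : T.Nonempty := by
        rw [← card_pos]; unfold sz at h2; omega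
      obtain ⟨e, he⟩ := this
      have : e.Nonempty := by
        rw [← card_pos, hc e (hSG (hTS he))]; omega
      obtain ⟨v, hv⟩ := this
      exact ⟨T, hTS, v, subset_vs he hv, h1, h2, h3⟩
    have : Nonempty α := by
      obtain ⟨S, hS⟩ := card_pos.1 (show 0 < M.card by omega)
      obtain ⟨_, _, v, _⟩ := hT S hS
      exact ⟨v⟩
    choose! T hTS v hvT hTc hsz hSc using hT
    obtain ⟨y, -, hy⟩ := Finset.exists_lt_card_fiber_of_mul_lt_card_of_maps_to (s := M)
      (t := (univ : Finset α) ×ˢ range 8) (f := fun S => (v S, S.card)) (n := 3)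
      (fun S hS => by
        simp only [mem_product, mem_univ, true_and, mem_range]
        have := (hszc S (hdense S hS)).2; omega)
      (by rw [card_product, card_range, card_univ]; omega)
    obtain ⟨S1, hS1, S2, hS2, S3, hS3, S4, hS4, n12, n13, n14, n23, n24, n34⟩ :=
      Finset.three_lt_card.1 hy
    simp only [mem_filter] at hS1 hS2 hS3 hS4
    obtain ⟨m1, k1⟩ := hS1
    obtain ⟨m2, k2⟩ := hS2
    obtain ⟨m3, k3⟩ := hS3
    obtain ⟨m4, k4⟩ := hS4
    have e12 := k1.trans k2.symm
    have e13 := k1.trans k3.symm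
    have e14 := k1.trans k4.symm
    simp only [Prod.mk.injEq] at e12 e13 e14
    have d := fun (S S' : Finset (Finset α)) (h : S ∈ M) (h' : S' ∈ M) (hne : S ≠ S') =>
      (show Disjoint S S' from hMdis h h' hne)
    have vS : ∀ S ∈ M, v S ∈ vs S := fun S hS => vs_mono (hTS S hS) (hvT S hS)
    have GS : ∀ S ∈ M, S ⊆ G := fun S hS => (hdense S hS).1
    have cases := hsz S1 m1
    have z2 := hsz S2 m2
    have z3 := hsz S3 m3
    by_cases h2 : S1.card = 2
    · have u1 := glue (A := S1) (B := S2) (v := v S1) (vS _ m1) (e12.1 ▸ vS _ m2)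
      have u2 := glue (A := S1 ∪ S2) (B := S3) (v := v S1)
        (by rw [vs_union]; exact mem_union_left _ (vS _ m1)) (e13.1 ▸ vS _ m3)
      have u3 := glue (A := S1 ∪ S2 ∪ S3) (B := S4) (v := v S1)
        (by rw [vs_union, vs_union]; exact mem_union_left _ (mem_union_left _ (vS _ m1)))
        (e14.1 ▸ vS _ m4)
      have c1 := card_union_of_disjoint (d _ _ m1 m2 n12)
      have c2 := card_union_of_disjoint (s := S1 ∪ S2) (t := S3)
        (disjoint_union_left.2 ⟨d _ _ m1 m3 n13, d _ _ m2 m3 n23⟩)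
      have c3 := card_union_of_disjoint (s := S1 ∪ S2 ∪ S3) (t := S4)
        (disjoint_union_left.2 ⟨disjoint_union_left.2 ⟨d _ _ m1 m4 n14, d _ _ m2 m4 n24⟩,
          d _ _ m3 m4 n34⟩)
      have := h8 (S1 ∪ S2 ∪ S3 ∪ S4)
        (union_subset (union_subset (union_subset (GS _ m1) (GS _ m2)) (GS _ m3)) (GS _ m4))
        (by omega)
      have q1 := hSc _ m1
      have q2 := hSc _ m2
      have q3 := hSc _ m3
      have q4 := hSc _ m4
      rw [← e12.2, h2] at q2
      rw [← e13.2, h2] at q3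
      rw [← e14.2, h2] at q4
      rw [h2] at q1
      omega
    by_cases h3 : S1.card = 3
    · have u1 := glue (A := S1) (B := S2) (v := v S1) (vS _ m1) (e12.1 ▸ vS _ m2)
      have u2 := glue (A := S1 ∪ S2) (B := T S3) (v := v S1)
        (by rw [vs_union]; exact mem_union_left _ (vS _ m1)) (e13.1 ▸ hvT _ m3)
      have c1 := card_union_of_disjoint (d _ _ m1 m2 n12)
      have c2 := card_union_of_disjoint (s := S1 ∪ S2) (t := T S3)
        (disjoint_of_subset_right (hTS _ m3)
          (disjoint_union_left.2 ⟨d _ _ m1 m3 n13, d _ _ m2 m3 n23⟩))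
      have hT3 : (T S3).card = 2 := by unfold sz at z3; omega
      have := h8 (S1 ∪ S2 ∪ T S3)
        (union_subset (union_subset (GS _ m1) (GS _ m2)) ((hTS _ m3).trans (GS _ m3)))
        (by omega)
      have q1 := hSc _ m1
      have q2 := hSc _ m2
      have q3 := hTc _ m3
      rw [← e12.2, h3] at q2
      rw [hT3] at q3
      rw [h3] at q1
      omega
    · have u1 := glue (A := S1) (B := T S2) (v := v S1) (vS _ m1) (e12.1 ▸ hvT _ m2)
      have c1 := card_union_of_disjoint (disjoint_of_subset_right (hTS _ m2) (d _ _ m1 m2 n12))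
      have hT3 : S1.card + (T S2).card = 8 := by unfold sz at z2; omega
      have := h8 (S1 ∪ T S2)
        (union_subset (GS _ m1) ((hTS _ m2).trans (GS _ m2)))
        (by omega)
      have q1 := hSc _ m1
      have q3 := hTc _ m2
      have : S1.card * t + (T S2).card * t = 8 * t := by rw [← add_mul, hT3]
      omega

end BES

namespace BES
open Finset

variable {α : Type*} [DecidableEq α]

def Cl (G : Finset (Finset α)) (t : ℕ) (S : Finset (Finset α)) : Prop :=
  S ⊆ G ∧ (vs S).card ≤ S.card * t + 2

section calculus
variable {G : Finset (Finset α)} {t : ℕ}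

theorem cl_single (hG : Loc G t) {e : Finset α} (he : e ∈ G) : Cl G t {e} := by
  refine ⟨by simpa using he, ?_⟩
  rw [vs_singleton, card_singleton, hG.card e he]; omega

theorem cl_union {A B : Finset (Finset α)} (hA : Cl G t A) (hB : Cl G t B) (hd : Disjoint A B)
    (h2 : 2 ≤ (vs A ∩ vs B).card) : Cl G t (A ∪ B) := by
  refine ⟨union_subset hA.1 hB.1, ?_⟩
  rw [vs_union, card_union_of_disjoint hd, add_mul]
  have := card_union_add_card_inter (vs A) (vs B)
  have := hA.2
  have := hB.2
  omega

theorem ne8 (hG : Loc G t) {A : Finset (Finset α)} (hA : Cl G t A) : A.card ≠ 8 := by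
  intro h
  have := hG.no8 A hA.1 h
  have := hA.2
  rw [h] at this
  omega

theorem inter_le (hG : Loc G t) {A B T : Finset (Finset α)} (hA : Cl G t A) (hB : Cl G t B)
    (hd : Disjoint A B) (hT : T ⊆ A ∪ B) (hcT : Cl G t T) (hs : sz (A.card + B.card) T.card) :
    (vs A ∩ vs B).card ≤ 2 := by
  have h := hG.nd T (A ∪ B) hT (union_subset hA.1 hB.1) hcT.2
    (by rwa [card_union_of_disjoint hd])
  rw [vs_union, card_union_of_disjoint hd, add_mul] at h
  have := card_union_add_card_inter (vs A) (vs B)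
  have := hA.2
  have := hB.2
  omega

theorem inter_le' (hG : Loc G t) {A B : Finset (Finset α)} (hA : Cl G t A) (hB : Cl G t B)
    (hd : Disjoint A B) (hs : A.card + B.card = 2 ∨ A.card + B.card = 4) :
    (vs A ∩ vs B).card ≤ 2 := by
  by_contra hcon
  push Not at hcon
  have := inter_le hG hA hB hd (Subset.refl _) (cl_union hA hB hd hcon.le)
    (by rw [card_union_of_disjoint hd]; unfold sz; omega)
  omega

theorem inter_le7 (hG : Loc G t) {A : Finset (Finset α)} {e : Finset α} (hA : Cl G t A)
    (h6 : A.card = 6) (he : e ∈ G) (heA : e ∉ A) : (vs A ∩ e).card ≤ 2 := by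
  have := inter_le hG hA (cl_single hG he) (by simpa using heA) (T := {e})
    subset_union_right (cl_single hG he) (by simp [h6, sz])
  simpa using this

theorem inter_lt8 (hG : Loc G t) {A B : Finset (Finset α)} (hA : Cl G t A) (hB : Cl G t B)
    (hd : Disjoint A B) (h8 : A.card + B.card = 8) : (vs A ∩ vs B).card < 2 := by
  by_contra hcon
  push Not at hcon
  exact ne8 hG (cl_union hA hB hd hcon) (by rw [card_union_of_disjoint hd, h8])

end calculus

/-- pairs of edges sharing two vertices -/
def QQ (G : Finset (Finset α)) (t : ℕ) : Finset (Finset (Finset α)) :=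
  (G.powersetCard 2).filter (fun p => (vs p).card ≤ 2 * t + 2)

def cross (p : Finset (Finset α)) : Finset (Finset α) :=
  ((vs p).powersetCard 2).filter (fun P => ∀ e ∈ p, ¬ P ⊆ e)

theorem mem_cross {p : Finset (Finset α)} {P : Finset α} :
    P ∈ cross p ↔ P ⊆ vs p ∧ P.card = 2 ∧ ∀ e ∈ p, ¬ P ⊆ e := by
  simp [cross, mem_powersetCard, and_assoc]

section pairs
variable {G : Finset (Finset α)} {t : ℕ}

theorem QQ_cl {p : Finset (Finset α)} (hp : p ∈ QQ G t) : Cl G t p ∧ p.card = 2 := by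
  simp only [QQ, mem_filter, mem_powersetCard] at hp
  refine ⟨⟨hp.1.1, ?_⟩, hp.1.2⟩
  rw [hp.1.2]; exact hp.2

theorem QQ_mk (hG : Loc G t) {f g : Finset α} (hf : f ∈ G) (hg : g ∈ G) (hne : f ≠ g)
    (h : 2 ≤ (f ∩ g).card) : {f, g} ∈ QQ G t := by
  have hd : Disjoint ({f} : Finset (Finset α)) {g} := by simpa using hne
  have := cl_union (cl_single hG hf) (cl_single hG hg) hd (by simpa using h)
  have h2 := this.2
  rw [card_union_of_disjoint hd] at h2
  simp only [QQ, mem_filter, mem_powersetCard]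
  refine ⟨⟨this.1, card_pair hne⟩, by simpa using h2⟩

theorem pair_inter_le (hG : Loc G t) {f g : Finset α} (hf : f ∈ G) (hg : g ∈ G) (hne : f ≠ g) :
    (f ∩ g).card ≤ 2 := by
  have hd : Disjoint ({f} : Finset (Finset α)) {g} := by simpa using hne
  simpa using inter_le' hG (cl_single hG hf) (cl_single hG hg) hd (by simp)

theorem QQ_inter (hG : Loc G t) {f g : Finset α} (hne : f ≠ g) (h : {f, g} ∈ QQ G t) :
    (f ∩ g).card = 2 := by
  have h1 := QQ_cl h
  have hf : f ∈ G := h1.1.1 (by simp)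
  have hg : g ∈ G := h1.1.1 (by simp)
  have h2 := h1.1.2
  rw [h1.2, show ({f, g} : Finset (Finset α)) = {f} ∪ {g} by rfl, vs_union, vs_singleton,
    vs_singleton] at h2
  have h3 := card_union_add_card_inter f g
  rw [hG.card f hf, hG.card g hg] at h3
  have := pair_inter_le hG hf hg hne
  omega

theorem vs_pair (f g : Finset α) : vs {f, g} = f ∪ g := by
  rw [show ({f, g} : Finset (Finset α)) = {f} ∪ {g} by rfl, vs_union, vs_singleton,
    vs_singleton]

/-- number of cross pairs -/
theorem four_cross (hG : Loc G t) {p : Finset (Finset α)} (hp : p ∈ QQ G t) :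
    4 ≤ (cross p).card := by
  obtain ⟨f, g, hne, rfl⟩ := card_eq_two.1 (QQ_cl hp).2
  have h1 := QQ_cl hp
  have hf : f ∈ G := h1.1.1 (by simp)
  have hg : g ∈ G := h1.1.1 (by simp)
  have hi := QQ_inter hG hne hp
  have c1 : (f \ g).card = t := by
    have := card_sdiff_add_card_inter f g
    rw [hG.card f hf] at this; omega
  have c2 : (g \ f).card = t := by
    have := card_sdiff_add_card_inter g f
    rw [hG.card g hg, inter_comm] at this; omega
  have h4 : 4 ≤ ((f \ g) ×ˢ (g \ f)).card := by
    rw [card_product, c1, c2]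
    have := hG.ht
    nlinarith
  refine h4.trans (card_le_card_of_injOn (fun x => {x.1, x.2}) ?_ ?_)
  · rintro ⟨a, b⟩ hab
    simp only [coe_product, Set.mem_prod, mem_coe, mem_sdiff] at hab
    obtain ⟨⟨a1, a2⟩, b1, b2⟩ := hab
    simp only [mem_coe, mem_cross, vs_pair]
    refine ⟨?_, card_pair (fun h => a2 (h ▸ b1)), ?_⟩
    · intro x hx
      simp only [mem_insert, mem_singleton] at hx
      rcases hx with rfl | rfl <;> simp [*]
    · intro e he
      simp only [mem_insert, mem_singleton] at he
      rcases he with rfl | rfl <;> simp [insert_subset_iff, *]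
  · rintro ⟨a, b⟩ hab ⟨a', b'⟩ hab' h
    simp only [coe_product, Set.mem_prod, mem_coe, mem_sdiff] at hab hab'
    obtain ⟨⟨a1, a2⟩, b1, b2⟩ := hab
    obtain ⟨⟨a1', a2'⟩, b1', b2'⟩ := hab'
    simp only at h a1 a2 b1 b2 a1' a2' b1' b2'
    have ha : a ∈ ({a', b'} : Finset α) := h ▸ (by simp)
    have hb : b ∈ ({a', b'} : Finset α) := h ▸ (by simp)
    simp only [mem_insert, mem_singleton] at ha hb
    grind

/-- attachments -/
structure Att (G : Finset (Finset α)) (t : ℕ) (p : Finset (Finset α)) (P : Finset α)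
    (A : Finset (Finset α)) : Prop where
  cl : Cl G t A
  sz : A.card = 1 ∨ A.card = 2
  dis : Disjoint p A
  int : vs p ∩ vs A = P

theorem att_single (hG : Loc G t) {p : Finset (Finset α)} (hp : p ∈ QQ G t) {P e : Finset α}
    (hP : P ∈ cross p) (he : e ∈ G) (hPe : P ⊆ e) : Att G t p P {e} := by
  rw [mem_cross] at hP
  obtain ⟨hPv, hP2, hPn⟩ := hP
  have hep : e ∉ p := fun h => hPn e h hPe
  have hd : Disjoint p {e} := by simpa using hep
  have h := inter_le hG (QQ_cl hp).1 (cl_single hG he) hd (T := p) subset_union_left (QQ_cl hp).1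
    (by rw [(QQ_cl hp).2, card_singleton]; simp [BES.sz])
  refine ⟨cl_single hG he, by simp, hd, ?_⟩
  exact (eq_of_subset_of_card_le (subset_inter hPv (by simpa using hPe)) (by omega)).symm

theorem att_pair (hG : Loc G t) {p q : Finset (Finset α)} (hp : p ∈ QQ G t) (hq : q ∈ QQ G t)
    (hne : p ≠ q) {P : Finset α} (hP : P ∈ cross p) (hPq : P ∈ cross q) : Att G t p P q := by
  rw [mem_cross] at hP hPq
  obtain ⟨hPv, hP2, hPn⟩ := hP
  obtain ⟨hPv', -, hPn'⟩ := hPq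
  have hd : Disjoint p q := by
    rw [Finset.disjoint_left]
    intro f hfp hfq
    obtain ⟨g, hg, hgf⟩ := exists_mem_ne (s := q) (by rw [(QQ_cl hq).2]; omega) f
    have hqe : q = {f, g} :=
      (eq_of_subset_of_card_le (insert_subset hfq (by simpa using hg))
        (by rw [(QQ_cl hq).2, card_pair hgf.symm])).symm
    have hgp : g ∉ p := by
      intro h
      apply hne
      rw [hqe]
      exact (eq_of_subset_of_card_le (insert_subset hfp (by simpa using h))
        (by rw [(QQ_cl hp).2, card_pair hgf.symm])).symm
    have hgG := (QQ_cl hq).1.1 hg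
    have hdd : Disjoint p {g} := by simpa using hgp
    have h := inter_le hG (QQ_cl hp).1 (cl_single hG hgG) hdd (T := p) subset_union_left
      (QQ_cl hp).1 (by rw [(QQ_cl hp).2, card_singleton]; simp [BES.sz])
    obtain ⟨y, hyP, hyf⟩ := not_subset.1 (hPn' f hfq)
    have hyg : y ∈ g := by
      have := hPv' hyP
      rw [hqe, vs_pair, mem_union] at this
      tauto
    have h2 := QQ_inter hG hgf.symm (hqe ▸ hq)
    have : insert y (f ∩ g) ⊆ vs p ∩ vs {g} := by
      rw [vs_singleton]
      exact insert_subset (mem_inter.2 ⟨hPv hyP, hyg⟩)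
        (inter_subset_inter (subset_vs hfp) (Subset.refl _))
    have := card_le_card this
    rw [card_insert_of_notMem (by simp [hyf]), h2] at this
    omega
  have h := inter_le' hG (QQ_cl hp).1 (QQ_cl hq).1 hd
    (by rw [(QQ_cl hp).2, (QQ_cl hq).2]; simp)
  refine ⟨(QQ_cl hq).1, Or.inr (QQ_cl hq).2, hd, ?_⟩
  exact (eq_of_subset_of_card_le (subset_inter hPv hPv') (by omega)).symm

theorem att_disj (hG : Loc G t) {p A B : Finset (Finset α)} {P R : Finset α} (hp : p ∈ QQ G t)
    (hP : P ∈ cross p) (hR : R ∈ cross p) (hPR : P ≠ R) (hA : Att G t p P A)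
    (hB : Att G t p R B) : Disjoint A B := by
  rw [mem_cross] at hP hR
  have key : ∀ X : Finset α, P ⊆ X → X ⊆ R → False := fun X h1 h2 =>
    hPR (eq_of_subset_of_card_le (h1.trans h2) (by omega))
  have key' : ∀ X : Finset α, R ⊆ X → X ⊆ P → False := fun X h1 h2 =>
    hPR (eq_of_subset_of_card_le (h1.trans h2) (by omega)).symm
  rw [Finset.disjoint_left]
  intro e heA heB
  have e1 : vs p ∩ e ⊆ P := hA.int ▸ inter_subset_inter (Subset.refl _) (subset_vs heA)
  have e2 : vs p ∩ e ⊆ R := hB.int ▸ inter_subset_inter (Subset.refl _) (subset_vs heB)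
  rcases hA.sz with h1 | h2
  · obtain ⟨e', rfl⟩ := card_eq_one.1 h1
    simp only [mem_singleton] at heA
    subst heA
    have := hA.int
    rw [vs_singleton] at this
    exact key _ this.ge e2
  rcases hB.sz with h1' | h2'
  · obtain ⟨e', rfl⟩ := card_eq_one.1 h1'
    simp only [mem_singleton] at heB
    subst heB
    have := hB.int
    rw [vs_singleton] at this
    exact key' _ this.ge e1
  obtain ⟨b, hb, hbe⟩ := exists_mem_ne (s := B) (by omega) e
  have hBe : B = {e, b} :=
    (eq_of_subset_of_card_le (insert_subset heB (by simpa using hb))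
        (by rw [h2', card_pair hbe.symm])).symm
  have hbA : b ∉ A := by
    intro h
    have : A = B := by
      rw [hBe]
      exact (eq_of_subset_of_card_le (insert_subset heA (by simpa using h))
        (by rw [h2, card_pair hbe.symm])).symm
    subst this
    exact hPR (hA.int.symm.trans hB.int)
  have hbp : b ∉ p := fun h => Finset.disjoint_left.1 hB.dis h hb
  have hbG : b ∈ G := hB.cl.1 hb
  have heG : e ∈ G := hB.cl.1 heB
  have hBQ : {e, b} ∈ QQ G t := by
    have := hB.cl.2
    rw [h2'] at this
    simp only [QQ, mem_filter, mem_powersetCard, ← hBe]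
    exact ⟨⟨hB.cl.1, h2'⟩, this⟩
  have hi := QQ_inter hG hbe.symm hBQ
  have hpA : Cl G t (p ∪ A) := cl_union (QQ_cl hp).1 hA.cl hA.dis (by rw [hA.int, hP.2.1])
  have hAb : Cl G t (A ∪ {b}) := cl_union hA.cl (cl_single hG hbG) (by simpa using hbA) (by
    rw [← hi, vs_singleton]
    exact card_le_card (inter_subset_inter (subset_vs heA) (Subset.refl _)))
  have hfin := inter_le hG hpA (cl_single hG hbG) (by simp [hbA, hbp]) (T := A ∪ {b})
    (union_subset_union subset_union_right (Subset.refl _)) hAb (by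
      rw [card_union_of_disjoint hA.dis, (QQ_cl hp).2, h2, card_singleton,
        card_union_of_disjoint (by simpa using hbA), h2, card_singleton]
      simp [BES.sz])
  have hnRe : ¬ R ⊆ e := fun h => key' (vs p ∩ e) (subset_inter hR.1 h) e1
  obtain ⟨y, hyR, hye⟩ := not_subset.1 hnRe
  have hyb : y ∈ b := by
    have h0 : R ⊆ vs B := hB.int ▸ inter_subset_right
    have := h0 hyR
    rw [hBe, vs_pair, mem_union] at this
    tauto
  have : insert y (e ∩ b) ⊆ vs (p ∪ A) ∩ vs {b} := by
    rw [vs_singleton]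
    refine insert_subset (mem_inter.2 ⟨vs_mono subset_union_left (hR.1 hyR), hyb⟩)
      (inter_subset_inter (subset_vs (mem_union_right _ heA)) (Subset.refl _))
  have := card_le_card this
  rw [card_insert_of_notMem (by simp [hye]), hi] at this
  omega

theorem att_add {p B A : Finset (Finset α)} {P : Finset α} (hP : P ∈ cross p)
    (hB : Cl G t B) (hpB : p ⊆ B) (hA : Att G t p P A) (hd : Disjoint B A) :
    Cl G t (B ∪ A) := by
  rw [mem_cross] at hP
  apply cl_union hB hA.cl hd
  rw [← hP.2.1]
  conv_lhs => rw [← hA.int]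
  exact card_le_card (inter_subset_inter (vs_mono hpB) (Subset.refl _))

end pairs
end BES

namespace BES
open Finset

variable {α : Type*} [DecidableEq α]

section fam
variable {G : Finset (Finset α)} {t : ℕ}

theorem att_family (hG : Loc G t) {p : Finset (Finset α)} (hp : p ∈ QQ G t)
    (A : Finset α → Finset (Finset α)) (I : Finset (Finset α)) (hI : I ⊆ cross p)
    (hA : ∀ P ∈ I, Att G t p P (A P)) :
    Cl G t (p ∪ I.biUnion A) ∧ (p ∪ I.biUnion A).card = 2 + ∑ P ∈ I, (A P).card := by
  induction I using Finset.induction_on with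
  | empty => simpa using QQ_cl hp
  | insert P I hPI ih =>
    obtain ⟨h1, h2⟩ := ih ((subset_insert _ _).trans hI) fun R hR => hA R (mem_insert_of_mem hR)
    have hP := hI (mem_insert_self P I)
    have hd : Disjoint (p ∪ I.biUnion A) (A P) := by
      rw [disjoint_union_left, disjoint_biUnion_left]
      refine ⟨(hA P (mem_insert_self _ _)).dis, fun R hR => ?_⟩
      exact att_disj hG hp (hI (mem_insert_of_mem hR)) hP (fun h => hPI (h ▸ hR))
        (hA R (mem_insert_of_mem hR)) (hA P (mem_insert_self _ _))
    have he : p ∪ (insert P I).biUnion A = (p ∪ I.biUnion A) ∪ A P := by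
      rw [biUnion_insert, union_comm (A P), union_assoc]
    rw [he]
    refine ⟨att_add hP h1 subset_union_left (hA P (mem_insert_self _ _)) hd, ?_⟩
    rw [card_union_of_disjoint hd, h2, sum_insert hPI]
    ring

theorem unc_le_one (hG : Loc G t) {p : Finset (Finset α)} (hp : p ∈ QQ G t)
    (A : Finset α → Finset (Finset α)) (hA : ∀ P ∈ cross p, Att G t p P (A P)) :
    ((cross p).filter (fun P => (A P).card = 2)).card ≤ 1 := by
  by_contra hcon
  push Not at hcon
  have key : ∀ I ⊆ cross p, ∑ P ∈ I, (A P).card ≠ 6 := by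
    intro I hI h
    obtain ⟨h1, h2⟩ := att_family hG hp A I hI fun P hP => hA P (hI hP)
    exact ne8 hG h1 (by omega)
  set D := (cross p).filter (fun P => (A P).card = 2) with hD
  set E := (cross p).filter (fun P => ¬ (A P).card = 2) with hE
  have hc : D.card + E.card = (cross p).card := card_filter_add_card_filter_not _
  have h4 := four_cross hG hp
  by_cases h3 : 3 ≤ D.card
  · obtain ⟨I, hI, hIc⟩ := exists_subset_card_eq h3
    apply key I (hI.trans (filter_subset _ _))
    rw [sum_congr rfl (fun P hP => (mem_filter.1 (hI hP)).2), sum_const, hIc]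
    rfl
  · obtain ⟨I, hI, hIc⟩ := exists_subset_card_eq (show 2 ≤ E.card by omega)
    apply key (D ∪ I) (union_subset (filter_subset _ _) (hI.trans (filter_subset _ _)))
    rw [sum_union (disjoint_of_subset_right hI (disjoint_filter_filter_not _ _ _)),
      sum_congr rfl (fun P hP => (mem_filter.1 hP).2), sum_const,
      sum_congr (g := fun _ => 1) rfl (fun P hP => by
        have h := mem_filter.1 (hI hP)
        have := (hA P h.1).sz
        omega), sum_const, hIc]
    have : D.card = 2 := by omega
    rw [this]; rfl

def Rel1 (G : Finset (Finset α)) (t : ℕ) (p : Finset (Finset α)) (P : Finset α) : Prop :=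
  P ∈ cross p ∧ ∀ q ∈ QQ G t, q ≠ p → P ∉ cross q

def Rel2 (G : Finset (Finset α)) (p : Finset (Finset α)) (P : Finset α) : Prop :=
  P ∈ cross p ∧ ∀ R ∈ cross p, R ≠ P → ∃ e ∈ G, R ⊆ e

theorem rel2_inj (hG : Loc G t) {p p' : Finset (Finset α)} (hp : p ∈ QQ G t) (hp' : p' ∈ QQ G t)
    {P : Finset α} (h : Rel2 G p P) (h' : Rel2 G p' P) : p = p' := by
  by_contra hne
  have hatt := att_pair hG hp hp' hne h.1 h'.1
  choose! e heG hRe using h.2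
  choose! e' heG' hRe' using h'.2
  set J := (cross p).erase P with hJ
  have hJc : 3 ≤ J.card := by
    rw [hJ, card_erase_of_mem h.1]
    have := four_cross hG hp; omega
  obtain ⟨I, hI, hIc⟩ := exists_subset_card_eq hJc
  have hPI : P ∉ I := fun hh => by simpa [hJ] using hI hh
  have hIcr : insert P I ⊆ cross p :=
    insert_subset h.1 (hI.trans (erase_subset _ _))
  let A : Finset α → Finset (Finset α) := fun R => if R = P then p' else {e R}
  have hA : ∀ R ∈ insert P I, Att G t p R (A R) := by
    intro R hR
    by_cases hRP : R = P
    · simp only [A, hRP, if_true]; exact hatt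
    · simp only [A, hRP, if_false]
      exact att_single hG hp (hIcr hR) (heG R (hIcr hR) hRP) (hRe R (hIcr hR) hRP)
  obtain ⟨hS, hSc⟩ := att_family hG hp A _ hIcr hA
  set S := p ∪ (insert P I).biUnion A with hSdef
  rw [sum_insert hPI, sum_congr (g := fun _ => 1) rfl (fun R hR => by
    have : R ≠ P := fun hh => hPI (hh ▸ hR)
    simp [A, this]), sum_const, hIc] at hSc
  simp only [A, if_true, (QQ_cl hp').2, smul_eq_mul] at hSc
  have hp'S : p' ⊆ S := by
    rw [hSdef, biUnion_insert]
    simp only [A, if_true]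
    exact subset_union_left.trans subset_union_right
  -- an edge e' covering a cross pair of p'
  obtain ⟨R', hR', hR'P⟩ := exists_mem_ne (s := cross p')
    (by have := four_cross hG hp'; omega) P
  have a' := att_single hG hp' hR' (heG' R' hR' hR'P) (hRe' R' hR' hR'P)
  set d := e' R' with hd
  have hdp' : d ∉ p' := by simpa using a'.dis
  have hdi : vs p' ∩ d = R' := by simpa using a'.int
  have hR2 := (mem_cross.1 hR').2.1
  have hP2 := (mem_cross.1 h.1).2.1
  have hR'nP : ¬ R' ⊆ P := fun hh => hR'P (eq_of_subset_of_card_le hh (by omega))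
  have hdG : d ∈ G := heG' R' hR' hR'P
  have hdS : d ∈ S := by
    by_contra hdS
    have := inter_lt8 hG hS (cl_single hG hdG) (by simpa using hdS) (by simp [hSc])
    have h2 : R' ⊆ vs S ∩ vs {d} := by
      rw [vs_singleton, ← hdi]
      exact inter_subset_inter (vs_mono hp'S) (Subset.refl _)
    have := card_le_card h2
    omega
  have hdp : d ∉ p := by
    intro hdp
    apply hR'nP
    rw [← hdi, ← hatt.int, inter_comm]
    exact inter_subset_inter (subset_vs hdp) (Subset.refl _)
  have : ∃ R ∈ I, d = e R := by
    rw [hSdef, biUnion_insert] at hdS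
    simp only [mem_union, hdp, false_or, mem_biUnion] at hdS
    rcases hdS with h0 | ⟨R, hRI, hR⟩
    · simp [A, hdp'] at h0
    · refine ⟨R, hRI, ?_⟩
      have hRP : R ≠ P := fun hh => hPI (hh ▸ hRI)
      simpa [A, hRP] using hR
  obtain ⟨R, hRI, hdR⟩ := this
  have hRP : R ≠ P := fun hh => hPI (hh ▸ hRI)
  have hRc : R ∈ cross p := hIcr (mem_insert_of_mem hRI)
  have aR := hA R (mem_insert_of_mem hRI)
  simp only [A, hRP, if_false, ← hdR] at aR
  have hi : vs p ∩ d = R := by simpa using aR.int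
  have hRR' : R ≠ R' := by
    intro hh
    apply hR'nP
    rw [← hatt.int]
    refine subset_inter ?_ (mem_cross.1 hR').1
    rw [← hh]; exact (mem_cross.1 hRc).1
  have hpp : Cl G t (p ∪ p') := cl_union (QQ_cl hp).1 (QQ_cl hp').1 hatt.dis (by
    rw [hatt.int]; omega)
  have hpd : Cl G t (p ∪ {d}) := att_add hRc (QQ_cl hp).1 (Subset.refl _) aR aR.dis
  have hfin := inter_le hG hpp (cl_single hG hdG) (by simp [hdp, hdp']) (T := p ∪ {d})
    (union_subset_union subset_union_left (Subset.refl _)) hpd (by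
      rw [card_union_of_disjoint hatt.dis, card_union_of_disjoint aR.dis, (QQ_cl hp).2,
        (QQ_cl hp').2]
      simp [sz])
  have hsub : R ∪ R' ⊆ vs (p ∪ p') ∩ vs {d} := by
    rw [vs_singleton, vs_union, union_inter_distrib_right, hi, hdi]
  have h3 := card_le_card hsub
  have hRc2 := (mem_cross.1 hRc).2.1
  have : R ∪ R' = R := (eq_of_subset_of_card_le subset_union_left (by omega)).symm
  have : R' ⊆ R := by rw [← this]; exact subset_union_right
  exact hRR' (eq_of_subset_of_card_le this (by omega)).symm

/-- data for a pair all of whose cross pairs are covered -/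
structure Rel0 (G : Finset (Finset α)) (t : ℕ) (p : Finset (Finset α)) (P : Finset α) : Prop where
  notc : ∀ q ∈ QQ G t, P ∉ cross q
  unc : ∀ e ∈ G, ¬ P ⊆ e
  two : P.card = 2
  data : ∃ S R : Finset (Finset α), Cl G t S ∧ S.card = 6 ∧ p ⊆ S ∧
    (∀ q ∈ QQ G t, q ⊆ S → q = p) ∧ (∀ e ∈ S, e ∉ p → vs p ∩ e ∈ cross p) ∧
    Cl G t R ∧ R.card = 4 ∧ R ⊆ S ∧ P ⊆ vs R

theorem rel0_inj (hG : Loc G t) {p p' : Finset (Finset α)} (hp' : p' ∈ QQ G t)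
    {P : Finset α} (h : Rel0 G t p P) (h' : Rel0 G t p' P) : p = p' := by
  by_contra hne
  obtain ⟨S, R, hS, hS6, hpS, huniq, -, hR, hR4, hRS, hPR⟩ := h.data
  obtain ⟨S', R', hS', hS6', hpS', -, hcr', hR', hR4', hRS', hPR'⟩ := h'.data
  have hp'S : ¬ p' ⊆ S := fun hh => hne (huniq p' hp' hh).symm
  by_cases hd : Disjoint S p'
  · by_cases hd2 : Disjoint S S'
    · have := inter_lt8 hG hR hR' (disjoint_of_subset_left hRS (disjoint_of_subset_right hRS' hd2))
        (by omega)
      have h2 := card_le_card (subset_inter hPR hPR')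
      have := h.two
      omega
    · obtain ⟨e, heS, heS'⟩ := not_disjoint_iff.1 hd2
      have hep' : e ∉ p' := fun hh => Finset.disjoint_left.1 hd heS hh
      have hc := hcr' e heS' hep'
      have := inter_lt8 hG hS (QQ_cl hp').1 hd (by rw [hS6, (QQ_cl hp').2])
      have h2 : vs p' ∩ e ⊆ vs S ∩ vs p' := by
        rw [inter_comm]; exact inter_subset_inter (subset_vs heS) (Subset.refl _)
      have h3 := card_le_card h2
      have := (mem_cross.1 hc).2.1
      omega
  · obtain ⟨f, hfS, hfp'⟩ := not_disjoint_iff.1 hd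
    obtain ⟨g, hgp', hgS⟩ := not_subset.1 hp'S
    have hfg : f ≠ g := fun hh => hgS (hh ▸ hfS)
    have hpe : p' = {f, g} :=
      (eq_of_subset_of_card_le (insert_subset hfp' (by simpa using hgp'))
        (by rw [(QQ_cl hp').2, card_pair hfg])).symm
    have hi := QQ_inter hG hfg (hpe ▸ hp')
    have hgG := (QQ_cl hp').1.1 hgp'
    obtain ⟨e, heS', hep'⟩ : ∃ e ∈ S', e ∉ p' := by
      by_contra hcon
      push Not at hcon
      have := card_le_card (show S' ⊆ p' from hcon)
      rw [(QQ_cl hp').2] at this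
      omega
    have hc := mem_cross.1 (hcr' e heS' hep')
    by_cases heS : e ∈ S
    · obtain ⟨y, hy, hyf⟩ := not_subset.1 (hc.2.2 f hfp')
      rw [mem_inter] at hy
      have hyg : y ∈ g := by
        have := hy.1
        rw [hpe, vs_pair, mem_union] at this
        tauto
      have h7 := inter_le7 hG hS hS6 hgG hgS
      have : insert y (f ∩ g) ⊆ vs S ∩ g :=
        insert_subset (mem_inter.2 ⟨subset_vs heS hy.2, hyg⟩)
          (inter_subset_inter (subset_vs hfS) (Subset.refl _))
      have := card_le_card this
      rw [card_insert_of_notMem (by simp [hyf]), hi] at this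
      omega
    · have hd1 : Disjoint S {g} := by simpa using hgS
      have h7 : Cl G t (S ∪ {g}) := cl_union hS (cl_single hG hgG) hd1 (by
        rw [← hi, vs_singleton]
        exact card_le_card (inter_subset_inter (subset_vs hfS) (Subset.refl _)))
      have heg : e ≠ g := fun hh => hep' (hh ▸ hgp')
      have h8 := inter_lt8 hG h7 (cl_single hG (hS'.1 heS')) (by simp [heS, heg])
        (by rw [card_union_of_disjoint hd1, hS6]; simp)
      have : vs p' ∩ e ⊆ vs (S ∪ {g}) ∩ vs {e} := by
        rw [vs_singleton]
        refine inter_subset_inter (vs_mono ?_) (Subset.refl _)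
        rw [hpe]
        exact insert_subset (mem_union_left _ hfS) subset_union_right
      have := card_le_card this
      omega

theorem rel0_exists (hG : Loc G t) {p : Finset (Finset α)} (hp : p ∈ QQ G t)
    (hcov : ∀ P ∈ cross p, ∃ e ∈ G, P ⊆ e) : ∃ P, Rel0 G t p P := by
  choose! e heG hPe using hcov
  obtain ⟨I, hI, hIc⟩ := exists_subset_card_eq (four_cross hG hp)
  let A : Finset α → Finset (Finset α) := fun R => {e R}
  have hA : ∀ R ∈ cross p, Att G t p R (A R) := fun R hR =>
    att_single hG hp hR (heG R hR) (hPe R hR)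
  have hAi : ∀ R ∈ cross p, vs p ∩ e R = R := fun R hR => by simpa [A] using (hA R hR).int
  obtain ⟨hS, hSc⟩ := att_family hG hp A I hI fun R hR => hA R (hI hR)
  obtain ⟨P1, hP1, P2, hP2, hP12⟩ := one_lt_card.1 (show 1 < I.card by omega)
  obtain ⟨hR, hRc⟩ := att_family hG hp A {P1, P2} (by
      intro x hx
      simp only [mem_insert, mem_singleton] at hx
      rcases hx with rfl | rfl
      exacts [hI hP1, hI hP2])
    fun R hR => by
      simp only [mem_insert, mem_singleton] at hR
      rcases hR with rfl | rfl
      exacts [hA _ (hI hP1), hA _ (hI hP2)]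
  rw [sum_pair hP12] at hRc
  simp only [A, card_singleton, sum_const, hIc] at hRc hSc
  set S := p ∪ I.biUnion fun R => {e R} with hSdef
  set R := p ∪ ({P1, P2} : Finset (Finset α)).biUnion fun R => {e R} with hRdef
  have hS6 : S.card = 6 := by simpa using hSc
  have hR4 : R.card = 4 := by simpa using hRc
  have hpS : p ⊆ S := subset_union_left
  have memS : ∀ d ∈ S, d ∈ p ∨ ∃ P ∈ I, d = e P := by
    intro d hd
    simpa [hSdef, eq_comm] using hd
  -- outside intersections
  have hout : ∀ P ∈ cross p, ∀ P' ∈ cross p, P ≠ P' → ∀ x ∈ e P, x ∈ e P' → x ∈ vs p := by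
    intro P hP P' hP' hne x hx hx'
    have h3 : Cl G t (p ∪ A P) := att_add hP (QQ_cl hp).1 (Subset.refl _) (hA P hP) (hA P hP).dis
    have hdd : Disjoint (p ∪ A P) (A P') := by
      rw [disjoint_union_left]
      exact ⟨(hA P' hP').dis, att_disj hG hp hP hP' hne (hA P hP) (hA P' hP')⟩
    have h4 := inter_le' hG h3 (hA P' hP').cl hdd (by
      rw [card_union_of_disjoint (hA P hP).dis, (QQ_cl hp).2]; simp [A])
    have h5 : P' ⊆ vs (p ∪ A P) ∩ vs (A P') := by
      have := (hA P' hP').int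
      conv_lhs => rw [← this]
      exact inter_subset_inter (vs_mono subset_union_left) (Subset.refl _)
    have h6 := eq_of_subset_of_card_le h5 (by rw [(mem_cross.1 hP').2.1]; exact h4)
    have : x ∈ vs (p ∪ A P) ∩ vs (A P') := by
      rw [vs_union, vs_singleton, vs_singleton]
      exact mem_inter.2 ⟨mem_union_right _ hx, hx'⟩
    rw [← h6] at this
    exact (mem_cross.1 hP').1 this
  have huniq : ∀ q ∈ QQ G t, q ⊆ S → q = p := by
    intro q hq hqS
    obtain ⟨a, b, hab, rfl⟩ := card_eq_two.1 (QQ_cl hq).2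
    have hi := QQ_inter hG hab hq
    have hmix : ∀ f ∈ p, ∀ P ∈ I, (f ∩ e P).card ≠ 2 := by
      intro f hf P hP hc
      have h1 : f ∩ e P ⊆ P := by
        conv_rhs => rw [← hAi P (hI hP)]
        exact inter_subset_inter (subset_vs hf) (Subset.refl _)
      have hm := mem_cross.1 (hI hP)
      have := eq_of_subset_of_card_le h1 (by omega)
      exact hm.2.2 f hf (this ▸ inter_subset_left)
    rcases memS a (hqS (by simp)) with ha | ⟨P, hP, rfl⟩ <;>
      rcases memS b (hqS (by simp)) with hb | ⟨P', hP', rfl⟩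
    · exact eq_of_subset_of_card_le (insert_subset ha (by simpa using hb))
        (by rw [(QQ_cl hp).2, card_pair hab])
    · exact absurd hi (hmix a ha P' hP')
    · rw [inter_comm] at hi
      exact absurd hi (hmix b hb P hP)
    · exfalso
      have hPP : P ≠ P' := fun hh => hab (by rw [hh])
      have h1 : e P ∩ e P' ⊆ P ∩ P' := by
        intro x hx
        rw [mem_inter] at hx
        have hv := hout P (hI hP) P' (hI hP') hPP x hx.1 hx.2
        rw [mem_inter]
        constructor
        · rw [← hAi P (hI hP)]; exact mem_inter.2 ⟨hv, hx.1⟩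
        · rw [← hAi P' (hI hP')]; exact mem_inter.2 ⟨hv, hx.2⟩
      have h2 := card_le_card h1
      have m1 := (mem_cross.1 (hI hP)).2.1
      have m2 := (mem_cross.1 (hI hP')).2.1
      have h3 : P ∩ P' = P := eq_of_subset_of_card_le inter_subset_left (by omega)
      have h4 : P ∩ P' = P' := eq_of_subset_of_card_le inter_subset_right (by omega)
      exact hPP (h3.symm.trans h4)
  have hcr : ∀ d ∈ S, d ∉ p → vs p ∩ d ∈ cross p := by
    intro d hd hdp
    rcases memS d hd with h | ⟨P, hP, rfl⟩
    · exact absurd h hdp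
    · rw [hAi P (hI hP)]; exact hI hP
  have hRS : R ⊆ S := by
    apply union_subset_union (Subset.refl _)
    apply biUnion_subset_biUnion_of_subset_left
    exact insert_subset hP1 (by simpa using hP2)
  -- choose vertices
  have houtc : ∀ P ∈ I, (e P \ vs p).card = t := by
    intro P hP
    have h1 := card_sdiff_add_card_inter (e P) (vs p)
    rw [hG.card _ (heG P (hI hP)), inter_comm, hAi P (hI hP), (mem_cross.1 (hI hP)).2.1] at h1
    omega
  obtain ⟨z, hz⟩ := card_pos.1 (show 0 < (e P1 \ vs p).card by
    rw [houtc P1 hP1]; have := hG.ht; omega)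
  obtain ⟨w, hw, w', hw', hww⟩ := one_lt_card.1 (show 1 < (e P2 \ vs p).card by
    rw [houtc P2 hP2]; have := hG.ht; omega)
  rw [mem_sdiff] at hz hw hw'
  have zne : ∀ x, x ∈ e P2 → z ≠ x := by
    rintro x hx rfl
    exact hz.2 (hout P1 (hI hP1) P2 (hI hP2) hP12 z hz.1 hx)
  have memR : ∀ P, (P = P1 ∨ P = P2) → e P ∈ R := by
    intro P hP
    rw [hRdef, mem_union, mem_biUnion]
    right
    exact ⟨P, by simpa using hP, by simp⟩
  have hzR : z ∈ vs R := subset_vs (memR P1 (by simp)) hz.1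
  have hwR : ∀ x ∈ e P2, x ∈ vs R := fun x hx => subset_vs (memR P2 (by simp)) hx
  have notS : ∀ x ∈ e P2, x ∉ vs p → ∀ d ∈ G, z ∈ d → x ∈ d → d ∉ S := by
    intro x hx hxp d hd hzd hxd hdS
    rcases memS d hdS with h | ⟨P, hP, rfl⟩
    · exact hz.2 (subset_vs h hzd)
    · by_cases hPP : P = P1
      · subst hPP
        exact hxp (hout P (hI hP1) P2 (hI hP2) hP12 x hxd hx)
      · exact hz.2 (hout P (hI hP) P1 (hI hP1) hPP z hzd hz.1)
  have exw : ∃ x ∈ e P2, x ∉ vs p ∧ ∀ d ∈ G, z ∈ d → x ∈ d → False := by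
    by_contra hcon
    push Not at hcon
    obtain ⟨d, hd, hzd, hwd, -⟩ := hcon w hw.1 hw.2
    obtain ⟨d', hd', hzd', hwd', -⟩ := hcon w' hw'.1 hw'.2
    have hdS := notS w hw.1 hw.2 d hd hzd hwd
    have hdS' := notS w' hw'.1 hw'.2 d' hd' hzd' hwd'
    have hzS := vs_mono hRS hzR
    have hwS := vs_mono hRS (hwR w hw.1)
    have hwS' := vs_mono hRS (hwR w' hw'.1)
    have i1 : ({z, w} : Finset α) ⊆ vs S ∩ d := by
      simp only [insert_subset_iff, singleton_subset_iff, mem_inter]; tauto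
    have i2 : ({z, w'} : Finset α) ⊆ vs S ∩ d' := by
      simp only [insert_subset_iff, singleton_subset_iff, mem_inter]; tauto
    by_cases hdd : d = d'
    · subst hdd
      have := inter_le7 hG hS hS6 hd hdS
      have i3 : ({z, w, w'} : Finset α) ⊆ vs S ∩ d := by
        simp only [insert_subset_iff, singleton_subset_iff, mem_inter]; tauto
      have := card_le_card i3
      rw [card_eq_three.2 ⟨z, w, w', zne w hw.1, zne w' hw'.1, hww, rfl⟩] at this
      omega
    · have c1 := card_le_card i1
      have c2 := card_le_card i2
      rw [card_pair (zne w hw.1)] at c1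
      rw [card_pair (zne w' hw'.1)] at c2
      have hd1 : Disjoint S {d} := by simpa using hdS
      have h7 : Cl G t (S ∪ {d}) := cl_union hS (cl_single hG hd) hd1 (by simpa using c1)
      have h8 := inter_lt8 hG h7 (cl_single hG hd') (by simp [hdS', Ne.symm hdd])
        (by rw [card_union_of_disjoint hd1, hS6]; simp)
      have : vs S ∩ d' ⊆ vs (S ∪ {d}) ∩ vs {d'} := by
        rw [vs_singleton]
        exact inter_subset_inter (vs_mono subset_union_left) (Subset.refl _)
      have := card_le_card this
      omega
  obtain ⟨x, hx, hxp, hunc⟩ := exw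
  have hzxR : ({z, x} : Finset α) ⊆ vs R := by
    simp [insert_subset_iff, hzR, hwR x hx]
  have hzxS := hzxR.trans (vs_mono hRS)
  refine ⟨{z, x}, ⟨?_, ?_, card_pair (zne x hx), S, R, hS, hS6, hpS, huniq, hcr, hR, hR4, hRS,
    hzxR⟩⟩
  · intro q hq hc
    rw [mem_cross] at hc
    by_cases hqS : q ⊆ S
    · have := huniq q hq hqS
      subst this
      exact hz.2 (hc.1 (by simp))
    · obtain ⟨b, hbq, hbS⟩ := not_subset.1 hqS
      by_cases hd : Disjoint S q
      · have h8 := inter_lt8 hG hS (QQ_cl hq).1 hd (by rw [hS6, (QQ_cl hq).2])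
        have := card_le_card (subset_inter hzxS hc.1)
        omega
      · obtain ⟨a, haS, haq⟩ := not_disjoint_iff.1 hd
        have hab : a ≠ b := fun hh => hbS (hh ▸ haS)
        have hqe : q = {a, b} :=
          (eq_of_subset_of_card_le (insert_subset haq (by simpa using hbq))
            (by rw [(QQ_cl hq).2, card_pair hab])).symm
        have hi := QQ_inter hG hab (hqe ▸ hq)
        obtain ⟨y, hy, hya⟩ := not_subset.1 (hc.2.2 a haq)
        have hyb : y ∈ b := by
          have := hc.1 hy
          rw [hqe, vs_pair, mem_union] at this
          tauto
        have h7 := inter_le7 hG hS hS6 ((QQ_cl hq).1.1 hbq) hbS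
        have : insert y (a ∩ b) ⊆ vs S ∩ b :=
          insert_subset (mem_inter.2 ⟨hzxS hy, hyb⟩)
            (inter_subset_inter (subset_vs haS) (Subset.refl _))
        have := card_le_card this
        rw [card_insert_of_notMem (by simp [hya]), hi] at this
        omega
  · intro d hd hsub
    exact hunc d hd (hsub (by simp)) (hsub (by simp))

theorem QQ_le (hG : Loc G t) [Fintype α] :
    (QQ G t).card ≤ (((univ : Finset α).powersetCard 2).filter
      (fun P => ¬ ∃ e ∈ G, P ⊆ e)).card := by
  classical
  set U := ((univ : Finset α).powersetCard 2).filter (fun P => ¬ ∃ e ∈ G, P ⊆ e) with hU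
  have memU : ∀ P, P ∈ U ↔ P.card = 2 ∧ ∀ e ∈ G, ¬ P ⊆ e := by
    intro P; simp [hU, mem_powersetCard]
  have hex : ∀ p ∈ QQ G t, ∃ P ∈ U, Rel1 G t p P ∨ Rel2 G p P ∨ Rel0 G t p P := by
    intro p hp
    by_cases hpriv : ∃ P ∈ U, Rel1 G t p P
    · obtain ⟨P, hP, h⟩ := hpriv
      exact ⟨P, hP, Or.inl h⟩
    push Not at hpriv
    have hatt : ∀ P ∈ cross p, ∃ A, Att G t p P A ∧ (P ∈ U → A.card = 2) := by
      intro P hP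
      by_cases hPU : P ∈ U
      · have := hpriv P hPU
        unfold Rel1 at this
        push Not at this
        obtain ⟨q, hq, hqp, hPq⟩ := this hP
        exact ⟨q, att_pair hG hp hq hqp.symm hP hPq, fun _ => (QQ_cl hq).2⟩
      · have h2 := (mem_cross.1 hP).2.1
        rw [memU] at hPU
        push Not at hPU
        obtain ⟨e, he, hPe⟩ := hPU h2
        refine ⟨{e}, att_single hG hp hP he hPe, fun h => ?_⟩
        exact absurd hPe (((memU P).1 h).2 e he)
    choose! A hA hA2 using hatt
    have hle := unc_le_one hG hp A hA
    by_cases hall : ∀ P ∈ cross p, ∃ e ∈ G, P ⊆ e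
    · obtain ⟨P, hP⟩ := rel0_exists hG hp hall
      exact ⟨P, (memU P).2 ⟨hP.two, hP.unc⟩, Or.inr (Or.inr hP)⟩
    · push Not at hall
      obtain ⟨P, hP, hPu⟩ := hall
      have hPU : P ∈ U := (memU P).2 ⟨(mem_cross.1 hP).2.1, hPu⟩
      refine ⟨P, hPU, Or.inr (Or.inl ⟨hP, ?_⟩)⟩
      intro R hR hRP
      by_contra hcon
      push Not at hcon
      have hRU : R ∈ U := (memU R).2 ⟨(mem_cross.1 hR).2.1, hcon⟩
      apply hRP
      rw [card_le_one] at hle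
      exact hle R (mem_filter.2 ⟨hR, hA2 R hR hRU⟩) P (mem_filter.2 ⟨hP, hA2 P hP hPU⟩)
  choose! φ hφU hφ using hex
  refine card_le_card_of_injOn φ hφU ?_
  intro p hp p' hp' heq
  rw [mem_coe] at hp hp'
  have h1 := hφ p hp
  have h2 := hφ p' hp'
  rw [← heq] at h2
  set P := φ p
  by_contra hne
  rcases h1 with h1 | h1 | h1 <;> rcases h2 with h2 | h2 | h2
  · exact h1.2 p' hp' (Ne.symm hne) h2.1
  · exact h1.2 p' hp' (Ne.symm hne) h2.1
  · exact h2.notc p hp h1.1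
  · exact h2.2 p hp hne h1.1
  · exact hne (rel2_inj hG hp hp' h1 h2)
  · exact h2.notc p hp h1.1
  · exact h1.notc p' hp' h2.1
  · exact h1.notc p' hp' h2.1
  · exact hne (rel0_inj hG hp' h1 h2)

theorem loc_bound (hG : Loc G t) [Fintype α] :
    G.card * (t + 2).choose 2 ≤ (Fintype.card α).choose 2 := by
  classical
  set Prs := (univ : Finset α).powersetCard 2 with hPrs
  let F : Finset α → Finset (Finset α) := fun P => G.filter (fun e => P ⊆ e)
  have h1 : G.card * (t + 2).choose 2 = ∑ P ∈ Prs, (F P).card := by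
    have : ∀ e ∈ G, (t + 2).choose 2 = (Prs.filter (fun P => P ⊆ e)).card := by
      intro e he
      rw [← hG.card e he, ← card_powersetCard]
      congr 1
      ext P
      simp [hPrs, mem_powersetCard, and_comm]
    rw [← smul_eq_mul, ← sum_const, sum_congr rfl this]
    simp only [F, card_filter]
    rw [sum_comm]
  have h2 : ∀ P ∈ Prs, (F P).card ≤ (if ∃ e ∈ G, P ⊆ e then 1 else 0) +
      ((F P).powersetCard 2).card := by
    intro P _
    rw [card_powersetCard]
    by_cases h0 : ∃ e ∈ G, P ⊆ e
    · rw [if_pos h0]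
      rcases Nat.lt_or_ge (F P).card 2 with h | h
      · omega
      · obtain ⟨k, hk⟩ := Nat.exists_eq_add_of_le h
        rw [hk, Nat.choose_two_right]
        have : 1 + k ≤ (2 + k) * (2 + k - 1) / 2 := by
          rw [Nat.le_div_iff_mul_le (by norm_num)]
          have : 2 + k - 1 = 1 + k := by omega
          rw [this]; nlinarith
        omega
    · have : F P = ∅ := by
        rw [filter_eq_empty_iff]
        intro e he hPe
        exact h0 ⟨e, he, hPe⟩
      simp [this]
  have h3 : ∑ P ∈ Prs, ((F P).powersetCard 2).card ≤ (QQ G t).card := by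
    have e1 : ∀ P ∈ Prs, ((F P).powersetCard 2).card ≤
        ((QQ G t).filter (fun q => ∀ e ∈ q, P ⊆ e)).card := by
      intro P hP
      apply card_le_card
      intro q hq
      rw [mem_powersetCard] at hq
      obtain ⟨a, b, hab, rfl⟩ := card_eq_two.1 hq.2
      have ha := mem_filter.1 (hq.1 (show a ∈ ({a, b} : Finset _) by simp))
      have hb := mem_filter.1 (hq.1 (show b ∈ ({a, b} : Finset _) by simp))
      rw [mem_filter]
      refine ⟨QQ_mk hG ha.1 hb.1 hab ?_, by simp [ha.2, hb.2]⟩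
      rw [← (mem_powersetCard.1 hP).2]
      exact card_le_card (subset_inter ha.2 hb.2)
    refine (sum_le_sum e1).trans ?_
    simp only [card_filter]
    rw [sum_comm, card_eq_sum_ones]
    apply sum_le_sum
    intro q hq
    rw [← card_filter, card_le_one]
    obtain ⟨a, b, hab, rfl⟩ := card_eq_two.1 (QQ_cl hq).2
    have hi := QQ_inter hG hab hq
    have : ∀ P ∈ Prs.filter (fun P => ∀ e ∈ ({a, b} : Finset (Finset α)), P ⊆ e), P = a ∩ b := by
      intro P hP
      rw [mem_filter, mem_powersetCard] at hP
      exact eq_of_subset_of_card_le (subset_inter (hP.2 a (by simp)) (hP.2 b (by simp)))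
        (by omega)
    intro P hP P' hP'
    rw [this P hP, this P' hP']
  have h4 := QQ_le hG
  rw [← hPrs] at h4
  have h5 : (Prs.filter (fun P => ∃ e ∈ G, P ⊆ e)).card +
      (Prs.filter (fun P => ¬ ∃ e ∈ G, P ⊆ e)).card = (Fintype.card α).choose 2 := by
    rw [card_filter_add_card_filter_not, hPrs, card_powersetCard, card_univ]
  have h6 := sum_le_sum h2
  rw [sum_add_distrib, ← card_filter] at h6
  omega

theorem upper_bound [Fintype α] (G : Finset (Finset α)) (t : ℕ) (ht : 2 ≤ t)
    (hc : ∀ e ∈ G, e.card = t + 2) (h8 : ∀ S ⊆ G, S.card = 8 → 8 * t + 2 < (vs S).card) :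
    G.card * (t + 2).choose 2 ≤ (Fintype.card α).choose 2 +
      168 * (t + 2).choose 2 * Fintype.card α := by
  obtain ⟨G', -, hL, hle⟩ := removal G t ht hc h8
  have := loc_bound hL
  have := Nat.mul_le_mul_right ((t + 2).choose 2) hle
  nlinarith

end fam
end BES

namespace BES
open Finset

/-- all `t+2`-subsets -/
def XX (t n : ℕ) : Finset (Finset (Fin n)) := powersetCard (t + 2) univ

/-- minimal conflicts -/
def Conf (t n : ℕ) : Finset (Finset (Finset (Fin n))) :=
  (XX t n).powerset.filter (fun C => 3 ≤ C.card ∧ C.card ≤ 8 ∧ (vs C).card = t * C.card + 2 ∧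
    ∀ C' ∈ C.powerset, C' ≠ C → 2 ≤ C'.card → t * C'.card + 3 ≤ (vs C').card)

/-- kill sets of a center -/
def KK (t n : ℕ) (a : Finset (Fin n)) : Finset (Finset (Finset (Fin n))) :=
  if a.card = 2 then ((XX t n).filter (fun f => a ⊆ f)).image (fun f => {f})
  else ((Conf t n).filter (fun C => a ∈ C)).image (fun C => C.erase a)

def DE {n : ℕ} (e : Finset (Fin n)) : Finset (Finset (Fin n)) := insert e (powersetCard 2 e)

def DD {n : ℕ} (Y : Finset (Finset (Fin n))) : Finset (Finset (Fin n)) := Y.biUnion DE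

def SS (t n : ℕ) (H : Finset (Finset (Fin n))) : Finset (Finset (Fin n)) :=
  (XX t n).filter (fun e => ∀ a ∈ DE e, ∀ κ ∈ KK t n a, ¬ κ ⊆ H)

structure Good (t n : ℕ) (Y Z : Finset (Finset (Fin n))) : Prop where
  hY : Y ⊆ XX t n
  hZ : Z ⊆ XX t n
  zz : ∀ z ∈ Z, ∀ z' ∈ Z, z ≠ z' → (z ∩ z').card ≤ 1
  yz : ∀ y ∈ Y, ∀ z ∈ Z, (y ∩ z).card ≤ 1
  yy : ∀ y ∈ Y, ∀ y' ∈ Y, y ≠ y' → (y ∩ y').card ≤ 2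
  cf : ∀ C ∈ Conf t n, C ⊆ Y ∪ Z → 2 ≤ (C ∩ Y).card

section comb
variable {t n : ℕ}

theorem mem_XX {e : Finset (Fin n)} : e ∈ XX t n ↔ e.card = t + 2 := by
  simp [XX, mem_powersetCard]

theorem mem_Conf {C : Finset (Finset (Fin n))} : C ∈ Conf t n ↔ C ⊆ XX t n ∧ 3 ≤ C.card ∧
    C.card ≤ 8 ∧ (vs C).card = t * C.card + 2 ∧
    ∀ C' ⊆ C, C' ≠ C → 2 ≤ C'.card → t * C'.card + 3 ≤ (vs C').card := by
  simp [Conf]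

theorem mem_KK_pair {a : Finset (Fin n)} (ha : a.card = 2) {κ : Finset (Finset (Fin n))} :
    κ ∈ KK t n a ↔ ∃ f ∈ XX t n, a ⊆ f ∧ κ = {f} := by
  simp only [KK, ha, if_true, mem_image, mem_filter, and_assoc, eq_comm]

theorem mem_KK_edge {a : Finset (Fin n)} (ha : a.card ≠ 2) {κ : Finset (Finset (Fin n))} :
    κ ∈ KK t n a ↔ a ∉ κ ∧ insert a κ ∈ Conf t n := by
  simp only [KK, ha, if_false, mem_image, mem_filter]
  constructor
  · rintro ⟨C, ⟨hC, haC⟩, rfl⟩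
    exact ⟨by simp, by rwa [insert_erase haC]⟩
  · rintro ⟨h1, h2⟩
    exact ⟨insert a κ, ⟨h2, by simp⟩, erase_insert h1⟩

theorem mem_DD {Y : Finset (Finset (Fin n))} {a : Finset (Fin n)} :
    a ∈ DD Y ↔ ∃ y ∈ Y, a = y ∨ (a ⊆ y ∧ a.card = 2) := by
  simp [DD, DE, mem_powersetCard]

theorem DD_edge {Y : Finset (Finset (Fin n))} {a : Finset (Fin n)} (h : a ∈ DD Y)
    (ha : a.card ≠ 2) : a ∈ Y := by
  obtain ⟨y, hy, rfl | h⟩ := mem_DD.1 h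
  exacts [hy, absurd h.2 ha]

theorem DD_sub {Y : Finset (Finset (Fin n))} {a : Finset (Fin n)} (h : a ∈ DD Y) :
    ∃ y ∈ Y, a ⊆ y := by
  obtain ⟨y, hy, rfl | h⟩ := mem_DD.1 h
  exacts [⟨a, hy, Subset.refl _⟩, ⟨y, hy, h.1⟩]

/-- a center is a pair or an edge -/
def IsC (t : ℕ) (a : Finset (Fin n)) : Prop := a.card = 2 ∨ a.card = t + 2

theorem DD_isC {Y : Finset (Finset (Fin n))} (hY : Y ⊆ XX t n) {a : Finset (Fin n)}
    (h : a ∈ DD Y) : IsC t a := by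
  by_cases ha : a.card = 2
  · exact Or.inl ha
  · exact Or.inr (mem_XX.1 (hY (DD_edge h ha)))

theorem vs_insert (a : Finset (Fin n)) (κ : Finset (Finset (Fin n))) :
    vs (insert a κ) = a ∪ vs κ := by
  simp [vs, sup_insert]

theorem conf_pair {C : Finset (Finset (Fin n))} (hC : C ∈ Conf t n) {e f : Finset (Fin n)}
    (he : e ∈ C) (hf : f ∈ C) (hne : e ≠ f) : (e ∩ f).card ≤ 1 := by
  rw [mem_Conf] at hC
  have h := hC.2.2.2.2 {e, f} (by simp [insert_subset_iff, he, hf])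
    (fun h => by
      have := hC.2.1
      rw [← h, card_pair hne] at this; omega) (by rw [card_pair hne])
  rw [card_pair hne, vs_pair] at h
  have := card_union_add_card_inter e f
  rw [mem_XX.1 (hC.1 he), mem_XX.1 (hC.1 hf)] at this
  omega

theorem KK_sub {a : Finset (Fin n)} {κ : Finset (Finset (Fin n))} (h : κ ∈ KK t n a) :
    κ ⊆ XX t n := by
  by_cases ha : a.card = 2
  · obtain ⟨f, hf, -, rfl⟩ := (mem_KK_pair ha).1 h
    simpa using hf
  · exact (subset_insert _ _).trans (mem_Conf.1 ((mem_KK_edge ha).1 h).2).1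

theorem KK_card {a : Finset (Fin n)} {κ : Finset (Finset (Fin n))} (h : κ ∈ KK t n a) :
    1 ≤ κ.card ∧ κ.card ≤ 7 := by
  by_cases ha : a.card = 2
  · obtain ⟨f, hf, -, rfl⟩ := (mem_KK_pair ha).1 h
    simp
  · have h1 := (mem_KK_edge ha).1 h
    have h2 := mem_Conf.1 h1.2
    rw [card_insert_of_notMem h1.1] at h2
    omega

theorem KK_ne {a : Finset (Fin n)} {κ : Finset (Finset (Fin n))} (h : κ ∈ KK t n a) :
    κ.Nonempty := card_pos.1 (KK_card h).1

theorem KK_vs {a : Finset (Fin n)} (hc : IsC t a) {κ : Finset (Finset (Fin n))}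
    (h : κ ∈ KK t n a) : (vs κ ∪ a).card = a.card + t * κ.card := by
  by_cases ha : a.card = 2
  · obtain ⟨f, hf, haf, rfl⟩ := (mem_KK_pair ha).1 h
    rw [vs_singleton, union_eq_left.2 haf, mem_XX.1 hf, ha]
    simp; ring
  · have h1 := (mem_KK_edge ha).1 h
    have h2 := (mem_Conf.1 h1.2).2.2.2.1
    rw [card_insert_of_notMem h1.1, vs_insert, union_comm] at h2
    rcases hc with h3 | h3
    · exact absurd h3 ha
    · rw [h2, h3]; ring

theorem KK_vs_sub {a : Finset (Fin n)} (hc : IsC t a) {κ F : Finset (Finset (Fin n))}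
    (h : κ ∈ KK t n a) (hF : F ⊆ κ) (hne : F ≠ κ) (hF0 : F.Nonempty) :
    a.card + t * F.card + 1 ≤ (vs F ∪ a).card := by
  by_cases ha : a.card = 2
  · obtain ⟨f, hf, haf, rfl⟩ := (mem_KK_pair ha).1 h
    rcases subset_singleton_iff.1 hF with h | h
    · simp [h] at hF0
    · exact absurd h hne
  · have h1 := (mem_KK_edge ha).1 h
    have haF : a ∉ F := fun h => h1.1 (hF h)
    have h2 := (mem_Conf.1 h1.2).2.2.2.2 (insert a F) (insert_subset_insert _ hF)
      (fun h => hne (by rw [← erase_insert haF, h, erase_insert h1.1]))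
      (by rw [card_insert_of_notMem haF]; have := card_pos.2 hF0; omega)
    rw [card_insert_of_notMem haF, vs_insert, union_comm] at h2
    rcases hc with h3 | h3
    · exact absurd h3 ha
    · rw [h3]; linarith

/-- sequences of fresh kill sets -/
inductive Fr (t n : ℕ) (Y Z : Finset (Finset (Fin n))) :
    Finset (Finset (Fin n)) → Finset (Finset (Fin n) × Finset (Finset (Fin n))) → Prop
  | nil : Fr t n Y Z Z ∅
  | cons {W B a κ} : Fr t n Y Z W B → a ∈ DD Y → κ ∈ KK t n a → vs κ ∩ vs (Y ∪ W) ⊆ a →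
      Fr t n Y Z (W ∪ κ) (insert (a, κ) B)

structure Inv (t n : ℕ) (Y W : Finset (Finset (Fin n)))
    (B : Finset (Finset (Fin n) × Finset (Finset (Fin n)))) : Prop where
  hY : Y ⊆ XX t n
  hW : W ⊆ XX t n
  dis : Disjoint Y W
  i1 : ∀ w ∈ W, (∀ a, a.card = 2 → (a, {w}) ∉ B) → ∀ e ∈ Y ∪ W, e ≠ w → (w ∩ e).card ≤ 1
  i2 : ∀ e ∈ Y ∪ W, ∀ e' ∈ Y ∪ W, e ≠ e' → (e ∩ e').card ≤ 2
  i3 : ∀ C ∈ Conf t n, C ⊆ Y ∪ W → 2 ≤ (C ∩ Y).card ∨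
    ∃ x ∈ B, x.1 ∈ Y ∧ C = insert x.1 x.2
  i4 : ∀ a ∈ DD Y, ∀ κ ∈ KK t n a, κ ⊆ W → (a, κ) ∈ B
  i5 : ∀ x ∈ B, x.1 ∈ DD Y ∧ x.2 ∈ KK t n x.1 ∧ x.2 ⊆ W

theorem inv_nil {Y Z : Finset (Finset (Fin n))} (h : Good t n Y Z) : Inv t n Y Z ∅ := by
  have hd : Disjoint Y Z := by
    rw [Finset.disjoint_left]
    intro e h1 h2
    have := h.yz e h1 e h2
    rw [inter_self, mem_XX.1 (h.hY h1)] at this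
    omega
  refine ⟨h.hY, h.hZ, hd, ?_, ?_, fun C hC hs => Or.inl (h.cf C hC hs), ?_, by simp⟩
  · intro w hw _ e he hne
    rcases mem_union.1 he with he | he
    · rw [inter_comm]; exact h.yz e he w hw
    · exact h.zz w hw e he hne.symm
  · intro e he e' he' hne
    rcases mem_union.1 he with he | he <;> rcases mem_union.1 he' with he' | he'
    · exact h.yy e he e' he' hne
    · exact (h.yz e he e' he').trans (by omega)
    · rw [inter_comm]; exact (h.yz e' he' e he).trans (by omega)
    · exact (h.zz e he e' he' hne).trans (by omega)
  · intro a ha κ hκ hκZ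
    exfalso
    by_cases h2 : a.card = 2
    · obtain ⟨f, hf, haf, rfl⟩ := (mem_KK_pair h2).1 hκ
      obtain ⟨y, hy, hay⟩ := DD_sub ha
      have := card_le_card (subset_inter hay haf)
      have := h.yz y hy f (hκZ (by simp))
      omega
    · have haY := DD_edge ha h2
      have h1 := (mem_KK_edge h2).1 hκ
      have h3 := h.cf _ h1.2 (insert_subset (mem_union_left _ haY) (hκZ.trans subset_union_right))
      have : insert a κ ∩ Y ⊆ {a} := by
        intro x hx
        rw [mem_inter, mem_insert] at hx
        rcases hx.1 with rfl | h5
        · simp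
        · exact absurd (hκZ h5) (Finset.disjoint_left.1 hd hx.2)
      have := card_le_card this
      simp at this
      omega

/-- a conflict meeting a fresh kill set comes from that kill set -/
theorem fresh_core (ht : 2 ≤ t) {E : Finset (Finset (Fin n))} {a : Finset (Fin n)}
    {κ C : Finset (Finset (Fin n))} (hE : E ⊆ XX t n) (haE : a.card ≠ 2 → a ∈ E)
    (hc : IsC t a)
    (h2 : ∀ e ∈ E, ∀ e' ∈ E, e ≠ e' → (e ∩ e').card ≤ 2)
    (hκ : κ ∈ KK t n a) (hfr : vs κ ∩ vs E ⊆ a) (hC : C ∈ Conf t n)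
    (hCs : C ⊆ E ∪ κ) (hm : (C ∩ κ).Nonempty) : a.card ≠ 2 ∧ C = insert a κ := by
  have hC' := mem_Conf.1 hC
  set A := C ∩ κ with hA
  set O := C \ κ with hO
  have hOE : O ⊆ E := by
    intro x hx
    rw [hO, mem_sdiff] at hx
    rcases mem_union.1 (hCs hx.1) with h | h
    exacts [h, absurd h hx.2]
  have hAO : C = O ∪ A := by rw [hO, hA, sdiff_union_inter]
  have hcard : C.card = O.card + A.card := by
    rw [hO, hA]; exact (card_sdiff_add_card_inter C κ).symm
  have hvs : vs C = vs O ∪ vs A := by rw [← vs_union, ← hAO]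
  have hin : vs O ∩ vs A ⊆ a := by
    intro x hx
    rw [mem_inter] at hx
    exact hfr (mem_inter.2 ⟨vs_mono inter_subset_right hx.2, vs_mono hOE hx.1⟩)
  have hvc := card_union_add_card_inter (vs O) (vs A)
  rw [← hvs, hC'.2.2.2.1] at hvc
  have hAne : A.card ≠ 0 := (card_pos.2 hm).ne'
  have hOd : 2 ≤ O.card → t * O.card + 3 ≤ (vs O).card := fun h =>
    hC'.2.2.2.2 O sdiff_subset (fun hh => by rw [hh] at hcard; omega) h
  by_cases h2' : a.card = 2
  · exfalso
    obtain ⟨f, hf, haf, rfl⟩ := (mem_KK_pair h2').1 hκ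
    have hAf : A = {f} := by
      rcases subset_singleton_iff.1 (show A ⊆ {f} from inter_subset_right) with h | h
      · simp [h] at hAne
      · exact h
    rw [hAf, card_singleton] at hcard
    have := hOd (by omega)
    rw [hAf, vs_singleton, mem_XX.1 hf] at hvc
    have h5 := card_le_card hin
    rw [hAf, vs_singleton] at h5
    rw [hcard] at hvc
    have : t * (O.card + 1) = t * O.card + t := by ring
    omega
  refine ⟨h2', ?_⟩
  have hk := (mem_KK_edge h2').1 hκ
  have hk2 := mem_Conf.1 hk.2
  have hac : a.card = t + 2 := by
    rcases hc with h | h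
    exacts [absurd h h2', h]
  have hin' : (vs O ∩ vs A).card + (vs A ∪ a).card ≤ (vs A).card + a.card := by
    have h1 := card_union_add_card_inter (vs A) a
    have : vs O ∩ vs A ⊆ vs A ∩ a := subset_inter inter_subset_right hin
    have := card_le_card this
    omega
  have hO1 : O.card = 1 → (vs O).card = t + 2 := by
    intro h
    obtain ⟨z, hz⟩ := card_eq_one.1 h
    rw [hz, vs_singleton]
    exact mem_XX.1 (hE (hOE (by simp [hz])))
  have hsubC : A ⊆ insert a κ := inter_subset_right.trans (subset_insert _ _)
  have hnA : A ≠ insert a κ := fun h => by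
    have : a ∈ A := by rw [h]; simp
    exact hk.1 (inter_subset_right this)
  have h0 : O.card ≠ 0 := by
    intro h
    rw [card_eq_zero] at h
    have hCA : C = A := by rw [hAO, h, empty_union]
    have := hk2.2.2.2.2 A hsubC hnA (by rw [← hCA]; omega)
    rw [← hCA, hC'.2.2.2.1] at this
    omega
  have hmul : t * C.card = t * O.card + t * A.card := by rw [hcard]; ring
  by_cases hAκ : A = κ
  · have hv := KK_vs hc hκ
    rw [← hAκ] at hv
    by_cases h1 : O.card = 1
    · obtain ⟨z, hz⟩ := card_eq_one.1 h1
      by_cases hza : z = a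
      · rw [hAO, hAκ, hz, hza]; rfl
      · exfalso
        have hzE : z ∈ E := hOE (by simp [hz])
        have hzz := h2 a (haE h2') z hzE (Ne.symm hza)
        have : vs O ∩ vs A ⊆ a ∩ z := by
          refine subset_inter hin ?_
          rw [hz, vs_singleton]; exact inter_subset_left
        have h7 := card_le_card this
        have h8 := hk2.2.2.2.2 A hsubC hnA (by omega)
        have := hO1 h1
        rw [h1] at hmul
        omega
    · exfalso
      have := hOd (by omega)
      omega
  · exfalso
    have hv : a.card + t * A.card + 1 ≤ (vs A ∪ a).card := KK_vs_sub hc hκ inter_subset_right hAκ hm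
    by_cases h1 : O.card = 1
    · have := hO1 h1
      rw [h1] at hmul
      omega
    · have := hOd (by omega)
      omega

theorem fresh_disj (ht : 2 ≤ t) {E : Finset (Finset (Fin n))} {a : Finset (Fin n)}
    {κ : Finset (Finset (Fin n))} (hc : IsC t a)
    (hκ : κ ∈ KK t n a) (hfr : vs κ ∩ vs E ⊆ a) : Disjoint E κ := by
  rw [Finset.disjoint_left]
  intro f hfE hfκ
  have hfa : f ⊆ a := (subset_inter (subset_vs hfκ) (subset_vs hfE)).trans hfr
  have hfX := mem_XX.1 (KK_sub hκ hfκ)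
  have h1 := card_le_card hfa
  by_cases h2 : a.card = 2
  · omega
  · have hac : a.card = t + 2 := by
      rcases hc with h | h
      exacts [absurd h h2, h]
    have : f = a := eq_of_subset_of_card_le hfa (by omega)
    exact ((mem_KK_edge h2).1 hκ).1 (this ▸ hfκ)

theorem fresh_inter {E : Finset (Finset (Fin n))} {a : Finset (Fin n)}
    {κ : Finset (Finset (Fin n))} (hfr : vs κ ∩ vs E ⊆ a) {f e : Finset (Fin n)} (hf : f ∈ κ)
    (he : e ∈ E) : f ∩ e ⊆ a :=
  (inter_subset_inter (subset_vs hf) (subset_vs he)).trans hfr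

theorem KK_edge_inter {a : Finset (Fin n)} (h2 : a.card ≠ 2) {κ : Finset (Finset (Fin n))}
    (hκ : κ ∈ KK t n a) {f : Finset (Fin n)} (hf : f ∈ κ) : (f ∩ a).card ≤ 1 := by
  have hk := (mem_KK_edge h2).1 hκ
  exact conf_pair hk.2 (mem_insert_of_mem hf) (mem_insert_self _ _) (fun h => hk.1 (h ▸ hf))

theorem KK_inter {a : Finset (Fin n)} {κ : Finset (Finset (Fin n))}
    (hκ : κ ∈ KK t n a) {f f' : Finset (Fin n)} (hf : f ∈ κ) (hf' : f' ∈ κ) (hne : f ≠ f') :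
    (f ∩ f').card ≤ 1 := by
  by_cases h2 : a.card = 2
  · obtain ⟨g, -, -, rfl⟩ := (mem_KK_pair h2).1 hκ
    simp only [mem_singleton] at hf hf'
    exact absurd (hf.trans hf'.symm) hne
  · have hk := (mem_KK_edge h2).1 hκ
    exact conf_pair hk.2 (mem_insert_of_mem hf) (mem_insert_of_mem hf') hne

theorem inv_cons (ht : 2 ≤ t) {Y W : Finset (Finset (Fin n))} {B a κ} (h : Inv t n Y W B)
    (ha : a ∈ DD Y) (hκ : κ ∈ KK t n a) (hfr : vs κ ∩ vs (Y ∪ W) ⊆ a) :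
    Inv t n Y (W ∪ κ) (insert (a, κ) B) := by
  have hc := DD_isC h.hY ha
  have hE : Y ∪ W ⊆ XX t n := union_subset h.hY h.hW
  have hd := fresh_disj ht hc hκ hfr
  have haE : a.card ≠ 2 → a ∈ Y ∪ W := fun h2 => mem_union_left _ (DD_edge ha h2)
  have hsm : ∀ f ∈ κ, ∀ e ∈ Y ∪ W, f ∩ e ⊆ a := fun f hf e he => fresh_inter hfr hf he
  have hcore : ∀ C ∈ Conf t n, C ⊆ Y ∪ W ∪ κ → (C ∩ κ).Nonempty → a.card ≠ 2 ∧ C = insert a κ :=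
    fun C hC hs hm => fresh_core ht hE haE hc h.i2 hκ hfr hC hs hm
  have hold : ∀ f ∈ κ, ∀ e ∈ Y ∪ W, (f ∩ e).card ≤ 2 := by
    intro f hf e he
    by_cases h2 : a.card = 2
    · rw [← h2]; exact card_le_card (hsm f hf e he)
    · have := card_le_card (subset_inter inter_subset_left (hsm f hf e he))
      have := KK_edge_inter h2 hκ hf
      omega
  refine ⟨h.hY, union_subset h.hW (KK_sub hκ), ?_, ?_, ?_, ?_, ?_, ?_⟩
  · exact disjoint_union_right.2 ⟨h.dis, disjoint_of_subset_left subset_union_left hd⟩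
  · intro w hw hnp e he hne
    rw [← union_assoc] at he
    rcases mem_union.1 hw with hw | hw
    · have hnp' : ∀ a, a.card = 2 → (a, {w}) ∉ B := fun a' h2 hh =>
        hnp a' h2 (mem_insert_of_mem hh)
      rcases mem_union.1 he with he | he
      · exact h.i1 w hw hnp' e he hne
      · rw [inter_comm]
        have h3 := hsm e he w (mem_union_right _ hw)
        by_cases h2 : a.card = 2
        · obtain ⟨y, hy, hay⟩ := DD_sub ha
          have hyw : y ≠ w := fun hh => Finset.disjoint_left.1 h.dis hy (hh ▸ hw)
          have h4 := h.i1 w hw hnp' y (mem_union_left _ hy) hyw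
          have := card_le_card (subset_inter (inter_subset_right (s₁ := e) (s₂ := w)) (h3.trans hay))
          omega
        · have := card_le_card (subset_inter inter_subset_left h3)
          have := KK_edge_inter h2 hκ he
          omega
    · have h2 : a.card ≠ 2 := by
        intro h2
        obtain ⟨g, -, -, rfl⟩ := (mem_KK_pair h2).1 hκ
        simp only [mem_singleton] at hw
        subst hw
        exact hnp a h2 (mem_insert_self _ _)
      rcases mem_union.1 he with he | he
      · have := card_le_card (subset_inter inter_subset_left (hsm w hw e he))
        have := KK_edge_inter h2 hκ hw
        omega
      · exact KK_inter hκ hw he hne.symm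
  · intro e he e' he' hne
    rw [← union_assoc] at he he'
    rcases mem_union.1 he with he | he <;> rcases mem_union.1 he' with he' | he'
    · exact h.i2 e he e' he' hne
    · rw [inter_comm]; exact hold e' he' e he
    · exact hold e he e' he'
    · exact (KK_inter hκ he he' hne).trans (by omega)
  · intro C hC hs
    rw [← union_assoc] at hs
    by_cases hm : (C ∩ κ).Nonempty
    · obtain ⟨h2, h3⟩ := hcore C hC hs hm
      exact Or.inr ⟨(a, κ), mem_insert_self _ _, DD_edge ha h2, h3⟩
    · have hs' : C ⊆ Y ∪ W := by
        intro x hx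
        rcases mem_union.1 (hs hx) with h5 | h5
        · exact h5
        · exact absurd ⟨x, mem_inter.2 ⟨hx, h5⟩⟩ hm
      rcases h.i3 C hC hs' with h5 | ⟨x, hx, h6⟩
      · exact Or.inl h5
      · exact Or.inr ⟨x, mem_insert_of_mem hx, h6⟩
  · intro a3 ha3 κ3 hκ3 hs
    by_cases hm : (κ3 ∩ κ).Nonempty
    · obtain ⟨f, hf⟩ := hm
      rw [mem_inter] at hf
      by_cases h3 : a3.card = 2
      · obtain ⟨g, hg, hag, rfl⟩ := (mem_KK_pair h3).1 hκ3
        have hfg : f = g := by simpa using hf.1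
        subst hfg
        obtain ⟨y, hy, hay⟩ := DD_sub ha3
        have hsub : a3 ⊆ a :=
          (subset_inter hag hay).trans (hsm f hf.2 y (mem_union_left _ hy))
        by_cases h2 : a.card = 2
        · have : a3 = a := eq_of_subset_of_card_le hsub (by omega)
          subst this
          obtain ⟨g, -, -, rfl⟩ := (mem_KK_pair h2).1 hκ
          have hfg : f = g := by simpa using hf.2
          subst hfg
          exact mem_insert_self _ _
        · have h4 := card_le_card (subset_inter hag hsub)
          have := KK_edge_inter h2 hκ hf.2
          omega
      · have hk3 := (mem_KK_edge h3).1 hκ3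
        have ha3Y := DD_edge ha3 h3
        obtain ⟨h2, he⟩ := hcore _ hk3.2
          (insert_subset (mem_union_left _ (mem_union_left _ ha3Y))
            (hs.trans (by rw [union_assoc]; exact subset_union_right)))
          ⟨f, mem_inter.2 ⟨mem_insert_of_mem hf.1, hf.2⟩⟩
        have h4 : a3 ∈ insert a κ := he ▸ mem_insert_self _ _
        have haa : a3 = a := by
          rcases mem_insert.1 h4 with h5 | h5
          · exact h5
          · exact absurd h5 (Finset.disjoint_left.1 hd (mem_union_left _ ha3Y))
        subst haa
        have : κ3 = κ := by
          rw [← erase_insert hk3.1, he, erase_insert ((mem_KK_edge h2).1 hκ).1]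
        subst this
        exact mem_insert_self _ _
    · refine mem_insert_of_mem (h.i4 a3 ha3 κ3 hκ3 ?_)
      intro x hx
      rcases mem_union.1 (hs hx) with h5 | h5
      · exact h5
      · exact absurd ⟨x, mem_inter.2 ⟨hx, h5⟩⟩ hm
  · intro x hx
    rcases mem_insert.1 hx with rfl | hx
    · exact ⟨ha, hκ, subset_union_right⟩
    · have := h.i5 x hx
      exact ⟨this.1, this.2.1, this.2.2.trans subset_union_left⟩

theorem fr_inv (ht : 2 ≤ t) {Y Z W : Finset (Finset (Fin n))} {B} (hg : Good t n Y Z)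
    (h : Fr t n Y Z W B) : Inv t n Y W B := by
  induction h with
  | nil => exact inv_nil hg
  | cons _ ha hκ hfr ih => exact inv_cons ht ih ha hκ hfr

/-- every used kill set is met by `T` -/
def Hits (B : Finset (Finset (Fin n) × Finset (Finset (Fin n)))) (T : Finset (Finset (Fin n))) :
    Prop := ∀ x ∈ B, (x.2 ∩ T).Nonempty

theorem inv_good {Y W T : Finset (Finset (Fin n))} {B} (h : Inv t n Y W B)
    (hT : T ⊆ W) (hv : Hits B T) : Good t n (Y ∪ T) (W \ T) := by
  have hnp : ∀ w ∈ W \ T, ∀ a, a.card = 2 → (a, {w}) ∉ B := by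
    intro w hw a _ hB
    obtain ⟨x, hx⟩ := hv _ hB
    simp only [mem_inter, mem_singleton] at hx
    exact (mem_sdiff.1 hw).2 (hx.1 ▸ hx.2)
  have hYW : Y ∪ T ⊆ Y ∪ W := union_subset_union (Subset.refl _) hT
  refine ⟨union_subset h.hY (hT.trans h.hW), sdiff_subset.trans h.hW, ?_, ?_, ?_, ?_⟩
  · intro z hz z' hz' hne
    exact h.i1 z (mem_sdiff.1 hz).1 (hnp z hz) z' (mem_union_right _ (mem_sdiff.1 hz').1) hne.symm
  · intro y hy z hz
    rw [inter_comm]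
    refine h.i1 z (mem_sdiff.1 hz).1 (hnp z hz) y (hYW hy) ?_
    rintro rfl
    rcases mem_union.1 hy with hy | hy
    · exact Finset.disjoint_left.1 h.dis hy (mem_sdiff.1 hz).1
    · exact (mem_sdiff.1 hz).2 hy
  · intro y hy y' hy' hne
    exact h.i2 y (hYW hy) y' (hYW hy') hne
  · intro C hC hs
    have hs' : C ⊆ Y ∪ W := hs.trans (union_subset hYW (sdiff_subset.trans subset_union_right))
    rcases h.i3 C hC hs' with h2 | ⟨x, hx, hxY, rfl⟩
    · exact h2.trans (card_le_card (inter_subset_inter (Subset.refl _) subset_union_left))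
    · obtain ⟨f, hf⟩ := hv x hx
      rw [mem_inter] at hf
      have hne : x.1 ≠ f := fun hh =>
        Finset.disjoint_left.1 h.dis hxY (hh ▸ hT hf.2)
      rw [← card_pair hne]
      apply card_le_card
      simp only [insert_subset_iff, singleton_subset_iff, mem_inter, mem_union, mem_insert]
      tauto

end comb
end BES

namespace BES
open Finset

section prod
variable {t n : ℕ}

/-- weight of a center -/
noncomputable def wt {n : ℕ} (π ψ : ℝ) (a : Finset (Fin n)) : ℝ := if a.card = 2 then π else ψ

noncomputable def PP {n : ℕ} (π ψ : ℝ) (Y : Finset (Finset (Fin n))) : ℝ := ∏ a ∈ DD Y, wt π ψ a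

noncomputable def om {n : ℕ} (π : ℝ) (a : Finset (Fin n)) : ℝ := if a.card = 2 then π⁻¹ else 1

theorem DD_insert (f : Finset (Fin n)) (E : Finset (Finset (Fin n))) :
    DD (insert f E) = DD E ∪ DE f := by
  rw [DD, biUnion_insert, union_comm]; rfl

theorem DE_prod (ht : 2 ≤ t) {f : Finset (Fin n)} (hf : f ∈ XX t n) (π ψ : ℝ) :
    ∏ a ∈ DE f, wt π ψ a = π ^ ((t + 2).choose 2) * ψ := by
  have hfc := mem_XX.1 hf
  rw [DE, prod_insert]
  · rw [mul_comm]
    congr 1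
    · rw [prod_congr rfl (g := fun _ => π)]
      · rw [prod_const, card_powersetCard, hfc]
      · intro a ha
        rw [wt, if_pos (mem_powersetCard.1 ha).2]
    · rw [wt, if_neg (by omega)]
  · rw [mem_powersetCard]; omega

theorem DE_cases {f a : Finset (Fin n)} (h : a ∈ DE f) : a ⊆ f ∧ (a = f ∨ a.card = 2) := by
  rw [DE, mem_insert, mem_powersetCard] at h
  rcases h with rfl | h
  · simp
  · exact ⟨h.1, Or.inr h.2⟩

theorem PP_insert (ht : 2 ≤ t) {E : Finset (Finset (Fin n))} {f : Finset (Fin n)}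
    (hE : E ⊆ XX t n) (hf : f ∈ XX t n) (h : ∀ e ∈ E, (f ∩ e).card ≤ 1) (π ψ : ℝ) :
    PP π ψ (insert f E) = PP π ψ E * (π ^ ((t + 2).choose 2) * ψ) := by
  rw [PP, DD_insert, prod_union, DE_prod ht hf]
  · rfl
  · rw [Finset.disjoint_left]
    intro a ha haf
    obtain ⟨y, hy, hay⟩ := DD_sub ha
    obtain ⟨h1, h2⟩ := DE_cases haf
    have h3 := card_le_card (subset_inter h1 hay)
    have h4 := h y hy
    have hfc := mem_XX.1 hf
    rcases h2 with rfl | h2 <;> omega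

theorem PP_insert_pair (ht : 2 ≤ t) {E : Finset (Finset (Fin n))} {f a : Finset (Fin n)}
    (hf : f ∈ XX t n) (h : ∀ e ∈ E, f ∩ e ⊆ a) (ha : a ∈ DD E) (h2 : a.card = 2)
    (haf : a ⊆ f) {π : ℝ} (hπ : π ≠ 0) (ψ : ℝ) :
    PP π ψ (insert f E) = PP π ψ E * (π ^ ((t + 2).choose 2) * ψ) * π⁻¹ := by
  have haD : a ∈ DE f := by rw [DE, mem_insert, mem_powersetCard]; exact Or.inr ⟨haf, h2⟩
  have : DD (insert f E) = DD E ∪ (DE f).erase a := by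
    rw [DD_insert]
    ext b
    simp only [mem_union, mem_erase]
    by_cases hb : b = a
    · subst hb; simp [ha]
    · simp [hb]
  rw [PP, this, prod_union, ← DE_prod ht hf, ← mul_prod_erase _ _ haD, wt, if_pos h2, ← PP]
  · field_simp
  · rw [Finset.disjoint_left]
    intro b hb hbf
    rw [mem_erase] at hbf
    obtain ⟨y, hy, hay⟩ := DD_sub hb
    obtain ⟨h3, h4⟩ := DE_cases hbf.2
    have h5 := (subset_inter h3 hay).trans (h y hy)
    have h6 := card_le_card h5
    have hfc := mem_XX.1 hf
    rcases h4 with rfl | h4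
    · omega
    · exact hbf.1 (eq_of_subset_of_card_le h5 (by omega))

theorem PP_union (ht : 2 ≤ t) {E T : Finset (Finset (Fin n))}
    (hE : E ⊆ XX t n) (hT : T ⊆ XX t n) (h : ∀ f ∈ T, ∀ e ∈ E, (f ∩ e).card ≤ 1)
    (h' : ∀ f ∈ T, ∀ e ∈ T, f ≠ e → (f ∩ e).card ≤ 1) (π ψ : ℝ) :
    PP π ψ (E ∪ T) = PP π ψ E * (π ^ ((t + 2).choose 2) * ψ) ^ T.card := by
  induction T using Finset.induction_on with
  | empty => simp
  | insert f T hfT ih =>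
    rw [insert_subset_iff] at hT
    rw [union_insert, PP_insert ht (union_subset hE hT.2) hT.1, ih hT.2, card_insert_of_notMem hfT]
    · ring
    · intro g hg; exact h g (mem_insert_of_mem hg)
    · intro g hg e he; exact h' g (mem_insert_of_mem hg) e (mem_insert_of_mem he)
    · intro e he
      rcases mem_union.1 he with he | he
      · exact h f (mem_insert_self _ _) e he
      · exact h' f (mem_insert_self _ _) e (mem_insert_of_mem he) (fun hh => hfT (hh ▸ he))

theorem fr_notMem (ht : 2 ≤ t) {Y Z W : Finset (Finset (Fin n))} {B a κ} (hg : Good t n Y Z)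
    (h : Fr t n Y Z W B) (ha : a ∈ DD Y) (hκ : κ ∈ KK t n a)
    (hfr : vs κ ∩ vs (Y ∪ W) ⊆ a) : (a, κ) ∉ B ∧ Disjoint W κ := by
  have hi := fr_inv ht hg h
  have hd := disjoint_of_subset_left subset_union_right (fresh_disj ht (DD_isC hi.hY ha) hκ hfr)
  refine ⟨fun hB => ?_, hd⟩
  obtain ⟨x, hx⟩ := KK_ne hκ
  exact Finset.disjoint_left.1 hd ((hi.i5 _ hB).2.2 hx) hx

theorem sum_powerset_union {α M : Type*} [DecidableEq α] [AddCommMonoid M] {W κ : Finset α}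
    (hd : Disjoint W κ) (F : Finset α → M) :
    ∑ T ∈ (W ∪ κ).powerset, F T = ∑ T₀ ∈ W.powerset, ∑ T₁ ∈ κ.powerset, F (T₀ ∪ T₁) := by
  rw [← sum_product']
  refine sum_bij' (fun T _ => (T ∩ W, T ∩ κ)) (fun x _ => x.1 ∪ x.2) ?_ ?_ ?_ ?_ ?_
  · intro T _; simp [inter_subset_right]
  · intro x hx
    simp only [mem_product, mem_powerset] at hx ⊢
    exact union_subset_union hx.1 hx.2
  · intro T hT
    rw [mem_powerset] at hT
    simp only
    rw [← inter_union_distrib_left, inter_eq_left.2 hT]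
  · rintro ⟨x, y⟩ hx
    simp only [mem_product, mem_powerset] at hx
    have h1 : y ∩ W = ∅ := by
      rw [← disjoint_iff_inter_eq_empty]; exact (disjoint_of_subset_right hx.2 hd).symm
    have h2 : x ∩ κ = ∅ := by
      rw [← disjoint_iff_inter_eq_empty]; exact (disjoint_of_subset_left hx.1 hd)
    simp only [union_inter_distrib_right, h1, h2, inter_eq_left.2 hx.1, inter_eq_left.2 hx.2,
      union_empty, empty_union]
  · intro T hT
    rw [mem_powerset] at hT
    simp only
    rw [← inter_union_distrib_left, inter_eq_left.2 hT]

theorem hits_cons {B : Finset (Finset (Fin n) × Finset (Finset (Fin n)))} {W κ a}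
    (hB : ∀ x ∈ B, x.2 ⊆ W) (hd : Disjoint W κ) {T₀ T₁ : Finset (Finset (Fin n))} (h0 : T₀ ⊆ W)
    (h1 : T₁ ⊆ κ) : Hits (insert (a, κ) B) (T₀ ∪ T₁) ↔ Hits B T₀ ∧ T₁.Nonempty := by
  have e1 : κ ∩ (T₀ ∪ T₁) = T₁ := by
    rw [inter_union_distrib_left, inter_eq_right.2 h1,
      disjoint_iff_inter_eq_empty.1 (disjoint_of_subset_left h0 hd).symm, empty_union]
  have e2 : ∀ x ∈ B, x.2 ∩ (T₀ ∪ T₁) = x.2 ∩ T₀ := fun x hx => by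
    rw [inter_union_distrib_left,
      disjoint_iff_inter_eq_empty.1 (disjoint_of_subset_left (hB x hx) (disjoint_of_subset_right h1 hd)),
      union_empty]
  constructor
  · intro h
    refine ⟨fun x hx => ?_, ?_⟩
    · rw [← e2 x hx]; exact h x (mem_insert_of_mem hx)
    · have := h (a, κ) (mem_insert_self _ _)
      rwa [show (a, κ).2 = κ from rfl, e1] at this
  · rintro ⟨h2, h3⟩ x hx
    rcases mem_insert.1 hx with rfl | hx
    · rw [show (a, κ).2 = κ from rfl, e1]; exact h3
    · rw [e2 x hx]; exact h2 x hx

theorem PP_fresh (ht : 2 ≤ t) {Y W : Finset (Finset (Fin n))} {B a κ} (hi : Inv t n Y W B)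
    (ha : a ∈ DD Y) (hκ : κ ∈ KK t n a) (hfr : vs κ ∩ vs (Y ∪ W) ⊆ a)
    {T₀ T₁ : Finset (Finset (Fin n))} (h0 : T₀ ⊆ W) (h1 : T₁ ⊆ κ) (hne : T₁.Nonempty)
    {π : ℝ} (hπ : π ≠ 0) (ψ : ℝ) :
    PP π ψ (Y ∪ (T₀ ∪ T₁)) =
      PP π ψ (Y ∪ T₀) * (π ^ ((t + 2).choose 2) * ψ) ^ T₁.card * om π a := by
  have hs : Y ∪ T₀ ⊆ Y ∪ W := union_subset_union (Subset.refl _) h0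
  have hX : Y ∪ T₀ ⊆ XX t n := hs.trans (union_subset hi.hY hi.hW)
  have hsm : ∀ f ∈ κ, ∀ e ∈ Y ∪ T₀, f ∩ e ⊆ a := fun f hf e he => fresh_inter hfr hf (hs he)
  rw [← union_assoc]
  by_cases h2 : a.card = 2
  · obtain ⟨f, hf, haf, rfl⟩ := (mem_KK_pair h2).1 hκ
    have : T₁ = {f} := by
      rcases subset_singleton_iff.1 h1 with h | h
      · simp [h] at hne
      · exact h
    subst this
    rw [union_comm _ {f}, ← insert_eq, PP_insert_pair ht hf (fun e he => hsm f (by simp) e he) _ h2 haf hπ]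
    · simp [om, h2]
    · rw [DD] at ha ⊢
      exact biUnion_subset_biUnion_of_subset_left _ subset_union_left ha
  · rw [PP_union ht hX (h1.trans (KK_sub hκ))]
    · simp [om, h2]
    · intro f hf e he
      have h4 := card_le_card (subset_inter inter_subset_left (hsm f (h1 hf) e he))
      exact h4.trans (KK_edge_inter h2 hκ (h1 hf))
    · intro f hf e he hne
      exact KK_inter hκ (h1 hf) (h1 he) hne

open Classical in
/-- the main algebraic identity -/
theorem fr_sum (ht : 2 ≤ t) {Y Z W : Finset (Finset (Fin n))} {B} (hg : Good t n Y Z)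
    (h : Fr t n Y Z W B) {π : ℝ} (hπ : π ≠ 0) (ψ ε H : ℝ) :
    ∑ T ∈ W.powerset, (if Hits B T then ε ^ T.card * (PP π ψ (Y ∪ T) * H ^ (W \ T).card) else 0) =
    PP π ψ Y * (H + ε * (π ^ ((t + 2).choose 2) * ψ)) ^ Z.card *
      ∏ x ∈ B, (om π x.1 * ((H + ε * (π ^ ((t + 2).choose 2) * ψ)) ^ x.2.card - H ^ x.2.card)) := by
  set y := π ^ ((t + 2).choose 2) * ψ with hy
  induction h with
  | nil =>
    have : ∀ T ∈ Z.powerset, (if Hits ∅ T then ε ^ T.card * (PP π ψ (Y ∪ T) * H ^ (Z \ T).card)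
        else 0) = PP π ψ Y * ((ε * y) ^ T.card * H ^ (Z.card - T.card)) := by
      intro T hT
      rw [mem_powerset] at hT
      rw [if_pos (by simp [Hits]), PP_union ht hg.hY (hT.trans hg.hZ), card_sdiff_of_subset hT, ← hy,
        mul_pow]
      · ring
      · intro f hf e he; rw [inter_comm]; exact hg.yz e he f (hT hf)
      · intro f hf e he hne; exact hg.zz f (hT hf) e (hT he) hne
    rw [sum_congr rfl this, ← mul_sum, Finset.sum_pow_mul_eq_add_pow]
    simp [add_comm]
  | @cons W B a κ hF ha hκ hfr ih =>
    have hi := fr_inv ht hg hF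
    obtain ⟨hnB, hd⟩ := fr_notMem ht hg hF ha hκ hfr
    rw [prod_insert hnB, sum_powerset_union hd]
    have key : ∀ T₀ ∈ W.powerset, ∑ T₁ ∈ κ.powerset, (if Hits (insert (a, κ) B) (T₀ ∪ T₁) then
        ε ^ (T₀ ∪ T₁).card * (PP π ψ (Y ∪ (T₀ ∪ T₁)) * H ^ ((W ∪ κ) \ (T₀ ∪ T₁)).card) else 0) =
        (if Hits B T₀ then ε ^ T₀.card * (PP π ψ (Y ∪ T₀) * H ^ (W \ T₀).card) else 0) *
          (om π a * ((H + ε * y) ^ κ.card - H ^ κ.card)) := by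
      intro T₀ h0
      rw [mem_powerset] at h0
      by_cases hh : Hits B T₀
      · rw [if_pos hh]
        have e1 : (H + ε * y) ^ κ.card - H ^ κ.card =
            ∑ T₁ ∈ κ.powerset, if T₁.Nonempty then (ε * y) ^ T₁.card * H ^ (κ.card - T₁.card) else 0 := by
          rw [add_comm, ← Finset.sum_pow_mul_eq_add_pow, ← sum_erase_add _ _ (empty_mem_powerset κ),
            ← sum_erase_add κ.powerset _ (empty_mem_powerset κ)]
          simp only [card_empty, pow_zero, Nat.sub_zero, one_mul, add_sub_cancel_right,
            Finset.not_nonempty_empty, if_false, add_zero]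
          apply sum_congr rfl
          intro T hT
          rw [if_pos (nonempty_iff_ne_empty.2 (mem_erase.1 hT).1)]
        rw [e1, mul_sum, mul_sum]
        apply sum_congr rfl
        intro T₁ h1
        rw [mem_powerset] at h1
        rw [hits_cons (fun x hx => (hi.i5 x hx).2.2) hd h0 h1]
        by_cases hne : T₁.Nonempty
        · rw [if_pos ⟨hh, hne⟩, if_pos hne, PP_fresh ht hi ha hκ hfr h0 h1 hne hπ, ← hy]
          have c1 : (T₀ ∪ T₁).card = T₀.card + T₁.card :=
            card_union_of_disjoint (disjoint_of_subset_left h0 (disjoint_of_subset_right h1 hd))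
          have c2 : ((W ∪ κ) \ (T₀ ∪ T₁)).card = (W \ T₀).card + (κ.card - T₁.card) := by
            rw [card_sdiff_of_subset (union_subset_union h0 h1), card_union_of_disjoint hd, c1,
              card_sdiff_of_subset h0]
            have := card_le_card h0
            have := card_le_card h1
            omega
          rw [c1, c2, pow_add, pow_add, mul_pow]
          ring
        · rw [if_neg (fun h => hne h.2), if_neg hne]; ring
      · rw [if_neg hh, zero_mul]
        apply sum_eq_zero
        intro T₁ h1
        rw [mem_powerset] at h1
        rw [hits_cons (fun x hx => (hi.i5 x hx).2.2) hd h0 h1, if_neg (fun h => hh h.1)]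
    rw [sum_congr rfl key, ← sum_mul, ih]
    ring

end prod

end BES

namespace BES
open Finset

section count
variable {t n : ℕ}

noncomputable def NN (t n : ℕ) : ℝ := ((n - 2).choose t : ℝ)

theorem count_le (hn : 1 ≤ n) (W₀ : Finset (Fin n)) (s : ℕ)
    (P : Finset (Finset (Finset (Fin n)))) (h : ∀ κ ∈ P, (vs κ \ W₀).card ≤ s) :
    P.card ≤ n ^ s * 2 ^ (2 ^ (W₀.card + s)) := by
  have hsub : P ⊆ (univ : Finset (Fin s → Fin n)).biUnion
      (fun g => (W₀ ∪ univ.image g).powerset.powerset) := by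
    intro κ hκ
    have h1 := h κ hκ
    have : ∃ g : Fin s → Fin n, vs κ \ W₀ ⊆ univ.image g := by
      set A := vs κ \ W₀ with hA
      refine ⟨fun i => if h : (i : ℕ) < A.card then A.equivFin.symm ⟨i, h⟩ else ⟨0, hn⟩, ?_⟩
      intro v hv
      rw [mem_image]
      set j := A.equivFin ⟨v, hv⟩ with hj
      refine ⟨⟨j, j.2.trans_le h1⟩, mem_univ _, ?_⟩
      simp [hj]
    obtain ⟨g, hgg⟩ := this
    rw [mem_biUnion]
    refine ⟨g, mem_univ _, ?_⟩
    rw [mem_powerset]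
    intro e he
    rw [mem_powerset]
    intro v hv
    by_cases hvW : v ∈ W₀
    · exact mem_union_left _ hvW
    · exact mem_union_right _ (hgg (mem_sdiff.2 ⟨subset_vs he hv, hvW⟩))
  refine (card_le_card hsub).trans ?_
  refine (card_biUnion_le_card_mul _ _ (2 ^ (2 ^ (W₀.card + s))) ?_).trans ?_
  · intro g _
    rw [card_powerset, card_powerset]
    refine Nat.pow_le_pow_right (by norm_num) (Nat.pow_le_pow_right (by norm_num) ?_)
    refine (card_union_le _ _).trans (Nat.add_le_add_left ?_ _)
    exact card_image_le.trans (by simp)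
  · simp

theorem NN_lower (hn : 2 * (t + 1) ≤ n) : (n : ℝ) ^ t ≤ (2 ^ t * t.factorial : ℝ) * NN t n := by
  have h1 : (n - 2 + 1 - t) ^ t ≤ (n - 2).descFactorial t := Nat.pow_sub_le_descFactorial _ _
  rw [Nat.descFactorial_eq_factorial_mul_choose] at h1
  have h2 : n ^ t ≤ (2 * (n - 2 + 1 - t)) ^ t := Nat.pow_le_pow_left (by omega) _
  rw [mul_pow] at h2
  have h3 : n ^ t ≤ 2 ^ t * (t.factorial * (n - 2).choose t) :=
    h2.trans (Nat.mul_le_mul_left _ h1)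
  have h4 : (n : ℝ) ^ t ≤ 2 ^ t * (t.factorial * ((n - 2).choose t : ℝ)) := by exact_mod_cast h3
  rw [NN]; linarith

theorem NN_pos (hn : 2 * (t + 1) ≤ n) : 0 < NN t n := by
  rw [NN]; exact_mod_cast Nat.choose_pos (by omega)

theorem NN_one (hn : 2 * (t + 1) ≤ n) : 1 ≤ NN t n := by
  rw [NN]; exact_mod_cast Nat.choose_pos (by omega)

noncomputable def CC (t M : ℕ) : ℝ := 8 * ((2 ^ t * t.factorial : ℝ) ^ 7 * 2 ^ (2 ^ (M + 7 * t)))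

theorem CC_nonneg (t M : ℕ) : 0 ≤ CC t M := by unfold CC; positivity

theorem cf_one (t : ℕ) : (1 : ℝ) ≤ 2 ^ t * t.factorial := by
  have : 1 ≤ 2 ^ t * t.factorial := Nat.mul_pos (by positivity) t.factorial_pos
  exact_mod_cast this

theorem sum_count (hn : 2 * (t + 1) ≤ n) (W₀ : Finset (Fin n)) {M : ℕ} (hM : W₀.card ≤ M) (s : ℕ)
    (F : Finset (Finset (Fin n)))
    (P : Finset (Finset (Finset (Fin n)))) (h7 : ∀ κ ∈ P, (κ \ F).card ≤ 7)
    (h : ∀ κ ∈ P, (vs κ \ W₀).card + s ≤ t * (κ \ F).card) :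
    ∑ κ ∈ P, (NN t n)⁻¹ ^ (κ \ F).card ≤ CC t M / (n : ℝ) ^ s := by
  have hNp := NN_pos hn
  have hn0 : (0 : ℝ) < n := by exact_mod_cast (by omega : 0 < n)
  have hmaps : ∀ κ ∈ P, (κ \ F).card ∈ range 8 := fun κ hκ => by
    rw [mem_range]; have := h7 κ hκ; omega
  rw [← sum_fiberwise_of_maps_to hmaps]
  have key : ∀ d ∈ range 8, ∑ κ ∈ P with (κ \ F).card = d, (NN t n)⁻¹ ^ (κ \ F).card ≤
      ((2 ^ t * t.factorial : ℝ) ^ 7 * 2 ^ (2 ^ (M + 7 * t))) / (n : ℝ) ^ s := by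
    intro d hd
    rw [mem_range] at hd
    rw [sum_congr rfl (g := fun _ => (NN t n)⁻¹ ^ d) (fun κ hκ => by rw [(mem_filter.1 hκ).2]),
      sum_const, nsmul_eq_mul]
    rcases (P.filter (fun κ => (κ \ F).card = d)).eq_empty_or_nonempty with he | ⟨κ₀, hκ₀⟩
    · rw [he]; simp; positivity
    have hsd : s ≤ t * d := by
      rw [mem_filter] at hκ₀
      have := h κ₀ hκ₀.1
      rw [hκ₀.2] at this; omega
    have hc := count_le (by omega) W₀ (t * d - s) (P.filter (fun κ => (κ \ F).card = d)) (by
      intro κ hκ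
      rw [mem_filter] at hκ
      have := h κ hκ.1
      rw [hκ.2] at this; omega)
    have hexp : W₀.card + (t * d - s) ≤ M + 7 * t := by
      have : t * d ≤ t * 7 := Nat.mul_le_mul_left _ (by omega)
      omega
    have hc2 : ((P.filter (fun κ => (κ \ F).card = d)).card : ℝ) ≤
        (n : ℝ) ^ (t * d - s) * 2 ^ (2 ^ (M + 7 * t)) := by
      have : (P.filter (fun κ => (κ \ F).card = d)).card ≤ n ^ (t * d - s) * 2 ^ (2 ^ (M + 7 * t)) :=
        hc.trans (Nat.mul_le_mul_left _ (Nat.pow_le_pow_right (by norm_num)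
          (Nat.pow_le_pow_right (by norm_num) hexp)))
      exact_mod_cast this
    rw [le_div_iff₀ (by positivity)]
    have h5 : (n : ℝ) ^ (t * d - s) * (n : ℝ) ^ s = ((n : ℝ) ^ t) ^ d := by
      rw [← pow_add, ← pow_mul]; congr 1; omega
    have h6 : ((n : ℝ) ^ t) ^ d * (NN t n)⁻¹ ^ d ≤ (2 ^ t * t.factorial : ℝ) ^ 7 := by
      rw [← mul_pow]
      have : (n : ℝ) ^ t * (NN t n)⁻¹ ≤ 2 ^ t * t.factorial := by
        rw [← div_eq_mul_inv, div_le_iff₀ hNp]; exact NN_lower hn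
      exact (pow_le_pow_left₀ (by positivity) this d).trans
        (pow_le_pow_right₀ (cf_one t) (by omega))
    calc _ ≤ (n : ℝ) ^ (t * d - s) * 2 ^ (2 ^ (M + 7 * t)) * (NN t n)⁻¹ ^ d * (n : ℝ) ^ s := by
          gcongr
      _ = ((n : ℝ) ^ (t * d - s) * (n : ℝ) ^ s) * (NN t n)⁻¹ ^ d * 2 ^ (2 ^ (M + 7 * t)) := by ring
      _ ≤ _ := by rw [h5]; gcongr
  refine (sum_le_sum key).trans ?_
  rw [sum_const, card_range, nsmul_eq_mul, CC]
  apply le_of_eq; push_cast; ring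

theorem KK_new {a : Finset (Fin n)} (hc : IsC t a) {κ F : Finset (Finset (Fin n))}
    (hκ : κ ∈ KK t n a) {W₀ : Finset (Fin n)} (ha : a ⊆ W₀) (hF : vs F ⊆ W₀) :
    (vs κ \ W₀).card ≤ t * (κ \ F).card := by
  have h1 := KK_vs hc hκ
  have h2 : a.card + t * (κ ∩ F).card ≤ (vs (κ ∩ F) ∪ a).card := by
    by_cases h3 : κ ∩ F = κ
    · rw [h3, h1]
    · by_cases h4 : (κ ∩ F).Nonempty
      · have := KK_vs_sub hc hκ inter_subset_left h3 h4; omega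
      · rw [not_nonempty_iff_eq_empty] at h4
        rw [h4]; simpa using card_le_card (subset_union_right (s₁ := vs ∅) (s₂ := a))
  have h3 : (vs (κ ∩ F) ∪ a) ⊆ W₀ := union_subset ((vs_mono inter_subset_right).trans hF) ha
  have h4 : (vs κ \ W₀).card + (vs (κ ∩ F) ∪ a).card ≤ (vs κ ∪ a).card := by
    rw [← card_union_of_disjoint]
    · apply card_le_card
      refine union_subset (sdiff_subset.trans subset_union_left)
        (union_subset_union (vs_mono inter_subset_left) (Subset.refl _))
    · exact disjoint_of_subset_right h3 sdiff_disjoint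
  have h5 := card_sdiff_add_card_inter κ F
  have : t * κ.card = t * (κ \ F).card + t * (κ ∩ F).card := by rw [← h5]; ring
  omega

theorem KK_new' {a : Finset (Fin n)} (hc : IsC t a) {κ F : Finset (Finset (Fin n))}
    (hκ : κ ∈ KK t n a) {W₀ : Finset (Fin n)} (ha : a ⊆ W₀) (hF : vs F ⊆ W₀)
    (hn : ¬ κ ⊆ F) (hfr : ¬ vs κ ∩ W₀ ⊆ a) :
    (vs κ \ W₀).card + 1 ≤ t * (κ \ F).card := by
  have h1 := KK_vs hc hκ
  have h5 := card_sdiff_add_card_inter κ F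
  have h6 : t * κ.card = t * (κ \ F).card + t * (κ ∩ F).card := by rw [← h5]; ring
  by_cases h4 : (κ ∩ F).Nonempty
  · have h2 := KK_vs_sub hc hκ inter_subset_left (fun h => hn (inter_eq_left.1 h)) h4
    have h3 : (vs (κ ∩ F) ∪ a) ⊆ W₀ := union_subset ((vs_mono inter_subset_right).trans hF) ha
    have h4 : (vs κ \ W₀).card + (vs (κ ∩ F) ∪ a).card ≤ (vs κ ∪ a).card := by
      rw [← card_union_of_disjoint]
      · apply card_le_card
        refine union_subset (sdiff_subset.trans subset_union_left)
          (union_subset_union (vs_mono inter_subset_left) (Subset.refl _))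
      · exact disjoint_of_subset_right h3 sdiff_disjoint
    omega
  · rw [not_nonempty_iff_eq_empty] at h4
    rw [h4] at h6
    have h7 : a ⊂ (vs κ ∩ W₀) ∪ a := by
      refine Finset.ssubset_iff_subset_ne.2 ⟨subset_union_right, fun h => hfr ?_⟩
      exact subset_union_left.trans (le_of_eq h.symm)
    have h8 := card_lt_card h7
    have h9 : (vs κ \ W₀).card + ((vs κ ∩ W₀) ∪ a).card ≤ (vs κ ∪ a).card := by
      rw [← card_union_of_disjoint]
      · apply card_le_card
        refine union_subset (sdiff_subset.trans subset_union_left)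
          (union_subset_union inter_subset_left (Subset.refl _))
      · exact disjoint_of_subset_right (union_subset inter_subset_right ha) sdiff_disjoint
    rw [card_empty, mul_zero, add_zero] at h6
    omega

theorem sum_KK (hn : 2 * (t + 1) ≤ n) {W₀ : Finset (Fin n)} {M : ℕ} (hM : W₀.card ≤ M)
    {F : Finset (Finset (Fin n))} {a : Finset (Fin n)} (hc : IsC t a) (ha : a ⊆ W₀)
    (hF : vs F ⊆ W₀) : ∑ κ ∈ KK t n a, (NN t n)⁻¹ ^ (κ \ F).card ≤ CC t M := by
  have := sum_count hn W₀ hM 0 F (KK t n a)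
    (fun κ hκ => (card_le_card sdiff_subset).trans (KK_card hκ).2)
    (fun κ hκ => by simpa using KK_new hc hκ ha hF)
  simpa using this

open Classical in
theorem sum_KK_nonfresh (hn : 2 * (t + 1) ≤ n) {W₀ : Finset (Fin n)} {M : ℕ} (hM : W₀.card ≤ M)
    {F : Finset (Finset (Fin n))} {a : Finset (Fin n)} (hc : IsC t a) (ha : a ⊆ W₀)
    (hF : vs F ⊆ W₀) : ∑ κ ∈ KK t n a with ¬ κ ⊆ F ∧ ¬ vs κ ∩ W₀ ⊆ a,
      (NN t n)⁻¹ ^ (κ \ F).card ≤ CC t M / n := by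
  have := sum_count hn W₀ hM 1 F ((KK t n a).filter (fun κ => ¬ κ ⊆ F ∧ ¬ vs κ ∩ W₀ ⊆ a))
    (fun κ hκ => (card_le_card sdiff_subset).trans (KK_card (mem_filter.1 hκ).1).2)
    (fun κ hκ => by
      rw [mem_filter] at hκ
      exact KK_new' hc hκ.1 ha hF hκ.2.1 hκ.2.2)
  simpa using this

/-! symmetry -/

theorem vs_map (σ : Equiv.Perm (Fin n)) (C : Finset (Finset (Fin n))) :
    vs (C.map (Finset.mapEmbedding σ.toEmbedding).toEmbedding) = (vs C).map σ.toEmbedding := by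
  ext v
  simp only [mem_vs, mem_map]
  constructor
  · rintro ⟨e, ⟨f, hf, rfl⟩, hv⟩
    simp only [RelEmbedding.coe_toEmbedding, mapEmbedding_apply, mem_map] at hv
    obtain ⟨u, hu, rfl⟩ := hv
    exact ⟨u, ⟨f, hf, hu⟩, rfl⟩
  · rintro ⟨u, ⟨f, hf, hu⟩, rfl⟩
    refine ⟨_, ⟨f, hf, rfl⟩, ?_⟩
    simp only [RelEmbedding.coe_toEmbedding, mapEmbedding_apply, mem_map]
    exact ⟨u, hu, rfl⟩

theorem Conf_map (σ : Equiv.Perm (Fin n)) {C : Finset (Finset (Fin n))} (hC : C ∈ Conf t n) :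
    C.map (Finset.mapEmbedding σ.toEmbedding).toEmbedding ∈ Conf t n := by
  rw [mem_Conf] at hC ⊢
  refine ⟨?_, by simpa using hC.2.1, by simpa using hC.2.2.1, ?_, ?_⟩
  · intro e he
    rw [mem_map] at he
    obtain ⟨f, hf, rfl⟩ := he
    rw [mem_XX]
    simpa using mem_XX.1 (hC.1 hf)
  · rw [vs_map, card_map, card_map]; exact hC.2.2.2.1
  · intro C' hs hne h2
    rw [subset_map_iff] at hs
    obtain ⟨D, hD, rfl⟩ := hs
    rw [vs_map, card_map, card_map]
    rw [card_map] at h2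
    exact hC.2.2.2.2 D hD (fun h => hne (by rw [h])) h2

theorem exists_perm {a b : Finset (Fin n)} (h : a.card = b.card) :
    ∃ σ : Equiv.Perm (Fin n), a.map σ.toEmbedding = b := by
  classical
  let e : {x // x ∈ a} ≃ {x // x ∈ b} := Finset.equivOfCardEq h
  refine ⟨e.extendSubtype, ?_⟩
  apply eq_of_subset_of_card_le
  · intro x hx
    rw [mem_map] at hx
    obtain ⟨u, hu, rfl⟩ := hx
    exact e.extendSubtype_mem u hu
  · rw [card_map, h]

theorem Gam_le (i : ℕ) {a b : Finset (Fin n)} (ht : 2 ≤ t) (ha : a ∈ XX t n) (hb : b ∈ XX t n) :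
    ((KK t n a).filter (fun κ => κ.card = i)).card ≤ ((KK t n b).filter (fun κ => κ.card = i)).card := by
  obtain ⟨σ, hσ⟩ := exists_perm ((mem_XX.1 ha).trans (mem_XX.1 hb).symm)
  have ha2 : a.card ≠ 2 := by rw [mem_XX.1 ha]; omega
  have hb2 : b.card ≠ 2 := by rw [mem_XX.1 hb]; omega
  apply card_le_card_of_injOn (fun κ => κ.map (Finset.mapEmbedding σ.toEmbedding).toEmbedding)
  · intro κ hκ
    simp only [coe_filter, Set.mem_ofPred_eq, mem_KK_edge ha2, mem_KK_edge hb2] at hκ ⊢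
    have h1 := Conf_map σ hκ.1.2
    rw [map_insert] at h1
    have hσ' : (Finset.mapEmbedding σ.toEmbedding).toEmbedding a = b := hσ
    rw [hσ'] at h1
    refine ⟨⟨?_, h1⟩, by simpa using hκ.2⟩
    rw [← hσ', mem_map']
    exact hκ.1.1
  · intro κ _ κ' _ h
    exact map_injective _ h

theorem Gam_eq (i : ℕ) {a b : Finset (Fin n)} (ht : 2 ≤ t) (ha : a ∈ XX t n) (hb : b ∈ XX t n) :
    ((KK t n a).filter (fun κ => κ.card = i)).card = ((KK t n b).filter (fun κ => κ.card = i)).card :=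
  le_antisymm (Gam_le i ht ha hb) (Gam_le i ht hb ha)

/-- normalized conflict degrees -/
noncomputable def cc (t n i : ℕ) : ℝ :=
  (∑ a ∈ XX t n, (((KK t n a).filter (fun κ => κ.card = i)).card : ℝ)) / (XX t n).card * (NN t n)⁻¹ ^ i

theorem cc_eq (i : ℕ) {a : Finset (Fin n)} (ht : 2 ≤ t) (ha : a ∈ XX t n) :
    cc t n i = (((KK t n a).filter (fun κ => κ.card = i)).card : ℝ) * (NN t n)⁻¹ ^ i := by
  have hX : ((XX t n).card : ℝ) ≠ 0 := by exact_mod_cast (card_pos.2 ⟨a, ha⟩).ne'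
  rw [cc, sum_congr rfl (fun b hb => by rw [Gam_eq i ht hb ha]), sum_const, nsmul_eq_mul]
  field_simp

theorem cc_nonneg (t n i : ℕ) : 0 ≤ cc t n i := by
  unfold cc NN; positivity

theorem XX_ne (hn : 2 * (t + 1) ≤ n) : (XX t n).Nonempty := by
  rw [XX, powersetCard_nonempty]; simp; omega

theorem cc_le (hn : 2 * (t + 1) ≤ n) (ht : 2 ≤ t) (i : ℕ) : cc t n i ≤ CC t (t + 2) := by
  obtain ⟨a, ha⟩ := XX_ne hn
  rw [cc_eq i ht ha]
  have h := sum_KK hn (W₀ := a) (M := t + 2) (mem_XX.1 ha).le (F := ∅) (Or.inr (mem_XX.1 ha))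
    (Subset.refl _) (by simp [vs])
  refine le_trans ?_ h
  have : ∑ κ ∈ (KK t n a).filter (fun κ => κ.card = i), (NN t n)⁻¹ ^ (κ \ ∅).card =
      (((KK t n a).filter (fun κ => κ.card = i)).card : ℝ) * (NN t n)⁻¹ ^ i := by
    rw [sum_congr rfl (g := fun _ => (NN t n)⁻¹ ^ i) (fun κ hκ => by
      rw [sdiff_empty, (mem_filter.1 hκ).2]), sum_const, nsmul_eq_mul]
  rw [← this]
  apply sum_le_sum_of_subset_of_nonneg (filter_subset _ _)
  intros
  have := NN_pos hn
  positivity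

theorem lam_edge (ht : 2 ≤ t) {a : Finset (Fin n)} (ha : a ∈ XX t n) (φ : ℕ → ℝ) :
    ∑ κ ∈ KK t n a, φ κ.card * (NN t n)⁻¹ ^ κ.card = ∑ i ∈ range 8, cc t n i * φ i := by
  have hmaps : ∀ κ ∈ KK t n a, κ.card ∈ range 8 := fun κ hκ => by
    rw [mem_range]; have := (KK_card hκ).2; omega
  rw [← sum_fiberwise_of_maps_to hmaps]
  apply sum_congr rfl
  intro i _
  rw [sum_congr rfl (g := fun _ => φ i * (NN t n)⁻¹ ^ i) (fun κ hκ => by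
      rw [(mem_filter.1 hκ).2]), sum_const, nsmul_eq_mul, cc_eq i ht ha]
  ring

theorem card_pair_sup (a : Finset (Fin n)) (ha : a.card = 2) :
    ((XX t n).filter (fun f => a ⊆ f)).card = (n - 2).choose t := by
  have : ((XX t n).filter (fun f => a ⊆ f)) = (powersetCard t aᶜ).image (fun s => a ∪ s) := by
    ext f
    simp only [mem_filter, mem_XX, mem_image, mem_powersetCard]
    constructor
    · rintro ⟨h1, h2⟩
      refine ⟨f \ a, ⟨fun x hx => by simpa using (mem_sdiff.1 hx).2, ?_⟩, union_sdiff_of_subset h2⟩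
      rw [card_sdiff_of_subset h2]; omega
    · rintro ⟨s, ⟨h1, h2⟩, rfl⟩
      refine ⟨?_, subset_union_left⟩
      rw [card_union_of_disjoint, ha, h2]; · ring
      exact disjoint_of_subset_right h1 disjoint_compl_right
  rw [this, card_image_of_injOn, card_powersetCard, card_compl, ha, Fintype.card_fin]
  intro s hs s' hs' h
  simp only [mem_coe, mem_powersetCard] at hs hs'
  have h3 : ∀ s : Finset (Fin n), s ⊆ aᶜ → (a ∪ s) \ a = s := fun s hs => by
    rw [union_sdiff_left, Finset.sdiff_eq_self_iff_disjoint]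
    exact (disjoint_of_subset_right hs disjoint_compl_right).symm
  have h' : a ∪ s = a ∪ s' := h
  rw [← h3 s hs.1, h', h3 s' hs'.1]

theorem lam_pair (hn : 2 * (t + 1) ≤ n) {a : Finset (Fin n)} (ha : a.card = 2) (φ : ℕ → ℝ) :
    ∑ κ ∈ KK t n a, φ κ.card * (NN t n)⁻¹ ^ κ.card = φ 1 := by
  rw [KK, if_pos ha, sum_image (by intro x _ y _ h; simpa using h)]
  simp only [card_singleton, pow_one, sum_const, nsmul_eq_mul, card_pair_sup a ha]
  have := NN_pos hn
  rw [NN] at this ⊢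
  field_simp

end count
end BES

namespace BES
open Finset

section op

/-- expectation over a `p`-random subset of `X` -/
noncomputable def Ep {α : Type*} [DecidableEq α] (X : Finset α) (p : ℝ) :
    (Finset α → ℝ) →ₗ[ℝ] ℝ :=
  ∑ R ∈ X.powerset, (p ^ R.card * (1 - p) ^ (X.card - R.card)) • LinearMap.proj R

variable {α : Type*} [DecidableEq α] {X : Finset α} {p : ℝ}

theorem Ep_apply (f : Finset α → ℝ) :
    Ep X p f = ∑ R ∈ X.powerset, p ^ R.card * (1 - p) ^ (X.card - R.card) * f R := by
  simp [Ep, LinearMap.sum_apply]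

theorem Ep_nonneg (hp : 0 ≤ p) (hp1 : p ≤ 1) {f : Finset α → ℝ} (hf : ∀ R, 0 ≤ f R) :
    0 ≤ Ep X p f := by
  rw [Ep_apply]
  have : 0 ≤ 1 - p := by linarith
  exact sum_nonneg (fun R _ => mul_nonneg (by positivity) (hf R))

theorem Ep_sub {T : Finset α} (hT : T ⊆ X) :
    Ep X p (fun R => if T ⊆ R then 1 else 0) = p ^ T.card := by
  rw [Ep_apply]
  have hd : Disjoint T (X \ T) := disjoint_sdiff
  have hX : X = T ∪ (X \ T) := (union_sdiff_of_subset hT).symm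
  conv_lhs => rw [hX]
  rw [sum_powerset_union hd, sum_eq_single T]
  · have : ∀ R ∈ (X \ T).powerset, p ^ (T ∪ R).card * (1 - p) ^ ((T ∪ X \ T).card - (T ∪ R).card) *
        (if T ⊆ T ∪ R then (1 : ℝ) else 0) = p ^ T.card * (p ^ R.card * (1 - p) ^ ((X \ T).card - R.card)) := by
      intro R hR
      rw [mem_powerset] at hR
      rw [if_pos subset_union_left, card_union_of_disjoint (disjoint_of_subset_right hR hd),
        card_union_of_disjoint hd, Nat.add_sub_add_left, pow_add]
      ring
    rw [sum_congr rfl this, ← mul_sum, Finset.sum_pow_mul_eq_add_pow]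
    simp
  · intro T' hT' hne
    apply sum_eq_zero
    intro R hR
    rw [mem_powerset] at hT' hR
    rw [if_neg, mul_zero]
    intro h
    apply hne
    apply Subset.antisymm hT'
    intro x hx
    rcases mem_union.1 (h hx) with h1 | h1
    · exact h1
    · exact absurd (hR h1) (fun h2 => (mem_sdiff.1 h2).2 hx)
  · intro h; exact absurd (mem_powerset_self T) h

end op

section ex

variable (t n : ℕ) (p : ℝ)

/-- expectation after `i` rounds -/
noncomputable def Ex : ℕ → ((Finset (Finset (Fin n)) → ℝ) →ₗ[ℝ] ℝ)
  | 0 => LinearMap.proj ∅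
  | i + 1 => (Ex i) ∘ₗ (LinearMap.pi (fun H => (Ep (XX t n) p) ∘ₗ
      (LinearMap.pi (fun R => LinearMap.proj (H ∪ (R ∩ SS t n H))))))

/-- expectation after `i` rounds and the random set of the next round -/
noncomputable def E2 (i : ℕ) :
    (Finset (Finset (Fin n)) → Finset (Finset (Fin n)) → ℝ) →ₗ[ℝ] ℝ :=
  (Ex t n p i) ∘ₗ (LinearMap.compLeft (Ep (XX t n) p) _)

variable {t n p}

theorem E2_apply (i : ℕ) (F : Finset (Finset (Fin n)) → Finset (Finset (Fin n)) → ℝ) :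
    E2 t n p i F = Ex t n p i (fun H => Ep (XX t n) p (F H)) := rfl

theorem Ex_succ (i : ℕ) (Φ : Finset (Finset (Fin n)) → ℝ) :
    Ex t n p (i + 1) Φ = E2 t n p i (fun H R => Φ (H ∪ (R ∩ SS t n H))) := rfl

theorem Ex_nonneg (hp : 0 ≤ p) (hp1 : p ≤ 1) (i : ℕ) {Φ : Finset (Finset (Fin n)) → ℝ}
    (h : ∀ H, 0 ≤ Φ H) : 0 ≤ Ex t n p i Φ := by
  induction i generalizing Φ with
  | zero => exact h ∅
  | succ i ih => exact ih (fun H => Ep_nonneg hp hp1 (fun R => h _))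

theorem Ex_mono (hp : 0 ≤ p) (hp1 : p ≤ 1) (i : ℕ) {Φ Ψ : Finset (Finset (Fin n)) → ℝ}
    (h : ∀ H, Φ H ≤ Ψ H) : Ex t n p i Φ ≤ Ex t n p i Ψ := by
  have := Ex_nonneg (t := t) hp hp1 i (Φ := Ψ - Φ) (fun H => by simpa using h H)
  rw [map_sub] at this; linarith

theorem E2_nonneg (hp : 0 ≤ p) (hp1 : p ≤ 1) (i : ℕ)
    {F : Finset (Finset (Fin n)) → Finset (Finset (Fin n)) → ℝ}
    (h : ∀ H R, 0 ≤ F H R) : 0 ≤ E2 t n p i F :=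
  Ex_nonneg hp hp1 i (fun H => Ep_nonneg hp hp1 (fun R => h H R))

theorem E2_mono (hp : 0 ≤ p) (hp1 : p ≤ 1) (i : ℕ)
    {F G : Finset (Finset (Fin n)) → Finset (Finset (Fin n)) → ℝ}
    (h : ∀ H R, F H R ≤ G H R) : E2 t n p i F ≤ E2 t n p i G := by
  have := E2_nonneg (t := t) hp hp1 i (F := G - F) (fun H R => by simpa using h H R)
  rw [map_sub] at this; linarith

theorem Ep_one : Ep (XX t n) p (fun _ => 1) = 1 := by
  have := Ep_sub (p := p) (empty_subset (XX t n))
  simpa using this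

theorem Ex_one (i : ℕ) : Ex t n p i (fun _ => 1) = 1 := by
  induction i with
  | zero => rfl
  | succ i ih => rw [Ex_succ, E2_apply]; simp only [Ep_one]; exact ih

theorem Ex_exists (hp : 0 ≤ p) (hp1 : p ≤ 1) (i : ℕ) (Φ : Finset (Finset (Fin n)) → ℝ) :
    ∃ H, Ex t n p i Φ ≤ Φ H := by
  by_contra! h
  obtain ⟨H₀, -, hmax⟩ := (univ : Finset (Finset (Finset (Fin n)))).exists_max_image Φ ⟨∅, mem_univ _⟩
  have h1 := Ex_mono (t := t) hp hp1 i (Φ := Φ) (Ψ := Φ H₀ • (fun _ => 1))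
    (fun H => by simpa using hmax H (mem_univ _))
  rw [map_smul, Ex_one] at h1
  have := h H₀
  simp at h1
  linarith

/-! facts on `SS` -/

theorem mem_SS {H : Finset (Finset (Fin n))} {e : Finset (Fin n)} :
    e ∈ SS t n H ↔ e ∈ XX t n ∧ ∀ a ∈ DE e, ∀ κ ∈ KK t n a, ¬ κ ⊆ H := by
  simp [SS]

theorem SS_anti {H H' : Finset (Finset (Fin n))} (h : H ⊆ H') : SS t n H' ⊆ SS t n H := by
  intro e he
  rw [mem_SS] at he ⊢
  exact ⟨he.1, fun a ha κ hκ hs => he.2 a ha κ hκ (hs.trans h)⟩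

theorem SS_disj {H : Finset (Finset (Fin n))} : Disjoint (SS t n H) H := by
  rw [Finset.disjoint_left]
  intro e he heH
  rw [mem_SS] at he
  obtain ⟨a, ha, ha2⟩ := exists_subset_card_eq (s := e) (n := 2) (by rw [mem_XX.1 he.1]; omega)
  refine he.2 a (by rw [DE, mem_insert, mem_powersetCard]; exact Or.inr ⟨ha, ha2⟩) {e}
    ((mem_KK_pair ha2).2 ⟨e, he.1, ha, rfl⟩) (by simpa using heH)

theorem sub_SS_iff {Y H : Finset (Finset (Fin n))} (hY : Y ⊆ XX t n) :
    Y ⊆ SS t n H ↔ ∀ a ∈ DD Y, ∀ κ ∈ KK t n a, ¬ κ ⊆ H := by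
  constructor
  · intro h a ha
    rw [DD, mem_biUnion] at ha
    obtain ⟨y, hy, hay⟩ := ha
    exact (mem_SS.1 (h hy)).2 a hay
  · intro h y hy
    exact mem_SS.2 ⟨hY hy, fun a ha => h a (by rw [DD, mem_biUnion]; exact ⟨y, hy, ha⟩)⟩

/-- joint probability -/
noncomputable def qq (t n : ℕ) (p : ℝ) (i : ℕ) (Y Z : Finset (Finset (Fin n))) : ℝ :=
  Ex t n p i (fun H => if Y ⊆ SS t n H ∧ Z ⊆ H then 1 else 0)

theorem qq_zero (i : ℕ) {Y Z : Finset (Finset (Fin n))} (hY : Y ⊆ XX t n) {a κ} (ha : a ∈ DD Y)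
    (hκ : κ ∈ KK t n a) (hs : κ ⊆ Z) : qq t n p i Y Z = 0 := by
  rw [qq]
  have : (fun H => if Y ⊆ SS t n H ∧ Z ⊆ H then (1 : ℝ) else 0) = 0 := by
    funext H
    rw [if_neg]
    · rfl
    rintro ⟨h1, h2⟩
    exact (sub_SS_iff hY).1 h1 a ha κ hκ (hs.trans h2)
  rw [this, map_zero]

theorem qq_nonneg (hp : 0 ≤ p) (hp1 : p ≤ 1) (i : ℕ) (Y Z : Finset (Finset (Fin n))) :
    0 ≤ qq t n p i Y Z := Ex_nonneg hp hp1 i (fun H => by split_ifs <;> norm_num)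

theorem Ep_step {W H : Finset (Finset (Fin n))} :
    Ep (XX t n) p (fun R => if W ⊆ H ∪ (R ∩ SS t n H) then 1 else 0) =
      ∑ T ∈ W.powerset, p ^ T.card * (if T ⊆ SS t n H ∧ W \ T ⊆ H then 1 else 0) := by
  have hd : Disjoint (SS t n H) H := SS_disj
  have hSX : SS t n H ⊆ XX t n := filter_subset _ _
  have h1 : ∀ R, (W ⊆ H ∪ (R ∩ SS t n H)) ↔ (W \ H ⊆ SS t n H ∧ W \ H ⊆ R) := by
    intro R
    rw [← subset_inter_iff, inter_comm]
    constructor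
    · intro h x hx
      rw [mem_sdiff] at hx
      rcases mem_union.1 (h hx.1) with h2 | h2
      · exact absurd h2 hx.2
      · exact h2
    · intro h x hx
      by_cases hH : x ∈ H
      · exact mem_union_left _ hH
      · exact mem_union_right _ (h (mem_sdiff.2 ⟨hx, hH⟩))
  simp only [h1]
  rw [sum_eq_single (W \ H)]
  · have h2 : W \ (W \ H) ⊆ H := by intro x hx; simp at hx; exact hx.2
    by_cases hs : W \ H ⊆ SS t n H
    · simp only [hs, h2, true_and, and_self, if_true, mul_one]
      exact Ep_sub (hs.trans hSX)
    · simp only [hs, false_and, if_false, mul_zero]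
      exact map_zero _
  · intro T hT hne
    rw [if_neg, mul_zero]
    rintro ⟨h2, h3⟩
    apply hne
    rw [mem_powerset] at hT
    ext x
    rw [mem_sdiff]
    constructor
    · intro hx
      exact ⟨hT hx, Finset.disjoint_left.1 hd (h2 hx)⟩
    · rintro ⟨hx, hxH⟩
      by_contra hxT
      exact hxH (h3 (mem_sdiff.2 ⟨hx, hxT⟩))
  · intro h; exact absurd (mem_powerset.2 sdiff_subset) h

/-- one step identity -/
theorem E2_step (i : ℕ) (Y W : Finset (Finset (Fin n))) :
    E2 t n p i (fun H R => if Y ⊆ SS t n H ∧ W ⊆ H ∪ (R ∩ SS t n H) then 1 else 0) =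
      ∑ T ∈ W.powerset, p ^ T.card * qq t n p i (Y ∪ T) (W \ T) := by
  rw [E2_apply]
  have : (fun H => Ep (XX t n) p (fun R => if Y ⊆ SS t n H ∧ W ⊆ H ∪ (R ∩ SS t n H) then 1 else 0)) =
      ∑ T ∈ W.powerset, p ^ T.card •
        (fun H => if Y ∪ T ⊆ SS t n H ∧ W \ T ⊆ H then (1 : ℝ) else 0) := by
    funext H
    rw [Finset.sum_apply]
    by_cases hY : Y ⊆ SS t n H
    · simp only [hY, true_and, union_subset_iff]
      rw [Ep_step]
      simp only [Pi.smul_apply, smul_eq_mul, hY, true_and]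
    · simp only [hY, false_and, if_false, union_subset_iff]
      rw [sum_eq_zero]
      · exact map_zero _
      · intro T _; simp [hY]
  rw [this, map_sum]
  apply sum_congr rfl
  intro T _
  rw [map_smul]; rfl

theorem ite_le_ite {P Q : Prop} [Decidable P] [Decidable Q] (h : P → Q) :
    (if P then (1 : ℝ) else 0) ≤ if Q then 1 else 0 := by
  by_cases hP : P
  · simp [hP, h hP]
  · simp only [hP, if_false]; split_ifs <;> norm_num

theorem Ex_crude (hp : 0 ≤ p) (hp1 : p ≤ 1) (i : ℕ) (Z : Finset (Finset (Fin n))) :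
    Ex t n p i (fun H => if Z ⊆ H then 1 else 0) ≤ (i * p) ^ Z.card := by
  induction i generalizing Z with
  | zero =>
    rcases Z.eq_empty_or_nonempty with rfl | h
    · simp [Ex]
    · simp [Ex, h.ne_empty]
  | succ i ih =>
    have h1 := E2_step (t := t) (p := p) i ∅ Z
    simp only [empty_subset, true_and, empty_union] at h1
    rw [Ex_succ, h1]
    have : ∀ T ∈ Z.powerset, p ^ T.card * qq t n p i T (Z \ T) ≤
        p ^ T.card * (i * p) ^ (Z.card - T.card) := by
      intro T hT
      rw [mem_powerset] at hT
      apply mul_le_mul_of_nonneg_left _ (by positivity)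
      rw [← card_sdiff_of_subset hT]
      refine le_trans (Ex_mono hp hp1 i (fun H => ?_)) (ih (Z \ T))
      exact ite_le_ite (fun h => h.2)
    refine (sum_le_sum this).trans ?_
    rw [Finset.sum_pow_mul_eq_add_pow]
    apply le_of_eq; push_cast; ring

theorem E2_crude (hp : 0 ≤ p) (hp1 : p ≤ 1) (i : ℕ) (Y W : Finset (Finset (Fin n))) :
    E2 t n p i (fun H R => if Y ⊆ SS t n H ∧ W ⊆ H ∪ (R ∩ SS t n H) then 1 else 0) ≤
      ((i + 1 : ℕ) * p) ^ W.card := by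
  refine le_trans (E2_mono hp hp1 i (fun H R => ?_)) (Ex_crude (t := t) hp hp1 (i + 1) W)
  exact ite_le_ite (fun h => h.2)

/-! Bonferroni -/

def EE (t n : ℕ) (Y : Finset (Finset (Fin n))) :
    Finset (Finset (Fin n) × Finset (Finset (Fin n))) :=
  ((DD Y) ×ˢ univ).filter (fun x => x.2 ∈ KK t n x.1)

theorem mem_EE {Y : Finset (Finset (Fin n))} {x} :
    x ∈ EE t n Y ↔ x.1 ∈ DD Y ∧ x.2 ∈ KK t n x.1 := by simp [EE]

theorem sum_EE {Y : Finset (Finset (Fin n))} (f : Finset (Fin n) × Finset (Finset (Fin n)) → ℝ) :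
    ∑ x ∈ EE t n Y, f x = ∑ a ∈ DD Y, ∑ κ ∈ KK t n a, f (a, κ) :=
  sum_finset_product _ _ _ (fun _ => mem_EE)

def Xc (t n : ℕ) (Y H : Finset (Finset (Fin n))) : ℕ := ((EE t n Y).filter (fun x => x.2 ⊆ H)).card

theorem Xc_zero {Y H : Finset (Finset (Fin n))} (hY : Y ⊆ XX t n) :
    Y ⊆ SS t n H ↔ Xc t n Y H = 0 := by
  rw [sub_SS_iff hY, Xc, card_eq_zero, filter_eq_empty_iff]
  constructor
  · intro h x hx
    rw [mem_EE] at hx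
    exact h _ hx.1 _ hx.2
  · intro h a ha κ hκ
    exact h (x := (a, κ)) (mem_EE.2 ⟨ha, hκ⟩)

noncomputable def mm (t n : ℕ) (Y H : Finset (Finset (Fin n))) : ℕ → Finset (Finset (Fin n)) →
    Finset (Finset (Fin n) × Finset (Finset (Fin n))) → ℝ
  | 0, W, _ => if W ⊆ H then 1 else 0
  | k + 1, W, B => ∑ x ∈ EE t n Y \ B, mm t n Y H k (W ∪ x.2) (insert x B)

theorem mm_eq (Y H : Finset (Finset (Fin n))) (k : ℕ) (W B) (hB : B ⊆ EE t n Y)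
    (hBW : ∀ x ∈ B, x.2 ⊆ W) :
    mm t n Y H k W B = if W ⊆ H then (((Xc t n Y H - B.card).descFactorial k : ℕ) : ℝ) else 0 := by
  induction k generalizing W B with
  | zero => simp [mm]
  | succ k ih =>
    rw [mm]
    have h1 : ∀ x ∈ EE t n Y \ B, mm t n Y H k (W ∪ x.2) (insert x B) =
        if W ⊆ H ∧ x.2 ⊆ H then (((Xc t n Y H - B.card - 1).descFactorial k : ℕ) : ℝ) else 0 := by
      intro x hx
      rw [mem_sdiff] at hx
      rw [ih _ _ (insert_subset hx.1 hB), card_insert_of_notMem hx.2, Nat.sub_sub]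
      · simp only [union_subset_iff]
      · intro z hz
        rcases mem_insert.1 hz with rfl | hz
        · exact subset_union_right
        · exact (hBW z hz).trans subset_union_left
    rw [sum_congr rfl h1]
    by_cases hW : W ⊆ H
    · simp only [hW, true_and, if_true]
      rw [← sum_filter, sum_const, nsmul_eq_mul]
      have hc : ((EE t n Y \ B).filter (fun x => x.2 ⊆ H)).card = Xc t n Y H - B.card := by
        have hBs : B ⊆ (EE t n Y).filter (fun x => x.2 ⊆ H) := fun x hx =>
          mem_filter.2 ⟨hB hx, (hBW x hx).trans hW⟩
        rw [Xc, ← card_sdiff_of_subset hBs]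
        congr 1
        ext x; simp only [mem_filter, mem_sdiff]; tauto
      rw [hc]
      norm_cast
      rcases h : Xc t n Y H - B.card with _ | m
      · simp
      · rw [Nat.succ_descFactorial_succ]; rfl
    · simp [hW]

theorem bonf_aux (s m : ℕ) :
    ∑ k ∈ range (m + 1), (-1 : ℝ) ^ k * ((s + 1).choose k : ℝ) = (-1) ^ m * (s.choose m : ℝ) := by
  induction m with
  | zero => simp
  | succ m ih =>
    rw [sum_range_succ, ih, Nat.choose_succ_succ]
    push_cast; ring

theorem bonf (X m : ℕ) :
    |(if X = 0 then (1 : ℝ) else 0) - ∑ k ∈ range m, (-1 : ℝ) ^ k * (X.choose k : ℝ)| ≤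
      (X.choose m : ℝ) := by
  rcases m with _ | m
  · simp; split_ifs <;> simp
  rcases X with _ | s
  · rw [sum_eq_single 0]
    · simp
    · intro b _ hb
      rw [Nat.choose_eq_zero_of_lt (by omega)]; simp
    · simp
  · rw [bonf_aux, if_neg (by omega)]
    rw [zero_sub, abs_neg, abs_mul, abs_pow]
    simp only [abs_neg, abs_one, one_pow, one_mul, Nat.abs_cast]
    rw [Nat.choose_succ_succ]
    push_cast
    have : (0 : ℝ) ≤ (s.choose (m+1) : ℝ) := by positivity
    linarith

/-- factorial moments -/
noncomputable def MM (t n : ℕ) (p : ℝ) (i : ℕ) (Y : Finset (Finset (Fin n))) (k : ℕ)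
    (W : Finset (Finset (Fin n))) (B : Finset (Finset (Fin n) × Finset (Finset (Fin n)))) : ℝ :=
  E2 t n p i (fun H R => if Y ⊆ SS t n H then mm t n Y (H ∪ (R ∩ SS t n H)) k W B else 0)

theorem MM_zero (i : ℕ) (Y W B) : MM t n p i Y 0 W B =
    ∑ T ∈ W.powerset, p ^ T.card * qq t n p i (Y ∪ T) (W \ T) := by
  rw [← E2_step, MM]
  congr 1
  funext H R
  simp only [mm, ite_and]

theorem MM_crude (hp : 0 ≤ p) (hp1 : p ≤ 1) (i : ℕ) (Y W B) :
    MM t n p i Y 0 W B ≤ ((i + 1 : ℕ) * p) ^ W.card := by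
  rw [MM_zero, ← E2_step]; exact E2_crude hp hp1 i Y W

theorem MM_succ (i : ℕ) (Y k W B) : MM t n p i Y (k + 1) W B =
    ∑ x ∈ EE t n Y \ B, MM t n p i Y k (W ∪ x.2) (insert x B) := by
  simp only [MM]
  rw [← map_sum]
  congr 1
  funext H R
  simp only [Finset.sum_apply]
  split_ifs
  · rfl
  · simp

theorem qq_succ (i : ℕ) {Y : Finset (Finset (Fin n))} (hY : Y ⊆ XX t n) (Z) :
    qq t n p (i + 1) Y Z = E2 t n p i (fun H R => if Y ⊆ SS t n H then
      if Z ⊆ H ∪ (R ∩ SS t n H) then if Xc t n Y (H ∪ (R ∩ SS t n H)) = 0 then 1 else 0 else 0 else 0) := by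
  rw [qq, Ex_succ]
  congr 1
  funext H R
  have h1 : Y ⊆ SS t n (H ∪ (R ∩ SS t n H)) → Y ⊆ SS t n H := fun h =>
    h.trans (SS_anti subset_union_left)
  have h2 := Xc_zero (H := H ∪ (R ∩ SS t n H)) hY
  by_cases a1 : Y ⊆ SS t n (H ∪ (R ∩ SS t n H))
  · have := h1 a1
    have := h2.1 a1
    simp [*]
  · have : ¬ Xc t n Y (H ∪ (R ∩ SS t n H)) = 0 := fun h => a1 (h2.2 h)
    simp [a1, this]

theorem qq_bonf (hp : 0 ≤ p) (hp1 : p ≤ 1) (i : ℕ) {Y : Finset (Finset (Fin n))}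
    (hY : Y ⊆ XX t n) (Z) (m : ℕ) :
    |qq t n p (i + 1) Y Z - ∑ k ∈ range m, (-1 : ℝ) ^ k * ((k.factorial : ℝ)⁻¹ * MM t n p i Y k Z ∅)| ≤
      (m.factorial : ℝ)⁻¹ * MM t n p i Y m Z ∅ := by
  have hmm : ∀ k H, (k.factorial : ℝ)⁻¹ * mm t n Y H k Z ∅ =
      if Z ⊆ H then ((Xc t n Y H).choose k : ℝ) else 0 := by
    intro k H
    rw [mm_eq Y H k Z ∅ (empty_subset _) (by simp)]
    split_ifs
    · rw [card_empty, Nat.sub_zero, Nat.descFactorial_eq_factorial_mul_choose]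
      push_cast
      have : (k.factorial : ℝ) ≠ 0 := by positivity
      field_simp
    · simp
  set F : Finset (Finset (Fin n)) → Finset (Finset (Fin n)) → ℝ := fun H R => if Y ⊆ SS t n H then
      if Z ⊆ H ∪ (R ∩ SS t n H) then if Xc t n Y (H ∪ (R ∩ SS t n H)) = 0 then 1 else 0 else 0 else 0
    with hF
  set G : ℕ → Finset (Finset (Fin n)) → Finset (Finset (Fin n)) → ℝ := fun k H R =>
      if Y ⊆ SS t n H then mm t n Y (H ∪ (R ∩ SS t n H)) k Z ∅ else 0 with hG
  have hpt : ∀ H R, |F H R - ∑ k ∈ range m, (-1 : ℝ) ^ k * ((k.factorial : ℝ)⁻¹ * G k H R)| ≤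
      (m.factorial : ℝ)⁻¹ * G m H R := by
    intro H R
    simp only [hF, hG]
    by_cases h1 : Y ⊆ SS t n H
    · simp only [h1, if_true, hmm]
      by_cases h2 : Z ⊆ H ∪ (R ∩ SS t n H)
      · simp only [h2, if_true]
        exact bonf _ _
      · simp [h2]
    · simp [h1]
  rw [qq_succ i hY]
  have hlin : E2 t n p i F - ∑ k ∈ range m, (-1 : ℝ) ^ k * ((k.factorial : ℝ)⁻¹ * MM t n p i Y k Z ∅) =
      E2 t n p i (F - ∑ k ∈ range m, ((-1 : ℝ) ^ k * (k.factorial : ℝ)⁻¹) • G k) := by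
    rw [map_sub, map_sum]
    congr 1
    apply sum_congr rfl
    intro k _
    rw [map_smul, smul_eq_mul, mul_assoc]; rfl
  have hM : (m.factorial : ℝ)⁻¹ * MM t n p i Y m Z ∅ = E2 t n p i ((m.factorial : ℝ)⁻¹ • G m) := by
    rw [map_smul]; rfl
  rw [hlin, hM, abs_le]
  constructor
  · rw [← map_neg]
    apply E2_mono hp hp1
    intro H R
    have := (abs_le.1 (hpt H R)).1
    simpa [Finset.sum_apply, mul_assoc] using this
  · apply E2_mono hp hp1
    intro H R
    have := (abs_le.1 (hpt H R)).2
    simpa [Finset.sum_apply, mul_assoc] using this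

end ex
end BES

namespace BES
open Finset

section step
variable {t n : ℕ}

theorem vs_card_le {S : Finset (Finset (Fin n))} (hS : S ⊆ XX t n) :
    (vs S).card ≤ S.card * (t + 2) := by
  have : vs S = S.biUnion id := by rw [vs, sup_eq_biUnion]
  rw [this]
  exact card_biUnion_le_card_mul _ _ _ (fun e he => (mem_XX.1 (hS he)).le)

theorem DD_card_le {Y : Finset (Finset (Fin n))} (hY : Y ⊆ XX t n) {m : ℕ} (hm : Y.card ≤ m) :
    ((DD Y).card : ℝ) ≤ m * (2 ^ (t + 2) + 1) := by
  have h1 : (DD Y).card ≤ Y.card * (2 ^ (t + 2) + 1) := by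
    apply card_biUnion_le_card_mul
    intro e he
    refine (card_insert_le _ _).trans (Nat.add_le_add_right ?_ 1)
    rw [← mem_XX.1 (hY he), ← card_powerset]
    exact card_le_card (fun x hx => mem_powerset.2 (mem_powersetCard.1 hx).1)
  have h2 : (DD Y).card ≤ m * (2 ^ (t + 2) + 1) := h1.trans (Nat.mul_le_mul_right _ hm)
  exact_mod_cast h2

noncomputable def KC (t m : ℕ) : ℝ := (m * (2 ^ (t + 2) + 1)) * CC t (2 * m * (t + 2))

theorem KC_nonneg (t m : ℕ) : 0 ≤ KC t m := by
  unfold KC; have := CC_nonneg t (2 * m * (t + 2)); positivity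

theorem vsYW_card {Y W : Finset (Finset (Fin n))} (hY : Y ⊆ XX t n) (hW : W ⊆ XX t n) {m : ℕ}
    (hYm : Y.card ≤ m) (hWm : W.card ≤ m) : (vs (Y ∪ W)).card ≤ 2 * m * (t + 2) := by
  refine (vs_card_le (union_subset hY hW)).trans (Nat.mul_le_mul_right _ ?_)
  have := card_union_le Y W
  omega

theorem DD_sub_vs {Y W : Finset (Finset (Fin n))} {a : Finset (Fin n)} (ha : a ∈ DD Y) :
    a ⊆ vs (Y ∪ W) := by
  obtain ⟨y, hy, hay⟩ := DD_sub ha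
  exact hay.trans (subset_vs (mem_union_left _ hy))

theorem sum_EE_le (hn : 2 * (t + 1) ≤ n) {Y W F : Finset (Finset (Fin n))} (hY : Y ⊆ XX t n)
    (hW : W ⊆ XX t n) {m : ℕ} (hYm : Y.card ≤ m) (hWm : W.card ≤ m) (hF : F ⊆ W) :
    ∑ x ∈ EE t n Y, (NN t n)⁻¹ ^ (x.2 \ F).card ≤ KC t m := by
  rw [sum_EE]
  refine (sum_le_sum (fun a ha => sum_KK hn (vsYW_card hY hW hYm hWm) (DD_isC hY ha)
    (DD_sub_vs ha) (vs_mono (hF.trans subset_union_right)))).trans ?_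
  rw [sum_const, nsmul_eq_mul, KC]
  exact mul_le_mul_of_nonneg_right (DD_card_le hY hYm) (CC_nonneg _ _)

open Classical in
theorem sum_EE_nonfresh (hn : 2 * (t + 1) ≤ n) {Y W F : Finset (Finset (Fin n))} (hY : Y ⊆ XX t n)
    (hW : W ⊆ XX t n) {m : ℕ} (hYm : Y.card ≤ m) (hWm : W.card ≤ m) (hF : F ⊆ W) :
    ∑ x ∈ EE t n Y with ¬ x.2 ⊆ F ∧ ¬ vs x.2 ∩ vs (Y ∪ W) ⊆ x.1, (NN t n)⁻¹ ^ (x.2 \ F).card ≤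
      KC t m / n := by
  rw [sum_filter, sum_EE]
  have : ∀ a ∈ DD Y, ∑ κ ∈ KK t n a, (if ¬ (a, κ).2 ⊆ F ∧ ¬ vs (a, κ).2 ∩ vs (Y ∪ W) ⊆ (a, κ).1 then
      (NN t n)⁻¹ ^ ((a, κ).2 \ F).card else 0) ≤ CC t (2 * m * (t + 2)) / n := by
    intro a ha
    rw [← sum_filter]
    exact sum_KK_nonfresh hn (vsYW_card hY hW hYm hWm) (DD_isC hY ha)
      (DD_sub_vs ha) (vs_mono (hF.trans subset_union_right))
  refine (sum_le_sum this).trans ?_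
  rw [sum_const, nsmul_eq_mul, KC, mul_div_assoc]
  exact mul_le_mul_of_nonneg_right (DD_card_le hY hYm)
    (div_nonneg (CC_nonneg _ _) (by positivity))

theorem mm_nonneg (Y H : Finset (Finset (Fin n))) (k W B) : 0 ≤ mm t n Y H k W B := by
  induction k generalizing W B with
  | zero => rw [mm]; split_ifs <;> norm_num
  | succ k ih => rw [mm]; exact sum_nonneg (fun x _ => ih _ _)

theorem MM_nonneg {p : ℝ} (hp : 0 ≤ p) (hp1 : p ≤ 1) (i : ℕ) (Y k W B) :
    0 ≤ MM t n p i Y k W B := E2_nonneg hp hp1 i (fun H R => by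
  split_ifs
  · exact mm_nonneg _ _ _ _ _
  · norm_num)

theorem p_ok (hn : 2 * (t + 1) ≤ n) {ε : ℝ} (hε : 0 ≤ ε) (hε1 : ε ≤ 1) :
    0 ≤ ε / NN t n ∧ ε / NN t n ≤ 1 := by
  have h1 := NN_one hn
  have h2 := NN_pos hn
  exact ⟨by positivity, by rw [div_le_one h2]; linarith⟩

theorem EE_card7 {Y : Finset (Finset (Fin n))} {x} (hx : x ∈ EE t n Y) : x.2.card ≤ 7 :=
  (KK_card (mem_EE.1 hx).2).2

theorem card_union_sdiff' {α : Type*} [DecidableEq α] (W κ : Finset α) :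
    (W ∪ κ).card = W.card + (κ \ W).card := by
  rw [← union_sdiff_self_eq_union, card_union_of_disjoint disjoint_sdiff]

theorem MM_bound (t i k m : ℕ) : ∃ C : ℝ, 0 ≤ C ∧ ∀ n : ℕ, 2 * (t + 1) ≤ n → ∀ ε : ℝ, 0 ≤ ε → ε ≤ 1 →
    ∀ Y W : Finset (Finset (Fin n)), Y ⊆ XX t n → W ⊆ XX t n → Y.card ≤ m → W.card ≤ m → ∀ B,
    MM t n (ε / NN t n) i Y k W B ≤ C * (NN t n)⁻¹ ^ W.card := by
  induction k generalizing m with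
  | zero =>
    refine ⟨(i + 1) ^ m, by positivity, ?_⟩
    intro n hn ε hε hε1 Y W hY hW hYm hWm B
    obtain ⟨hp, hp1⟩ := p_ok hn hε hε1
    have hN := NN_pos hn
    refine (MM_crude hp hp1 i Y W B).trans ?_
    rw [div_eq_mul_inv, ← mul_assoc, mul_pow]
    apply mul_le_mul_of_nonneg_right _ (by positivity)
    have h1 : ((i + 1 : ℕ) : ℝ) * ε ≤ i + 1 := by
      push_cast; nlinarith [(Nat.cast_nonneg i : (0:ℝ) ≤ i)]
    refine (pow_le_pow_left₀ (by positivity) h1 _).trans ?_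
    exact pow_le_pow_right₀ (by linarith [(Nat.cast_nonneg i : (0:ℝ) ≤ i)]) hWm
  | succ k ih =>
    obtain ⟨C, hC, h⟩ := ih (m + 7)
    refine ⟨C * KC t m, mul_nonneg hC (KC_nonneg _ _), ?_⟩
    intro n hn ε hε hε1 Y W hY hW hYm hWm B
    obtain ⟨hp, hp1⟩ := p_ok hn hε hε1
    have hN := NN_pos hn
    rw [MM_succ]
    calc _ ≤ ∑ x ∈ EE t n Y, MM t n (ε / NN t n) i Y k (W ∪ x.2) (insert x B) :=
          sum_le_sum_of_subset_of_nonneg sdiff_subset (fun x _ _ => MM_nonneg hp hp1 _ _ _ _ _)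
      _ ≤ ∑ x ∈ EE t n Y, C * (NN t n)⁻¹ ^ W.card * (NN t n)⁻¹ ^ (x.2 \ W).card := by
          apply sum_le_sum
          intro x hx
          have h7 := EE_card7 hx
          have := h n hn ε hε hε1 Y (W ∪ x.2) hY (union_subset hW (KK_sub (mem_EE.1 hx).2))
            (by omega) (by have := card_union_le W x.2; omega) (insert x B)
          rwa [card_union_sdiff', pow_add, ← mul_assoc] at this
      _ ≤ _ := by
          rw [← mul_sum, mul_assoc, mul_assoc, mul_comm (KC t m)]
          apply mul_le_mul_of_nonneg_left _ hC
          apply mul_le_mul_of_nonneg_left _ (by positivity)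
          exact sum_EE_le hn hY hW hYm hWm (Subset.refl _)

/-- parameter bundle -/
structure Par (ε π ψ h L : ℝ) : Prop where
  e0 : 0 < ε
  e1 : ε ≤ 1
  p0 : 0 < π
  p1 : π ≤ 1
  s0 : 0 < ψ
  s1 : ψ ≤ 1
  h0 : 0 ≤ h
  hL : h ≤ L

/-- increment -/
noncomputable def xi (t : ℕ) (ε π ψ : ℝ) : ℝ := ε * (π ^ ((t + 2).choose 2) * ψ)

noncomputable def nu {n : ℕ} (t : ℕ) (ε π ψ h : ℝ) (x : Finset (Fin n) × Finset (Finset (Fin n))) : ℝ :=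
  om π x.1 * ((h + xi t ε π ψ) ^ x.2.card - h ^ x.2.card)

theorem C0_pos (t : ℕ) : 1 ≤ (t + 2).choose 2 := Nat.choose_pos (by omega)

theorem xi_bd {ε π ψ h L : ℝ} (hP : Par ε π ψ h L) (t : ℕ) : 0 < xi t ε π ψ ∧ xi t ε π ψ ≤ 1 ∧
    π⁻¹ * xi t ε π ψ ≤ 1 ∧ xi t ε π ψ ≤ π := by
  obtain ⟨e0, e1, p0, p1, s0, s1, h0, hL⟩ := hP
  have h1 : π ^ ((t + 2).choose 2) ≤ π := by
    calc _ ≤ π ^ 1 := pow_le_pow_of_le_one p0.le p1 (C0_pos t)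
      _ = π := pow_one _
  have hpos : 0 < π ^ ((t + 2).choose 2) := by positivity
  have h2 : π ^ ((t + 2).choose 2) * ψ ≤ π := by nlinarith
  have h3 : xi t ε π ψ ≤ π := by
    rw [xi]
    have : 0 < π ^ ((t + 2).choose 2) * ψ := by positivity
    nlinarith
  refine ⟨by rw [xi]; positivity, h3.trans p1, ?_, h3⟩
  rw [inv_mul_le_iff₀ p0]; linarith

theorem nu_bd {ε π ψ h L : ℝ} (hP : Par ε π ψ h L) {Y : Finset (Finset (Fin n))} {x}
    (hx : x ∈ EE t n Y) : 0 ≤ nu t ε π ψ h x ∧ nu t ε π ψ h x ≤ (L + 1) ^ 7 := by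
  obtain ⟨x0, x1, x2, -⟩ := xi_bd hP t
  have hL0 : 1 ≤ L + 1 := by linarith [hP.h0, hP.hL]
  have hmono : h ^ x.2.card ≤ (h + xi t ε π ψ) ^ x.2.card :=
    pow_le_pow_left₀ hP.h0 (by linarith) _
  rw [nu, om]
  rw [mem_EE] at hx
  split_ifs with h2
  · obtain ⟨f, -, -, hf⟩ := (mem_KK_pair h2).1 hx.2
    rw [hf]
    simp only [card_singleton, pow_one, add_sub_cancel_left]
    have := hP.p0
    exact ⟨by positivity, x2.trans (one_le_pow₀ hL0)⟩
  · rw [one_mul]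
    refine ⟨by linarith, ?_⟩
    have h3 : (h + xi t ε π ψ) ^ x.2.card ≤ (L + 1) ^ 7 := by
      refine (pow_le_pow_left₀ (by linarith [hP.h0]) (by linarith [hP.hL] : h + xi t ε π ψ ≤ L + 1) _).trans ?_
      exact pow_le_pow_right₀ hL0 (KK_card hx.2).2
    have : 0 ≤ h ^ x.2.card := pow_nonneg hP.h0 _
    linarith

theorem PP_bd {ε π ψ h L : ℝ} (hP : Par ε π ψ h L) (Y : Finset (Finset (Fin n))) :
    0 ≤ PP π ψ Y ∧ PP π ψ Y ≤ 1 := by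
  have h1 : ∀ a ∈ DD Y, 0 ≤ wt π ψ a := fun a _ => by
    rw [wt]; split_ifs; exacts [hP.p0.le, hP.s0.le]
  exact ⟨prod_nonneg h1, prod_le_one h1 (fun a _ => by
    rw [wt]; split_ifs; exacts [hP.p1, hP.s1])⟩

noncomputable def lam {n : ℕ} (t : ℕ) (ε π ψ h : ℝ) (Y : Finset (Finset (Fin n))) : ℝ :=
  ∑ x ∈ EE t n Y, nu t ε π ψ h x * (NN t n)⁻¹ ^ x.2.card

theorem lam_bd (hn : 2 * (t + 1) ≤ n) {ε π ψ h L : ℝ} (hP : Par ε π ψ h L)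
    {Y : Finset (Finset (Fin n))} (hY : Y ⊆ XX t n) {m : ℕ} (hYm : Y.card ≤ m) :
    0 ≤ lam t ε π ψ h Y ∧ lam t ε π ψ h Y ≤ (L + 1) ^ 7 * KC t m := by
  have hN := NN_pos hn
  constructor
  · exact sum_nonneg (fun x hx => mul_nonneg (nu_bd hP hx).1 (by positivity))
  · have h1 : lam t ε π ψ h Y ≤ ∑ x ∈ EE t n Y, (L + 1) ^ 7 * (NN t n)⁻¹ ^ (x.2 \ ∅).card := by
      apply sum_le_sum
      intro x hx
      rw [sdiff_empty]
      exact mul_le_mul_of_nonneg_right (nu_bd hP hx).2 (by positivity)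
    refine h1.trans ?_
    rw [← mul_sum]
    apply mul_le_mul_of_nonneg_left _ (pow_nonneg (by linarith [hP.h0, hP.hL]) _)
    exact sum_EE_le hn hY (empty_subset _) hYm (by simp) (Subset.refl _)

/-- approximation hypothesis -/
def ClA (t n : ℕ) (ε π ψ h : ℝ) (i m : ℕ) (η : ℝ) : Prop :=
  ∀ Y Z : Finset (Finset (Fin n)), Good t n Y Z → Y.card ≤ m → Z.card ≤ m →
    |qq t n (ε / NN t n) i Y Z * NN t n ^ Z.card - PP π ψ Y * h ^ Z.card| ≤ η

theorem ClA_mono {ε π ψ h η : ℝ} {i m m' : ℕ} (hm : m' ≤ m) (h1 : ClA t n ε π ψ h i m η) :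
    ClA t n ε π ψ h i m' η := fun Y Z hg hY hZ => h1 Y Z hg (hY.trans hm) (hZ.trans hm)

theorem stepA (ht : 2 ≤ t) (hn : 2 * (t + 1) ≤ n) {ε π ψ h L : ℝ} (hP : Par ε π ψ h L) {i m : ℕ}
    {η : ℝ} (hη : 0 ≤ η) (hcl : ClA t n ε π ψ h i (2 * m) η) {Y Z W : Finset (Finset (Fin n))} {B}
    (hg : Good t n Y Z) (hF : Fr t n Y Z W B) (hYm : Y.card ≤ m) (hWm : W.card ≤ m) :
    |MM t n (ε / NN t n) i Y 0 W B * NN t n ^ W.card -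
      PP π ψ Y * (h + xi t ε π ψ) ^ Z.card * ∏ x ∈ B, nu t ε π ψ h x| ≤ 2 ^ m * η := by
  classical
  have hN := NN_pos hn
  have hi := fr_inv ht hg hF
  have hs := fr_sum ht hg hF hP.p0.ne' ψ ε h
  simp only [nu, xi]
  rw [← hs, MM_zero, sum_mul, ← sum_sub_distrib]
  refine (abs_sum_le_sum_abs _ _).trans ?_
  have key : ∀ T ∈ W.powerset, |(ε / NN t n) ^ T.card * qq t n (ε / NN t n) i (Y ∪ T) (W \ T) *
      NN t n ^ W.card - (if Hits B T then ε ^ T.card * (PP π ψ (Y ∪ T) * h ^ (W \ T).card) else 0)| ≤ η := by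
    intro T hT
    rw [mem_powerset] at hT
    by_cases hh : Hits B T
    · rw [if_pos hh]
      have hgood := inv_good hi hT hh
      have h1 := hcl _ _ hgood (by
        have := card_union_le Y T; have := card_le_card hT; omega) (by
        have := card_le_card (sdiff_subset (s := W) (t := T)); omega)
      have hc : NN t n ^ W.card = NN t n ^ T.card * NN t n ^ (W \ T).card := by
        rw [← pow_add, card_sdiff_of_subset hT]
        congr 1
        have := card_le_card hT
        omega
      have e1 : (ε / NN t n) ^ T.card * qq t n (ε / NN t n) i (Y ∪ T) (W \ T) * NN t n ^ W.card =
          ε ^ T.card * (qq t n (ε / NN t n) i (Y ∪ T) (W \ T) * NN t n ^ (W \ T).card) := by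
        rw [hc, div_pow]; field_simp
      rw [e1, ← mul_sub, abs_mul, abs_of_nonneg (pow_nonneg hP.e0.le _)]
      have h2 : ε ^ T.card ≤ 1 := pow_le_one₀ hP.e0.le hP.e1
      calc _ ≤ 1 * η := mul_le_mul h2 h1 (abs_nonneg _) zero_le_one
        _ = η := one_mul _
    · rw [if_neg hh]
      unfold Hits at hh
      push Not at hh
      obtain ⟨x, hx, hxe⟩ := hh
      have h5 := hi.i5 x hx
      rw [qq_zero i (union_subset hi.hY (hT.trans hi.hW))
        (a := x.1) (κ := x.2) (biUnion_subset_biUnion_of_subset_left _ subset_union_left h5.1) h5.2.1]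
      · simpa using hη
      · intro f hf
        refine mem_sdiff.2 ⟨h5.2.2 hf, fun hfT => ?_⟩
        have : f ∈ x.2 ∩ T := mem_inter.2 ⟨hf, hfT⟩
        rw [hxe] at this; simp at this
  refine (sum_le_sum key).trans ?_
  rw [sum_const, card_powerset, nsmul_eq_mul]
  apply mul_le_mul_of_nonneg_right _ hη
  push_cast
  exact pow_le_pow_right₀ (by norm_num) hWm

end step
end BES

namespace BES
open Finset

section stepm
variable {t n : ℕ}

theorem fr_sub {Y Z W : Finset (Finset (Fin n))} {B} (h : Fr t n Y Z W B) : Z ⊆ W := by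
  induction h with
  | nil => exact Subset.refl _
  | cons _ _ _ _ ih => exact ih.trans subset_union_left

theorem fr_B {Y Z W : Finset (Finset (Fin n))} {B} (h : Fr t n Y Z W B) : B ⊆ EE t n Y := by
  induction h with
  | nil => exact empty_subset _
  | cons _ ha hκ _ ih => exact insert_subset (mem_EE.2 ⟨ha, hκ⟩) ih

theorem stepM (ht : 2 ≤ t) (i : ℕ) {L : ℝ} (hL : 0 ≤ L) (k m : ℕ) : ∃ K : ℝ, 0 ≤ K ∧
    ∀ n : ℕ, 2 * (t + 1) ≤ n → ∀ ε π ψ h : ℝ, Par ε π ψ h L → ∀ η : ℝ, 0 ≤ η →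
    ClA t n ε π ψ h i (2 * (m + 7 * k)) η → ∀ Y Z W B, Good t n Y Z → Fr t n Y Z W B →
    Y.card ≤ m → W.card ≤ m → B.card ≤ m →
    |MM t n (ε / NN t n) i Y k W B * NN t n ^ W.card -
      PP π ψ Y * (h + xi t ε π ψ) ^ Z.card * (∏ x ∈ B, nu t ε π ψ h x) * lam t ε π ψ h Y ^ k| ≤
      K * (η + (n : ℝ)⁻¹) := by
  classical
  induction k generalizing m with
  | zero =>
    refine ⟨2 ^ m, by positivity, ?_⟩
    intro n hn ε π ψ h hP η hη hcl Y Z W B hg hF hYm hWm hBm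
    have := stepA ht hn hP hη hcl hg hF hYm hWm
    rw [pow_zero, mul_one]
    refine this.trans (mul_le_mul_of_nonneg_left ?_ (by positivity))
    have : (0 : ℝ) ≤ (n : ℝ)⁻¹ := by positivity
    linarith
  | succ k ih =>
    obtain ⟨K', hK', hM⟩ := ih (m + 7)
    obtain ⟨C, hC, hb⟩ := MM_bound t i k (m + 7)
    have hKC := KC_nonneg t m
    set D0 : ℝ := (L + 1) ^ m * ((L + 1) ^ 7) ^ m * ((L + 1) ^ 7 * KC t m) ^ k * (L + 1) ^ 7 with hD0
    have hD0n : 0 ≤ D0 := by positivity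
    refine ⟨K' * KC t m + C * KC t m + D0 * KC t m, by positivity, ?_⟩
    intro n hn ε π ψ h hP η hη hcl Y Z W B hg hF hYm hWm hBm
    have hN := NN_pos hn
    have hn0 : (0 : ℝ) < n := by exact_mod_cast (by omega : 0 < n)
    obtain ⟨hp, hp1⟩ := p_ok hn hP.e0.le hP.e1
    have hi := fr_inv ht hg hF
    obtain ⟨x0, x1, -, -⟩ := xi_bd hP t
    set u := (NN t n)⁻¹ with hu
    have hu0 : 0 < u := by positivity
    set D := PP π ψ Y * (h + xi t ε π ψ) ^ Z.card * (∏ x ∈ B, nu t ε π ψ h x) with hD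
    set ℓ := lam t ε π ψ h Y with hℓ
    obtain ⟨hl0, hl1⟩ := lam_bd hn hP hi.hY hYm
    obtain ⟨hP0, hP1⟩ := PP_bd hP Y
    have hL1 : 1 ≤ L + 1 := by linarith
    have hBn : ∀ x ∈ B, 0 ≤ nu t ε π ψ h x ∧ nu t ε π ψ h x ≤ (L + 1) ^ 7 := fun x hx =>
      nu_bd hP (fr_B hF hx)
    have hg0 : 0 ≤ h + xi t ε π ψ := by linarith [hP.h0]
    have hDn : 0 ≤ D := mul_nonneg (mul_nonneg hP0 (pow_nonneg hg0 _))
      (prod_nonneg (fun x hx => (hBn x hx).1))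
    have hDu : D ≤ (L + 1) ^ m * ((L + 1) ^ 7) ^ m := by
      have h1 : (h + xi t ε π ψ) ^ Z.card ≤ (L + 1) ^ m :=
        (pow_le_pow_left₀ hg0 (by linarith [hP.hL]) _).trans
          (pow_le_pow_right₀ hL1 ((card_le_card (fr_sub hF)).trans hWm))
      have h2 : (∏ x ∈ B, nu t ε π ψ h x) ≤ ((L + 1) ^ 7) ^ m := by
        refine (prod_le_prod (fun x hx => (hBn x hx).1) (fun x hx => (hBn x hx).2)).trans ?_
        rw [prod_const]
        exact pow_le_pow_right₀ (one_le_pow₀ hL1) hBm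
      rw [hD]
      refine mul_le_mul ?_ h2 (prod_nonneg (fun x hx => (hBn x hx).1)) (by positivity)
      calc _ ≤ 1 * (L + 1) ^ m := mul_le_mul hP1 h1 (pow_nonneg hg0 _) zero_le_one
        _ = _ := one_mul _
    have hDl : ∀ x ∈ EE t n Y, 0 ≤ D * ℓ ^ k * nu t ε π ψ h x ∧ D * ℓ ^ k * nu t ε π ψ h x ≤ D0 := by
      intro x hx
      obtain ⟨n0, n1⟩ := nu_bd hP hx
      refine ⟨by positivity, ?_⟩
      rw [hD0]
      have : ℓ ^ k ≤ ((L + 1) ^ 7 * KC t m) ^ k := pow_le_pow_left₀ hl0 hl1 _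
      gcongr
    -- pointwise estimate
    set a : Finset (Fin n) × Finset (Finset (Fin n)) → ℝ := fun x => if x ∈ B then 0 else
      MM t n (ε / NN t n) i Y k (W ∪ x.2) (insert x B) * NN t n ^ W.card with ha
    set b : Finset (Fin n) × Finset (Finset (Fin n)) → ℝ := fun x =>
      D * ℓ ^ k * nu t ε π ψ h x * u ^ x.2.card with hbd
    have e1 : MM t n (ε / NN t n) i Y (k + 1) W B * NN t n ^ W.card = ∑ x ∈ EE t n Y, a x := by
      rw [MM_succ, sum_mul]
      simp only [ha]
      rw [← sum_sdiff (fr_B hF)]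
      rw [sum_eq_zero (s := B), add_zero]
      · apply sum_congr rfl
        intro x hx
        rw [if_neg (mem_sdiff.1 hx).2]
      · intro x hx; rw [if_pos hx]
    have e2 : D * ℓ ^ (k + 1) = ∑ x ∈ EE t n Y, b x := by
      simp only [hbd, mul_assoc]
      rw [← mul_sum, ← mul_sum, pow_succ]
      rfl
    have key : ∀ x ∈ EE t n Y, |a x - b x| ≤ K' * (η + (n : ℝ)⁻¹) * u ^ (x.2 \ ∅).card +
        (if ¬ x.2 ⊆ W ∧ ¬ vs x.2 ∩ vs (Y ∪ W) ⊆ x.1 then C * u ^ (x.2 \ W).card else 0) +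
        (if ¬ x.2 ⊆ ∅ ∧ ¬ vs x.2 ∩ vs (Y ∪ W) ⊆ x.1 then D0 * u ^ (x.2 \ ∅).card else 0) := by
      intro x hx
      have hx' := mem_EE.1 hx
      have hne := KK_ne hx'.2
      have h7 := EE_card7 hx
      have he : ¬ x.2 ⊆ ∅ := fun hh => by rw [subset_empty] at hh; simp [hh] at hne
      have hcu := card_union_le W x.2
      have hpos : 0 ≤ K' * (η + (n : ℝ)⁻¹) * u ^ (x.2 \ ∅).card := by positivity
      by_cases hfr : vs x.2 ∩ vs (Y ∪ W) ⊆ x.1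
      · obtain ⟨hnB, hd⟩ := fr_notMem ht hg hF hx'.1 hx'.2 hfr
        have hF' : Fr t n Y Z (W ∪ x.2) (insert x B) := Fr.cons hF hx'.1 hx'.2 hfr
        have hb1 := card_insert_le x B
        have h1 := hM n hn ε π ψ h hP η hη (ClA_mono (by omega) hcl) Y Z _ _ hg hF' (by omega) (by omega)
          (by omega)
        rw [prod_insert hnB, card_union_of_disjoint hd, pow_add] at h1
        simp only [ha, hbd, if_neg hnB, hfr, not_true, and_false, if_false, add_zero, sdiff_empty]
        have hNk : NN t n ^ x.2.card * u ^ x.2.card = 1 := by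
          rw [← mul_pow, hu, mul_inv_cancel₀ hN.ne', one_pow]
        have h2 : MM t n (ε / NN t n) i Y k (W ∪ x.2) (insert x B) * NN t n ^ W.card -
            D * ℓ ^ k * nu t ε π ψ h x * u ^ x.2.card =
            (MM t n (ε / NN t n) i Y k (W ∪ x.2) (insert x B) * (NN t n ^ W.card * NN t n ^ x.2.card) -
              PP π ψ Y * (h + xi t ε π ψ) ^ Z.card * (nu t ε π ψ h x * ∏ x ∈ B, nu t ε π ψ h x) *
                ℓ ^ k) * u ^ x.2.card := by
          rw [sub_mul, mul_assoc (MM t n _ i Y k _ _), mul_assoc (NN t n ^ W.card), hNk, mul_one, hD]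
          ring
        rw [h2, abs_mul, abs_of_pos (pow_pos hu0 _)]
        exact mul_le_mul_of_nonneg_right h1 (by positivity)
      · simp only [hfr, he, not_false_eq_true, and_true, if_true]
        obtain ⟨hb0, hb1⟩ := hDl x hx
        have hbx : 0 ≤ b x ∧ b x ≤ D0 * u ^ (x.2 \ ∅).card := by
          simp only [hbd, sdiff_empty]
          exact ⟨by positivity, mul_le_mul_of_nonneg_right hb1 (by positivity)⟩
        have hax : 0 ≤ a x ∧ a x ≤ if ¬ x.2 ⊆ W then C * u ^ (x.2 \ W).card else 0 := by
          simp only [ha]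
          by_cases hB : x ∈ B
          · simp only [if_pos hB, le_refl, true_and]
            split_ifs <;> positivity
          · have hnW : ¬ x.2 ⊆ W := fun hh => hB (hi.i4 _ hx'.1 _ hx'.2 hh)
            simp only [if_neg hB, hnW, not_false_eq_true, if_true]
            refine ⟨mul_nonneg (MM_nonneg hp hp1 _ _ _ _ _) (by positivity), ?_⟩
            have h3 := hb n hn ε hP.e0.le hP.e1 Y (W ∪ x.2) hi.hY (union_subset hi.hW (KK_sub hx'.2))
              (by omega) (by omega) (insert x B)
            rw [card_union_sdiff', pow_add] at h3
            calc _ ≤ C * (u ^ W.card * u ^ (x.2 \ W).card) * NN t n ^ W.card :=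
                  mul_le_mul_of_nonneg_right h3 (by positivity)
              _ = C * u ^ (x.2 \ W).card * (NN t n ^ W.card * u ^ W.card) := by ring
              _ = _ := by rw [← mul_pow, hu, mul_inv_cancel₀ hN.ne', one_pow, mul_one]
        rw [abs_le]
        constructor <;> linarith
    rw [e1, e2, ← sum_sub_distrib]
    refine (abs_sum_le_sum_abs _ _).trans ((sum_le_sum key).trans ?_)
    rw [sum_add_distrib, sum_add_distrib, ← mul_sum, ← sum_filter, ← sum_filter, ← mul_sum, ← mul_sum]
    have s1 := sum_EE_le hn hi.hY hi.hW hYm hWm (empty_subset W)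
    have s2 := sum_EE_nonfresh hn hi.hY hi.hW hYm hWm (Subset.refl W)
    have s3 := sum_EE_nonfresh hn hi.hY hi.hW hYm hWm (empty_subset W)
    rw [div_eq_mul_inv] at s2 s3
    have hni : 0 ≤ (n : ℝ)⁻¹ := by positivity
    have t1 := mul_le_mul_of_nonneg_left s1 (by positivity : 0 ≤ K' * (η + (n : ℝ)⁻¹))
    have t2 := mul_le_mul_of_nonneg_left s2 hC
    have t3 := mul_le_mul_of_nonneg_left s3 hD0n
    have t4 : 0 ≤ C * KC t m * η := by positivity
    have t5 : 0 ≤ D0 * KC t m * η := by positivity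
    nlinarith

end stepm
end BES

namespace BES
open Finset

section claim
variable {t n : ℕ}

/-- the parameters after one round -/
noncomputable def nxP (t : ℕ) (ε π ψ : ℝ) : ℝ := π * Real.exp (-(π⁻¹ * xi t ε π ψ))

noncomputable def nxS (t n : ℕ) (ε π ψ h : ℝ) : ℝ :=
  ψ * Real.exp (-(∑ j ∈ range 8, cc t n j * ((h + xi t ε π ψ) ^ j - h ^ j)))

theorem PP_update (ht : 2 ≤ t) (hn : 2 * (t + 1) ≤ n) (ε π ψ h : ℝ)
    {Y : Finset (Finset (Fin n))} (hY : Y ⊆ XX t n) :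
    PP (nxP t ε π ψ) (nxS t n ε π ψ h) Y = PP π ψ Y * Real.exp (-(lam t ε π ψ h Y)) := by
  rw [lam, sum_EE, ← sum_neg_distrib, Real.exp_sum, PP, PP, ← prod_mul_distrib]
  apply prod_congr rfl
  intro a ha
  by_cases h2 : a.card = 2
  · rw [wt, wt, if_pos h2, if_pos h2, nxP]
    have := lam_pair hn h2 (fun j => π⁻¹ * ((h + xi t ε π ψ) ^ j - h ^ j))
    simp only [nu, om, if_pos h2] at this ⊢
    rw [this]
    ring_nf
  · rw [wt, wt, if_neg h2, if_neg h2, nxS]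
    have := lam_edge ht (hY (DD_edge ha h2)) (fun j => 1 * ((h + xi t ε π ψ) ^ j - h ^ j))
    simp only [nu, om, if_neg h2] at this ⊢
    rw [this]
    simp only [one_mul]

theorem real_exp_bd {x : ℝ} {n : ℕ} (hx : |x| / n.succ ≤ 1 / 2) :
    |Real.exp x - ∑ m ∈ range n, x ^ m / (m.factorial : ℝ)| ≤ |x| ^ n / n.factorial * 2 := by
  have h := Complex.exp_bound' (x := (x : ℂ)) (n := n) (by simpa using hx)
  have e : (Complex.exp (x : ℂ) - ∑ m ∈ range n, (x : ℂ) ^ m / (m.factorial : ℂ)) =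
      ((Real.exp x - ∑ m ∈ range n, x ^ m / (m.factorial : ℝ) : ℝ) : ℂ) := by push_cast; rfl
  rw [e, Complex.norm_real, Complex.norm_real] at h
  simpa using h

theorem choose_M (D Λ η : ℝ) (hη : 0 < η) :
    ∃ M : ℕ, 1 ≤ M ∧ Λ / M.succ ≤ 1 / 2 ∧ D * (Λ ^ M / M.factorial) ≤ η := by
  have h1 := (FloorSemiring.tendsto_pow_div_factorial_atTop Λ).const_mul D
  rw [mul_zero] at h1
  have h2 := h1.eventually (eventually_le_nhds hη)
  have h3 : ∀ᶠ M : ℕ in Filter.atTop, 2 * Λ ≤ M := by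
    filter_upwards [Filter.eventually_ge_atTop ⌈2 * Λ⌉₊] with M hM
    exact (Nat.le_ceil _).trans (by exact_mod_cast hM)
  obtain ⟨M, hM, hM3, hM1⟩ := (h2.and (h3.and (Filter.eventually_ge_atTop 1))).exists
  refine ⟨M, hM1, ?_, hM⟩
  rw [div_le_iff₀ (by positivity)]
  push_cast
  linarith

/-- abstract numerical part of the step -/
theorem num_step {Q D lm Dm Λ θ e : ℝ} {M : ℕ} {a K : ℕ → ℝ}
    (hl : 0 ≤ lm) (hlΛ : lm ≤ Λ) (hD : 0 ≤ D) (hDm : D ≤ Dm) (hΛ : Λ / M.succ ≤ 1 / 2)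
    (hK : ∀ k, 0 ≤ K k) (hθ : 0 ≤ θ)
    (ha : ∀ k ∈ range (M + 1), |a k - D * lm ^ k| ≤ K k * θ)
    (hQ : |Q - ∑ k ∈ range M, (-1) ^ k * ((k.factorial : ℝ)⁻¹ * a k)| ≤ (M.factorial : ℝ)⁻¹ * a M)
    (hDe : 3 * Dm * (Λ ^ M / M.factorial) ≤ e) :
    |Q - D * Real.exp (-lm)| ≤ (∑ k ∈ range (M + 1), K k) * θ + e := by
  have hf : ∀ k : ℕ, 0 < (k.factorial : ℝ) := fun k => by positivity
  have hf1 : ∀ k : ℕ, (k.factorial : ℝ)⁻¹ ≤ 1 := fun k =>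
    inv_le_one_of_one_le₀ (by exact_mod_cast k.factorial_pos)
  have hexp := real_exp_bd (x := -lm) (n := M)
    (by rw [abs_neg, abs_of_nonneg hl]; exact (by gcongr : lm / M.succ ≤ Λ / M.succ).trans hΛ)
  rw [abs_neg, abs_of_nonneg hl] at hexp
  have hpow : lm ^ M / M.factorial ≤ Λ ^ M / M.factorial := by gcongr
  have hpow0 : 0 ≤ lm ^ M / M.factorial := by positivity
  have hDm0 : 0 ≤ Dm := hD.trans hDm
  have hDp : D * (lm ^ M / M.factorial) ≤ Dm * (Λ ^ M / M.factorial) :=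
    mul_le_mul hDm hpow hpow0 hDm0
  -- third piece
  have p3 : |D * (∑ m ∈ range M, (-lm) ^ m / (m.factorial : ℝ)) - D * Real.exp (-lm)| ≤
      2 * (Dm * (Λ ^ M / M.factorial)) := by
    rw [← mul_sub, abs_mul, abs_of_nonneg hD, abs_sub_comm]
    calc _ ≤ D * (lm ^ M / M.factorial * 2) := mul_le_mul_of_nonneg_left hexp hD
      _ = 2 * (D * (lm ^ M / M.factorial)) := by ring
      _ ≤ _ := by linarith
  have p2 : |∑ k ∈ range M, (-1) ^ k * ((k.factorial : ℝ)⁻¹ * a k) -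
      D * (∑ m ∈ range M, (-lm) ^ m / (m.factorial : ℝ))| ≤ ∑ k ∈ range M, K k * θ := by
    rw [mul_sum, ← sum_sub_distrib]
    refine (abs_sum_le_sum_abs _ _).trans (sum_le_sum fun k hk => ?_)
    have e1 : (-1) ^ k * ((k.factorial : ℝ)⁻¹ * a k) - D * ((-lm) ^ k / (k.factorial : ℝ)) =
        (-1) ^ k * ((k.factorial : ℝ)⁻¹ * (a k - D * lm ^ k)) := by
      rw [neg_pow lm]; field_simp
    rw [e1, abs_mul, abs_pow, abs_neg, abs_one, one_pow, one_mul, abs_mul,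
      abs_of_pos (inv_pos.2 (hf k))]
    have := ha k (mem_range.2 (by have := mem_range.1 hk; omega))
    calc _ ≤ 1 * |a k - D * lm ^ k| := mul_le_mul_of_nonneg_right (hf1 k) (abs_nonneg _)
      _ ≤ _ := by rw [one_mul]; exact this
  have p1 : (M.factorial : ℝ)⁻¹ * a M ≤ Dm * (Λ ^ M / M.factorial) + K M * θ := by
    have h := (abs_le.1 (ha M (by simp))).2
    have h' : a M ≤ D * lm ^ M + K M * θ := by linarith
    calc (M.factorial : ℝ)⁻¹ * a M ≤ (M.factorial : ℝ)⁻¹ * (D * lm ^ M + K M * θ) :=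
          mul_le_mul_of_nonneg_left h' (inv_pos.2 (hf M)).le
      _ = D * (lm ^ M / M.factorial) + (M.factorial : ℝ)⁻¹ * (K M * θ) := by ring
      _ ≤ _ := add_le_add hDp (by
          have := mul_le_mul_of_nonneg_right (hf1 M) (mul_nonneg (hK M) hθ)
          rwa [one_mul] at this)
  rw [sum_range_succ, add_mul, sum_mul]
  have := abs_sub_le Q (∑ k ∈ range M, (-1) ^ k * ((k.factorial : ℝ)⁻¹ * a k)) (D * Real.exp (-lm))
  have := abs_sub_le (∑ k ∈ range M, (-1) ^ k * ((k.factorial : ℝ)⁻¹ * a k))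
    (D * (∑ m ∈ range M, (-lm) ^ m / (m.factorial : ℝ))) (D * Real.exp (-lm))
  linarith

theorem claimStep (ht : 2 ≤ t) (i : ℕ) {L : ℝ} (hL : 0 ≤ L) (m : ℕ) (η' : ℝ) (hη' : 0 < η') :
    ∃ (m' : ℕ) (η : ℝ) (n0 : ℕ), 0 < η ∧ ∀ n, n0 ≤ n → 2 * (t + 1) ≤ n → ∀ ε π ψ h,
      Par ε π ψ h L → ClA t n ε π ψ h i m' η →
      ClA t n ε (nxP t ε π ψ) (nxS t n ε π ψ h) (h + xi t ε π ψ) (i + 1) m η' := by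
  obtain ⟨M, hM1, hM2, hM3⟩ := choose_M (3 * (L + 1) ^ m) ((L + 1) ^ 7 * KC t m) (η' / 2) (by linarith)
  choose K hK0 hK using fun k => stepM ht i hL k m
  set S := ∑ k ∈ range (M + 1), K k with hS
  have hS0 : 0 ≤ S := sum_nonneg fun k _ => hK0 k
  refine ⟨2 * (m + 7 * M), η' / (4 * (S + 1)), ⌈4 * (S + 1) / η'⌉₊, by positivity, ?_⟩
  intro n hn0 hn ε π ψ h hP hA Y Z hG hYm hZm
  obtain ⟨hp, hp1⟩ := p_ok hn hP.e0.le hP.e1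
  have hN := NN_pos hn
  obtain ⟨hl0, hl1⟩ := lam_bd hn hP hG.hY hYm
  obtain ⟨hx0, hx1, -, -⟩ := xi_bd hP t
  obtain ⟨hPP0, hPP1⟩ := PP_bd hP Y
  have hg0 : 0 ≤ h + xi t ε π ψ := by linarith [hP.h0]
  have hnpos : (0 : ℝ) < n := by
    have : 0 < n := by omega
    exact_mod_cast this
  have hninv : (n : ℝ)⁻¹ ≤ η' / (4 * (S + 1)) := by
    rw [inv_le_comm₀ hnpos (by positivity), inv_div]
    exact (Nat.le_ceil _).trans (by exact_mod_cast hn0)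
  have key := num_step (Q := qq t n (ε / NN t n) (i + 1) Y Z * NN t n ^ Z.card)
    (D := PP π ψ Y * (h + xi t ε π ψ) ^ Z.card) (lm := lam t ε π ψ h Y) (Dm := (L + 1) ^ m)
    (Λ := (L + 1) ^ 7 * KC t m) (θ := η' / (4 * (S + 1)) + (n : ℝ)⁻¹) (e := η' / 2) (M := M)
    (a := fun k => MM t n (ε / NN t n) i Y k Z ∅ * NN t n ^ Z.card) (K := K) hl0 hl1
    (mul_nonneg hPP0 (pow_nonneg hg0 _)) ?_ hM2 hK0 (by positivity) ?_ ?_ hM3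
  · rw [PP_update ht hn ε π ψ h hG.hY]
    refine le_trans (le_of_eq ?_) (key.trans ?_)
    · congr 1; ring
    · have : S * (η' / (4 * (S + 1)) + (n : ℝ)⁻¹) ≤ η' / 2 := by
        calc _ ≤ (S + 1) * (η' / (4 * (S + 1)) + η' / (4 * (S + 1))) := by gcongr; linarith
          _ = _ := by field_simp; ring
      linarith
  · calc _ ≤ 1 * (L + 1) ^ m := by
          apply mul_le_mul hPP1 _ (pow_nonneg hg0 _) zero_le_one
          calc _ ≤ (L + 1) ^ Z.card := pow_le_pow_left₀ hg0 (by linarith [hP.hL]) _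
            _ ≤ _ := pow_le_pow_right₀ (by linarith) hZm
      _ = _ := one_mul _
  · intro k hk
    have hk' := mem_range.1 hk
    have := hK k n hn ε π ψ h hP (η' / (4 * (S + 1))) (by positivity)
      (by
        intro Y' Z' hG' h1 h2
        exact hA Y' Z' hG' (h1.trans (by omega)) (h2.trans (by omega))) Y Z Z ∅ hG Fr.nil hYm hZm (by simp)
    simpa using this
  · have := qq_bonf hp hp1 i hG.hY Z M
    have hNp : 0 < NN t n ^ Z.card := by positivity
    have h2 := mul_le_mul_of_nonneg_right this hNp.le
    rw [← abs_of_pos hNp, ← abs_mul, abs_of_pos hNp, sub_mul, sum_mul] at h2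
    simpa only [mul_assoc] using h2

/-- parameter sequences -/
noncomputable def st (t n : ℕ) (ε : ℝ) : ℕ → ℝ × ℝ × ℝ
  | 0 => (1, 1, 0)
  | i + 1 => (nxP t ε (st t n ε i).1 (st t n ε i).2.1,
      nxS t n ε (st t n ε i).1 (st t n ε i).2.1 (st t n ε i).2.2,
      (st t n ε i).2.2 + xi t ε (st t n ε i).1 (st t n ε i).2.1)

theorem st_par {ε : ℝ} (he : 0 < ε) (he1 : ε ≤ 1) (i : ℕ) :
    Par ε (st t n ε i).1 (st t n ε i).2.1 (st t n ε i).2.2 i := by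
  induction i with
  | zero => exact ⟨he, he1, by simp [st], by simp [st], by simp [st], by simp [st], by simp [st], by simp [st]⟩
  | succ i ih =>
    obtain ⟨hx0, hx1, hx2, hx3⟩ := xi_bd ih t
    obtain ⟨-, -, p0, p1, s0, s1, h0, hL⟩ := ih
    refine ⟨he, he1, ?_, ?_, ?_, ?_, ?_, ?_⟩ <;> simp only [st]
    · exact mul_pos p0 (Real.exp_pos _)
    · refine mul_le_one₀ p1 (Real.exp_pos _).le (Real.exp_le_one_iff.2 ?_)
      rw [neg_nonpos]; positivity
    · exact mul_pos s0 (Real.exp_pos _)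
    · refine mul_le_one₀ s1 (Real.exp_pos _).le (Real.exp_le_one_iff.2 ?_)
      rw [neg_nonpos]
      refine sum_nonneg fun j _ => mul_nonneg (cc_nonneg _ _ _) (sub_nonneg.2 ?_)
      exact pow_le_pow_left₀ h0 (by linarith) _
    · linarith
    · push_cast; linarith

theorem claim (ht : 2 ≤ t) {ε : ℝ} (he : 0 < ε) (he1 : ε ≤ 1) (i m : ℕ) (η : ℝ) (hη : 0 < η) :
    ∃ n0 : ℕ, ∀ n, n0 ≤ n → ClA t n ε (st t n ε i).1 (st t n ε i).2.1 (st t n ε i).2.2 i m η := by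
  induction i generalizing m η with
  | zero =>
    refine ⟨0, fun n _ Y Z hG _ _ => ?_⟩
    have hPP : PP 1 1 Y = 1 := by
      rw [PP]; exact prod_eq_one fun a _ => by rw [wt]; split_ifs <;> rfl
    have hS : Y ⊆ SS t n ∅ := by
      rw [sub_SS_iff hG.hY]
      intro a ha κ hκ hs
      exact (KK_ne hκ).ne_empty (subset_empty.1 hs)
    have : qq t n (ε / NN t n) 0 Y Z = if Z = ∅ then 1 else 0 := by
      rw [qq]; simp only [Ex, LinearMap.proj_apply]
      simp [hS, subset_empty]
    simp only [st]
    rw [hPP, this]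
    by_cases hZ : Z = ∅
    · simp [hZ, hη.le]
    · rw [if_neg hZ, zero_pow (by simpa using hZ)]; simp [hη.le]
  | succ i ih =>
    obtain ⟨m', η1, n0, hη1, hstep⟩ := claimStep ht i (L := (i : ℝ)) (by positivity) m η hη
    obtain ⟨n1, h1⟩ := ih m' η1 hη1
    refine ⟨max n0 (max n1 (2 * (t + 1))), fun n hn => ?_⟩
    simp only [max_le_iff] at hn
    exact hstep n hn.1 hn.2.2 ε _ _ _ (st_par he he1 i) (h1 n hn.2.1)

end claim
end BES

namespace BES
open Finset

section traj
variable {t n : ℕ}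

theorem exp_neg_le {u : ℝ} (h0 : 0 ≤ u) (h1 : u ≤ 1) : Real.exp (-u) ≤ 1 - u / 2 := by
  rw [Real.exp_neg]
  have h := Real.add_one_le_exp u
  calc (Real.exp u)⁻¹ ≤ (u + 1)⁻¹ := inv_anti₀ (by linarith) h
    _ ≤ 1 - u / 2 := by
      rw [inv_le_iff_one_le_mul₀ (by linarith)]
      nlinarith

theorem st_inv {ε : ℝ} (he : 0 < ε) (he1 : ε ≤ 1) (i : ℕ) :
    1 ≤ (st t n ε i).1 + (st t n ε i).2.2 ∧ (st t n ε i).2.2 ≤ 2 * (1 - (st t n ε i).1) ∧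
    (st t n ε i).2.1 = Real.exp (-(∑ j ∈ range 8, cc t n j * ((st t n ε i).2.2 ^ j - 0 ^ j))) := by
  induction i with
  | zero => simp [st]
  | succ i ih =>
    have hP := st_par (t := t) (n := n) he he1 i
    obtain ⟨hx0, hx1, hx2, hx3⟩ := xi_bd hP t
    obtain ⟨h1, h2, h3⟩ := ih
    have p0 := hP.p0
    simp only [st]
    set π := (st t n ε i).1
    set ψ := (st t n ε i).2.1
    set h := (st t n ε i).2.2
    set ξ := xi t ε π ψ
    have hu0 : 0 ≤ π⁻¹ * ξ := by positivity
    have hpu : π * (π⁻¹ * ξ) = ξ := by field_simp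
    refine ⟨?_, ?_, ?_⟩
    · rw [nxP]
      have := Real.add_one_le_exp (-(π⁻¹ * ξ))
      have := mul_le_mul_of_nonneg_left this p0.le
      change 1 ≤ π * Real.exp (-(π⁻¹ * ξ)) + (h + ξ)
      nlinarith
    · have := exp_neg_le hu0 hx2
      have := mul_le_mul_of_nonneg_left this p0.le
      change h + ξ ≤ 2 * (1 - π * Real.exp (-(π⁻¹ * ξ)))
      nlinarith
    · change ψ * Real.exp (-(∑ j ∈ range 8, cc t n j * ((h + ξ) ^ j - h ^ j))) = _
      rw [h3, ← Real.exp_add, ← neg_add, ← sum_add_distrib]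
      congr 2
      exact sum_congr rfl fun j _ => by ring

noncomputable def psm (t : ℕ) : ℝ := Real.exp (-(8 * (CC t (t + 2) * 2 ^ 7)))

theorem st_psm (ht : 2 ≤ t) (hn : 2 * (t + 1) ≤ n) {ε : ℝ} (he : 0 < ε) (he1 : ε ≤ 1) (i : ℕ) :
    psm t ≤ (st t n ε i).2.1 ∧ (st t n ε i).2.2 ≤ 2 := by
  obtain ⟨h1, h2, h3⟩ := st_inv (t := t) (n := n) he he1 i
  have hP := st_par (t := t) (n := n) he he1 i
  have hh : (st t n ε i).2.2 ≤ 2 := by linarith [hP.p0]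
  refine ⟨?_, hh⟩
  rw [h3, psm]
  apply Real.exp_le_exp.2
  rw [neg_le_neg_iff]
  refine (sum_le_card_nsmul _ _ (CC t (t + 2) * 2 ^ 7) ?_).trans (by simp)
  intro j hj
  have hj' := mem_range.1 hj
  have hp : (st t n ε i).2.2 ^ j ≤ 2 ^ 7 :=
    (pow_le_pow_left₀ hP.h0 hh j).trans (pow_le_pow_right₀ (by norm_num) (by omega))
  calc _ ≤ cc t n j * 2 ^ 7 := by
        apply mul_le_mul_of_nonneg_left _ (cc_nonneg _ _ _)
        have : (0 : ℝ) ≤ 0 ^ j := by positivity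
        linarith
    _ ≤ _ := mul_le_mul_of_nonneg_right (cc_le hn ht j) (by norm_num)

theorem st_low (ht : 2 ≤ t) (hn : 2 * (t + 1) ≤ n) {ε : ℝ} (he : 0 < ε) (he1 : ε ≤ 1) {δ : ℝ}
    (hδ : 0 < δ) (i : ℕ) (h : δ ≤ (st t n ε i).1) :
    i * ε * (δ ^ ((t + 2).choose 2) * psm t) ≤ (st t n ε i).2.2 := by
  induction i with
  | zero => simp [st]
  | succ i ih =>
    have hP := st_par (t := t) (n := n) he he1 i
    have hP' := st_par (t := t) (n := n) he he1 (i + 1)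
    obtain ⟨hx0, hx1, hx2, hx3⟩ := xi_bd hP t
    have p0 := hP.p0
    have hle : (st t n ε (i + 1)).1 ≤ (st t n ε i).1 := by
      simp only [st, nxP]
      apply mul_le_of_le_one_right hP.p0.le
      apply Real.exp_le_one_iff.2
      rw [neg_nonpos]; positivity
    have hi := ih (h.trans hle)
    have hps : 0 < psm t := Real.exp_pos _
    have : ε * (δ ^ ((t + 2).choose 2) * psm t) ≤ xi t ε (st t n ε i).1 (st t n ε i).2.1 := by
      rw [xi]
      apply mul_le_mul_of_nonneg_left _ he.le
      exact mul_le_mul (pow_le_pow_left₀ hδ.le (h.trans hle) _) (st_psm ht hn he he1 i).1 hps.le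
        (by positivity)
    simp only [st]
    push_cast
    linarith

theorem traj (ht : 2 ≤ t) {δ : ℝ} (hδ : 0 < δ) : ∃ τ : ℝ, 0 < τ ∧ ∀ (K : ℕ) (ε : ℝ), 0 < ε → ε ≤ 1 →
    τ ≤ K * ε → ∀ n, 2 * (t + 1) ≤ n → 1 - δ ≤ (st t n ε K).2.2 := by
  have hps : 0 < psm t := Real.exp_pos _
  refine ⟨2 / (δ ^ ((t + 2).choose 2) * psm t), by positivity, ?_⟩
  intro K ε he he1 hτ n hn
  obtain ⟨h1, h2, -⟩ := st_inv (t := t) (n := n) he he1 K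
  have hP := st_par (t := t) (n := n) he he1 K
  by_cases hc : δ ≤ (st t n ε K).1
  · have := st_low ht hn he he1 hδ K hc
    rw [div_le_iff₀ (by positivity)] at hτ
    linarith [hP.p0]
  · push Not at hc
    linarith

end traj
end BES

namespace BES
open Finset

section waste
variable {t n : ℕ} {p : ℝ}

theorem E2_const (i : ℕ) (A : Finset (Finset (Fin n)) → ℝ) :
    E2 t n p i (fun H _ => A H) = Ex t n p i A := by
  rw [E2_apply]
  congr 1
  funext H
  have : (fun _ : Finset (Finset (Fin n)) => A H) = A H • (fun _ => (1 : ℝ)) := by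
    funext R; simp
  rw [this, map_smul, Ep_one, smul_eq_mul, mul_one]

theorem E2_prod (i : ℕ) (A : Finset (Finset (Fin n)) → ℝ) {T : Finset (Finset (Fin n))}
    (hT : T ⊆ XX t n) :
    E2 t n p i (fun H R => A H * (if T ⊆ R then 1 else 0)) = p ^ T.card * Ex t n p i A := by
  rw [E2_apply, ← smul_eq_mul, ← map_smul]
  congr 1
  funext H
  have : (fun R : Finset (Finset (Fin n)) => A H * (if T ⊆ R then (1 : ℝ) else 0)) =
      A H • (fun R => if T ⊆ R then (1 : ℝ) else 0) := by
    funext R; simp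
  rw [this, map_smul, Ep_sub hT, Pi.smul_apply, smul_eq_mul, smul_eq_mul, mul_comm]

/-- a set none of whose edges can be added once the others are present -/
def Kill (t n : ℕ) (C : Finset (Finset (Fin n))) : Prop :=
  ∀ H, ∀ e ∈ C, C.erase e ⊆ H → e ∉ SS t n H

theorem waste_pt {C : Finset (Finset (Fin n))} (hC : Kill t n C) (H R : Finset (Finset (Fin n))) :
    (if C ⊆ H ∪ (R ∩ SS t n H) then (1 : ℝ) else 0) ≤ (if C ⊆ H then 1 else 0) +
      ∑ T ∈ C.powerset with 2 ≤ T.card, (if C \ T ⊆ H then 1 else 0) * (if T ⊆ R then 1 else 0) := by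
  have hnn : ∀ T ∈ C.powerset.filter (fun T => 2 ≤ T.card),
      (0 : ℝ) ≤ (if C \ T ⊆ H then 1 else 0) * (if T ⊆ R then 1 else 0) := fun T _ => by
    split_ifs <;> norm_num
  have hs := sum_nonneg hnn
  by_cases h : C ⊆ H ∪ (R ∩ SS t n H)
  · rw [if_pos h]
    by_cases h0 : C ⊆ H
    · rw [if_pos h0]; linarith
    · rw [if_neg h0, zero_add]
      have hTR : C \ H ⊆ R ∩ SS t n H := by
        intro e he
        rw [mem_sdiff] at he
        rcases mem_union.1 (h he.1) with h1 | h1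
        · exact absurd h1 he.2
        · exact h1
      have hpos : (C \ H).Nonempty := by
        rw [nonempty_iff_ne_empty]
        intro h1
        exact h0 (sdiff_eq_empty_iff_subset.1 h1)
      have hne1 : (C \ H).card ≠ 1 := by
        intro h1
        obtain ⟨e, he⟩ := card_eq_one.1 h1
        have hem : e ∈ C \ H := by rw [he]; simp
        refine hC H e (mem_sdiff.1 hem).1 ?_ (mem_inter.1 (hTR hem)).2
        intro f hf
        by_contra hfH
        have : f ∈ C \ H := mem_sdiff.2 ⟨mem_of_mem_erase hf, hfH⟩
        rw [he, mem_singleton] at this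
        exact ne_of_mem_erase hf this
      have hcp := hpos.card_pos
      have hmem : C \ H ∈ C.powerset.filter (fun T => 2 ≤ T.card) :=
        mem_filter.2 ⟨mem_powerset.2 sdiff_subset, by omega⟩
      refine le_trans (le_of_eq ?_) (single_le_sum hnn hmem)
      rw [if_pos, if_pos (hTR.trans inter_subset_left), one_mul]
      intro e he
      simp only [mem_sdiff, not_and, not_not] at he
      exact he.2 he.1
  · rw [if_neg h]
    have : (0 : ℝ) ≤ if C ⊆ H then 1 else 0 := by split_ifs <;> norm_num
    linarith

theorem waste_step (hp : 0 ≤ p) (hp1 : p ≤ 1) {C : Finset (Finset (Fin n))} (hCX : C ⊆ XX t n)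
    (hC : Kill t n C) {K i : ℕ} (hi : i ≤ K) (hK : 1 ≤ K) :
    Ex t n p (i + 1) (fun H => if C ⊆ H then 1 else 0) ≤
      Ex t n p i (fun H => if C ⊆ H then 1 else 0) + 2 ^ C.card * (K : ℝ) ^ (C.card - 2) * p ^ C.card := by
  rw [Ex_succ]
  have h1 := E2_mono (t := t) hp hp1 i (fun H R => waste_pt hC H R)
  refine h1.trans ?_
  have e1 : (fun H R : Finset (Finset (Fin n)) => (if C ⊆ H then (1 : ℝ) else 0) +
      ∑ T ∈ C.powerset with 2 ≤ T.card, (if C \ T ⊆ H then 1 else 0) * (if T ⊆ R then 1 else 0)) =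
      (fun H _ => if C ⊆ H then (1 : ℝ) else 0) + ∑ T ∈ C.powerset with 2 ≤ T.card,
        (fun H R => (if C \ T ⊆ H then (1 : ℝ) else 0) * (if T ⊆ R then 1 else 0)) := by
    funext H R
    simp only [Pi.add_apply, Finset.sum_apply]
  rw [e1, map_add, map_sum, E2_const]
  gcongr
  calc _ ≤ ∑ T ∈ C.powerset with 2 ≤ T.card, (K : ℝ) ^ (C.card - 2) * p ^ C.card := by
        apply sum_le_sum
        intro T hT
        rw [mem_filter, mem_powerset] at hT
        rw [E2_prod i _ (hT.1.trans hCX)]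
        have hcr := Ex_crude (t := t) hp hp1 i (C \ T)
        have hcard : (C \ T).card + T.card = C.card := card_sdiff_add_card_eq_card hT.1
        calc _ ≤ p ^ T.card * ((i * p) ^ (C \ T).card) :=
              mul_le_mul_of_nonneg_left hcr (by positivity)
          _ = (i : ℝ) ^ (C \ T).card * p ^ C.card := by rw [← hcard, mul_pow, pow_add]; ring
          _ ≤ (K : ℝ) ^ (C.card - 2) * p ^ C.card := by
              apply mul_le_mul_of_nonneg_right _ (by positivity)
              calc (i : ℝ) ^ (C \ T).card ≤ (K : ℝ) ^ (C \ T).card := by gcongr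
                _ ≤ _ := pow_le_pow_right₀ (by exact_mod_cast hK) (by omega)
    _ ≤ ∑ T ∈ C.powerset, (K : ℝ) ^ (C.card - 2) * p ^ C.card :=
        sum_le_sum_of_subset_of_nonneg (filter_subset _ _) (fun _ _ _ => by positivity)
    _ = _ := by rw [sum_const, card_powerset, nsmul_eq_mul]; push_cast; ring

theorem waste (hp : 0 ≤ p) (hp1 : p ≤ 1) {C : Finset (Finset (Fin n))} (hCX : C ⊆ XX t n)
    (hC2 : 2 ≤ C.card) (hC : Kill t n C) {K : ℕ} (hK : 1 ≤ K) :
    Ex t n p K (fun H => if C ⊆ H then 1 else 0) ≤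
      2 ^ C.card * (K : ℝ) ^ (C.card - 1) * p ^ C.card := by
  have key : ∀ i, i ≤ K → Ex t n p i (fun H => if C ⊆ H then 1 else 0) ≤
      i * (2 ^ C.card * (K : ℝ) ^ (C.card - 2) * p ^ C.card) := by
    intro i
    induction i with
    | zero =>
      intro _
      simp only [Ex, LinearMap.proj_apply]
      rw [if_neg]
      · simp
      · intro h
        rw [subset_empty.1 h] at hC2
        simp at hC2
    | succ i ih =>
      intro hi
      have := waste_step hp hp1 hCX hC (K := K) (i := i) (by omega) hK
      have := ih (by omega)
      push_cast
      linarith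
  refine (key K le_rfl).trans (le_of_eq ?_)
  have : (K : ℝ) ^ (C.card - 1) = K * K ^ (C.card - 2) := by
    rw [← pow_succ']; congr 1; omega
  rw [this]; ring

open Classical in
noncomputable def Bad1 (t n : ℕ) : Finset (Finset (Finset (Fin n))) :=
  (XX t n).powerset.filter (fun C => 2 ≤ C.card ∧ C.card ≤ 8 ∧ (vs C).card ≤ t * C.card + 2 ∧ Kill t n C)

noncomputable def Bad2 (t n : ℕ) : Finset (Finset (Finset (Fin n))) :=
  (XX t n).powerset.filter (fun C => 2 ≤ C.card ∧ C.card ≤ 8 ∧ (vs C).card ≤ t * C.card + 1)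

theorem bad_min (ht : 2 ≤ t) {S : Finset (Finset (Fin n))} (hS : S ⊆ XX t n) (h8 : S.card = 8)
    (hv : (vs S).card ≤ 8 * t + 2) : ∃ C ⊆ S, C ∈ Bad1 t n ∨ C ∈ Bad2 t n := by
  obtain ⟨C, hCm, hmin⟩ := exists_min_image
    (S.powerset.filter (fun C => 2 ≤ C.card ∧ (vs C).card ≤ t * C.card + 2)) card
    ⟨S, by simp [h8]; omega⟩
  rw [mem_filter, mem_powerset] at hCm
  obtain ⟨hCS, hC2, hCv⟩ := hCm
  have hC8 : C.card ≤ 8 := h8 ▸ card_le_card hCS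
  have hCX := hCS.trans hS
  refine ⟨C, hCS, ?_⟩
  by_cases h1 : (vs C).card ≤ t * C.card + 1
  · right; simp only [Bad2, mem_filter, mem_powerset]; exact ⟨hCX, hC2, hC8, h1⟩
  left
  simp only [Bad1, mem_filter, mem_powerset]
  refine ⟨hCX, hC2, hC8, hCv, ?_⟩
  intro H e he hs heS
  rw [mem_SS] at heS
  rcases eq_or_lt_of_le hC2 with h2 | h3
  · obtain ⟨x, y, hxy, hC⟩ := card_eq_two.1 h2.symm
    obtain ⟨f, hfe, hC'⟩ : ∃ f, f ≠ e ∧ C = {e, f} := by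
      rw [hC] at he
      rcases mem_insert.1 he with rfl | h
      · exact ⟨y, hxy.symm, hC⟩
      · rw [mem_singleton] at h; subst h
        exact ⟨x, hxy, by rw [hC, pair_comm]⟩
    have hfC : f ∈ C := by rw [hC']; simp
    have hfX := hCX hfC
    rw [← h2, hC', vs_pair] at hCv
    have hc := card_union_add_card_inter e f
    rw [mem_XX.1 heS.1, mem_XX.1 hfX] at hc
    obtain ⟨a, ha, ha2⟩ := exists_subset_card_eq (show 2 ≤ (e ∩ f).card by omega)
    refine heS.2 a (mem_insert_of_mem (mem_powersetCard.2 ⟨ha.trans inter_subset_left, ha2⟩)) {f}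
      ((mem_KK_pair ha2).2 ⟨f, hfX, ha.trans inter_subset_right, rfl⟩) ?_
    rw [singleton_subset_iff]
    exact hs (mem_erase.2 ⟨hfe, hfC⟩)
  · refine heS.2 e (mem_insert_self _ _) (C.erase e) ?_ hs
    rw [mem_KK_edge (by rw [mem_XX.1 heS.1]; omega), insert_erase he, mem_Conf]
    refine ⟨by simp, hCX, h3, hC8, by omega, ?_⟩
    intro C' hC' hne h2'
    by_contra hcon
    have := hmin C' (mem_filter.2 ⟨mem_powerset.2 (hC'.trans hCS), h2', by omega⟩)
    exact hne (eq_of_subset_of_card_le hC' this)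

/-- deletion -/
theorem deletion (ht : 2 ≤ t) (H : Finset (Finset (Fin n))) :
    ∃ G : Finset (Finset (Fin n)), (∀ e ∈ G, e.card = t + 2) ∧
      (∀ S ⊆ G, S.card = 8 → 8 * t + 2 < (vs S).card) ∧
      (H ∩ XX t n).card ≤ G.card + ((Bad1 t n).filter (fun C => C ⊆ H)).card +
        ((Bad2 t n).filter (fun C => C ⊆ H)).card := by
  classical
  set B := (Bad1 t n).filter (fun C => C ⊆ H) ∪ (Bad2 t n).filter (fun C => C ⊆ H) with hB
  have hne : ∀ C ∈ B, ∃ e, e ∈ C := by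
    intro C hC
    have : 2 ≤ C.card := by
      simp only [hB, Bad1, Bad2, mem_union, mem_filter] at hC
      rcases hC with h | h
      · exact h.1.2.1
      · exact h.1.2.1
    exact card_pos.1 (by omega)
  choose! g hg using hne
  refine ⟨(H ∩ XX t n) \ B.image g, ?_, ?_, ?_⟩
  · intro e he
    exact mem_XX.1 (mem_inter.1 (mem_sdiff.1 he).1).2
  · intro S hS h8
    by_contra hcon
    push Not at hcon
    obtain ⟨C, hCS, hC⟩ := bad_min ht (fun e he => (mem_inter.1 (mem_sdiff.1 (hS he)).1).2) h8 hcon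
    have hCB : C ∈ B := by
      have hCH : C ⊆ H := fun e he => (mem_inter.1 (mem_sdiff.1 (hS (hCS he))).1).1
      rw [hB, mem_union, mem_filter, mem_filter]
      tauto
    exact (mem_sdiff.1 (hS (hCS (hg C hCB)))).2 (mem_image_of_mem g hCB)
  · have h1 := le_card_sdiff (B.image g) (H ∩ XX t n)
    have h2 : (B.image g).card ≤ B.card := card_image_le
    have h3 : B.card ≤ _ := card_union_le ((Bad1 t n).filter (fun C => C ⊆ H)) _
    omega

end waste
end BES

namespace BES
open Finset

section lower
variable {t n : ℕ}

/-- sums over families with few vertices, scaled by powers of the main counting quantity -/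
theorem sum_bad_le (hn : 2 * (t + 1) ≤ n) (P : Finset (Finset (Finset (Fin n)))) (s : ℕ)
    (hP : ∀ C ∈ P, C.card ≤ 8 ∧ (vs C).card ≤ t * C.card + s) (w : ℝ) (hw : 0 ≤ w) :
    ∑ C ∈ P, (w / NN t n) ^ C.card ≤
      (∑ j ∈ range 9, 2 ^ (2 ^ (t * j + s)) * (w * (2 ^ t * t.factorial)) ^ j) * (n : ℝ) ^ s := by
  have hN := NN_pos hn
  rw [← sum_fiberwise_of_maps_to (g := card) (t := range 9)
    (fun C hC => mem_range.2 (by have := (hP C hC).1; omega)), sum_mul]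
  apply sum_le_sum
  intro j hj
  rw [sum_congr rfl (g := fun _ => (w / NN t n) ^ j)
    (fun C hC => by rw [(mem_filter.1 hC).2]), sum_const, nsmul_eq_mul]
  have hc := count_le (n := n) (by omega) ∅ (t * j + s) (P.filter (fun C => C.card = j)) (by
    intro C hC
    rw [mem_filter] at hC
    have := (hP C hC.1).2
    rw [hC.2] at this
    simpa using this)
  have hc' : ((P.filter (fun C => C.card = j)).card : ℝ) ≤
      (n : ℝ) ^ (t * j + s) * 2 ^ (2 ^ (t * j + s)) := by
    have : (P.filter (fun C => C.card = j)).card ≤ n ^ (t * j + s) * 2 ^ (2 ^ (t * j + s)) := by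
      simpa using hc
    exact_mod_cast this
  have hl : ((n : ℝ) ^ t) ^ j ≤ (2 ^ t * t.factorial * NN t n) ^ j :=
    pow_le_pow_left₀ (by positivity) (NN_lower hn) j
  calc _ ≤ (n : ℝ) ^ (t * j + s) * 2 ^ (2 ^ (t * j + s)) * (w / NN t n) ^ j := by gcongr
    _ = ((n : ℝ) ^ t) ^ j * (2 ^ (2 ^ (t * j + s)) * (w / NN t n) ^ j * (n : ℝ) ^ s) := by
        rw [pow_add (n : ℝ), pow_mul]; ring
    _ ≤ (2 ^ t * t.factorial * NN t n) ^ j * (2 ^ (2 ^ (t * j + s)) * (w / NN t n) ^ j * (n : ℝ) ^ s) := by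
        gcongr
    _ = _ := by
        simp only [div_pow, mul_pow]
        field_simp

theorem XX_card_real (hn : 2 * (t + 1) ≤ n) :
    ((XX t n).card : ℝ) = (n.choose 2 : ℝ) / ((t + 2).choose 2 : ℝ) * NN t n := by
  have h := Nat.choose_mul (n := n) (k := t + 2) (s := 2) (by omega)
  have h1 : (XX t n).card = n.choose (t + 2) := by simp [XX, card_powersetCard]
  have h2 : ((t + 2).choose 2 : ℝ) ≠ 0 := by
    have := C0_pos t
    positivity
  rw [h1, NN, div_mul_eq_mul_div, eq_div_iff h2]
  simp only [Nat.add_sub_cancel] at h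
  exact_mod_cast h

theorem good_single {e : Finset (Fin n)} (he : e ∈ XX t n) : Good t n ∅ {e} := by
  refine ⟨by simp, by simpa using he, ?_, by simp, by simp, ?_⟩
  · intro z hz z' hz' hne
    rw [mem_singleton] at hz hz'
    exact absurd (hz.trans hz'.symm) hne
  · intro C hC hs
    have h1 := card_le_card hs
    have h2 := (mem_Conf.1 hC).2.1
    simp at h1
    omega

set_option maxHeartbeats 1000000 in
theorem lower_bound (ht : 2 ≤ t) {γ : ℝ} (hγ : 0 < γ) : ∃ n0 : ℕ, ∀ n, n0 ≤ n →
    ∃ G : Finset (Finset (Fin n)), (∀ e ∈ G, e.card = t + 2) ∧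
      (∀ S ⊆ G, S.card = 8 → 8 * t + 2 < (vs S).card) ∧
      (n.choose 2 : ℝ) / ((t + 2).choose 2 : ℝ) - γ * (n : ℝ) ^ 2 ≤ G.card := by
  obtain ⟨τ, hτ, htraj⟩ := traj ht (δ := γ / 4) (by linarith)
  set A1 : ℝ := ∑ j ∈ range 9, 2 ^ (2 ^ (t * j + 2)) * ((2 * τ) * (2 ^ t * t.factorial)) ^ j with hA1
  set A2 : ℝ := ∑ j ∈ range 9, 2 ^ (2 ^ (t * j + 1)) * (τ * (2 ^ t * t.factorial)) ^ j with hA2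
  have hA10 : 0 ≤ A1 := sum_nonneg fun j _ => by positivity
  have hA20 : 0 ≤ A2 := sum_nonneg fun j _ => by positivity
  obtain ⟨K, hK⟩ := exists_nat_ge (max 1 (max τ (4 * A1 / γ)))
  simp only [max_le_iff] at hK
  obtain ⟨hK1, hKτ, hKA⟩ := hK
  have hK1' : 1 ≤ K := by exact_mod_cast hK1
  have hKpos : (0 : ℝ) < K := by linarith
  obtain ⟨ε, hε⟩ : ∃ ε : ℝ, ε = τ / K := ⟨_, rfl⟩
  have he : 0 < ε := by rw [hε]; positivity
  have he1 : ε ≤ 1 := by rw [hε, div_le_one hKpos]; exact hKτ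
  have hKε : K * ε = τ := by rw [hε]; field_simp
  obtain ⟨n0, hcl⟩ := claim ht he he1 K 1 (γ / 4) (by linarith)
  refine ⟨max n0 (max (2 * (t + 1)) ⌈4 * A2 / γ⌉₊), ?_⟩
  intro n hn'
  simp only [max_le_iff] at hn'
  obtain ⟨hn0, hn, hn2⟩ := hn'
  have hN := NN_pos hn
  obtain ⟨hp, hp1⟩ := p_ok hn he.le he1
  have hnA : 4 * A2 / γ ≤ n := (Nat.le_ceil _).trans (by exact_mod_cast hn2)
  have hh := htraj K ε he he1 (by rw [hKε]) n hn
  have hcl' := hcl n hn0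
  obtain ⟨H, hH⟩ := Ex_exists (t := t) (n := n) hp hp1 K
    (∑ e ∈ XX t n, (fun H => if (∅ : Finset (Finset (Fin n))) ⊆ SS t n H ∧ {e} ⊆ H then (1 : ℝ) else 0) -
      ∑ C ∈ Bad1 t n, (fun H => if C ⊆ H then (1 : ℝ) else 0) -
      ∑ C ∈ Bad2 t n, (fun H => if C ⊆ H then (1 : ℝ) else 0))
  rw [map_sub, map_sub, map_sum, map_sum, map_sum] at hH
  obtain ⟨G, hG1, hG2, hG3⟩ := deletion ht H
  refine ⟨G, hG1, hG2, ?_⟩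
  -- evaluate the functional at H
  have eval : (∑ e ∈ XX t n, (fun H => if (∅ : Finset (Finset (Fin n))) ⊆ SS t n H ∧ {e} ⊆ H then (1 : ℝ) else 0) -
      ∑ C ∈ Bad1 t n, (fun H => if C ⊆ H then (1 : ℝ) else 0) -
      ∑ C ∈ Bad2 t n, (fun H => if C ⊆ H then (1 : ℝ) else 0)) H =
      ((H ∩ XX t n).card : ℝ) - ((Bad1 t n).filter (fun C => C ⊆ H)).card -
        ((Bad2 t n).filter (fun C => C ⊆ H)).card := by
    simp only [Pi.sub_apply, Finset.sum_apply, sum_boole, empty_subset, true_and,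
      singleton_subset_iff]
    rw [filter_mem_eq_inter, inter_comm]
  rw [eval] at hH
  have hG3' : ((H ∩ XX t n).card : ℝ) ≤ G.card + ((Bad1 t n).filter (fun C => C ⊆ H)).card +
      ((Bad2 t n).filter (fun C => C ⊆ H)).card := by exact_mod_cast hG3
  -- main term
  have hmain : ((XX t n).card : ℝ) * ((1 - γ / 2) / NN t n) ≤
      ∑ e ∈ XX t n, Ex t n (ε / NN t n) K
        (fun H => if (∅ : Finset (Finset (Fin n))) ⊆ SS t n H ∧ {e} ⊆ H then (1 : ℝ) else 0) := by
    rw [← nsmul_eq_mul]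
    apply card_nsmul_le_sum
    intro e hx
    have h := hcl' ∅ {e} (good_single hx) (by simp) (by simp)
    have hPP : PP (st t n ε K).1 (st t n ε K).2.1 (∅ : Finset (Finset (Fin n))) = 1 := by simp [PP, DD]
    rw [hPP, card_singleton, pow_one, pow_one, one_mul] at h
    have h' := (abs_le.1 h).1
    rw [div_le_iff₀ hN]
    change _ ≤ qq t n (ε / NN t n) K ∅ {e} * NN t n
    linarith
  have hb1 : ∑ C ∈ Bad1 t n, Ex t n (ε / NN t n) K (fun H => if C ⊆ H then (1 : ℝ) else 0) ≤
      A1 / K * (n : ℝ) ^ 2 := by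
    have h1 := sum_bad_le hn (Bad1 t n) 2 (by
      intro C hC
      simp only [Bad1, mem_filter] at hC
      exact ⟨hC.2.2.1, hC.2.2.2.1⟩) (2 * τ) (by positivity)
    rw [← hA1] at h1
    calc _ ≤ ∑ C ∈ Bad1 t n, (K : ℝ)⁻¹ * ((2 * τ) / NN t n) ^ C.card := by
          apply sum_le_sum
          intro C hC
          simp only [Bad1, mem_filter, mem_powerset] at hC
          obtain ⟨hCX, hC2, -, -, hk⟩ := hC
          refine (waste hp hp1 hCX hC2 hk hK1').trans (le_of_eq ?_)
          rw [← hKε]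
          have : (K : ℝ) ^ (C.card) = K * K ^ (C.card - 1) := by
            rw [← pow_succ']; congr 1; omega
          rw [div_pow, div_pow, mul_pow, mul_pow, this]
          field_simp
      _ = (K : ℝ)⁻¹ * ∑ C ∈ Bad1 t n, ((2 * τ) / NN t n) ^ C.card := by rw [mul_sum]
      _ ≤ (K : ℝ)⁻¹ * (A1 * (n : ℝ) ^ 2) := by gcongr
      _ = _ := by ring
  have hb2 : ∑ C ∈ Bad2 t n, Ex t n (ε / NN t n) K (fun H => if C ⊆ H then (1 : ℝ) else 0) ≤
      A2 * n := by
    have h1 := sum_bad_le hn (Bad2 t n) 1 (by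
      intro C hC
      simp only [Bad2, mem_filter] at hC
      exact ⟨hC.2.2.1, hC.2.2.2⟩) τ hτ.le
    rw [← hA2, pow_one] at h1
    refine (sum_le_sum fun C _ => Ex_crude hp hp1 K C).trans ?_
    rw [← mul_div_assoc, hKε]
    exact h1
  rw [XX_card_real hn] at hmain
  have hA : (n.choose 2 : ℝ) / ((t + 2).choose 2 : ℝ) ≤ (n : ℝ) ^ 2 := by
    have h1 : (1 : ℝ) ≤ ((t + 2).choose 2 : ℝ) := by exact_mod_cast C0_pos t
    have h2 : (n.choose 2 : ℝ) ≤ (n : ℝ) ^ 2 := by exact_mod_cast Nat.choose_le_pow n 2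
    rw [div_le_iff₀ (by linarith)]
    nlinarith [sq_nonneg (n : ℝ)]
  set Q := (n.choose 2 : ℝ) / ((t + 2).choose 2 : ℝ)
  have hm2 : Q * NN t n * ((1 - γ / 2) / NN t n) = Q * (1 - γ / 2) := by field_simp
  rw [hm2] at hmain
  have hw1 : A1 / K * (n : ℝ) ^ 2 ≤ γ / 4 * (n : ℝ) ^ 2 := by
    apply mul_le_mul_of_nonneg_right _ (by positivity)
    rw [div_le_iff₀ hγ] at hKA
    rw [div_le_iff₀ hKpos]; linarith
  have hw2 : A2 * n ≤ γ / 4 * (n : ℝ) ^ 2 := by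
    rw [div_le_iff₀ hγ] at hnA
    have hn0' : (0 : ℝ) ≤ n := by positivity
    nlinarith
  nlinarith

end lower
end BES

namespace BES
open Finset

theorem fBES_le {n t : ℕ} (ht : 2 ≤ t) :
    fBES (t + 2) n (8 * t + 2) 8 * (t + 2).choose 2 ≤ n.choose 2 + 168 * (t + 2).choose 2 * n := by
  have hmem : fBES (t + 2) n (8 * t + 2) 8 ∈ {m : ℕ | ∃ G : Finset (Finset (Fin n)),
      (∀ e ∈ G, e.card = t + 2) ∧ ¬ HasConfig G (8 * t + 2) 8 ∧ G.card = m} := by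
    apply Nat.sSup_mem
    · refine ⟨0, ∅, by simp, ?_, by simp⟩
      rintro ⟨S, hS, h8, -⟩
      rw [subset_empty.1 hS] at h8
      simp at h8
    · refine ⟨Fintype.card (Finset (Fin n)), ?_⟩
      rintro m ⟨G, -, -, rfl⟩
      exact card_le_univ G
  obtain ⟨G, hG, hc, hm⟩ := hmem
  rw [← hm]
  have := upper_bound G t ht hG (by
    intro S hS h8
    by_contra hcon
    push Not at hcon
    exact hc ⟨S, hS, h8, hcon⟩)
  simpa using this

theorem le_fBES {n t : ℕ} (G : Finset (Finset (Fin n))) (h1 : ∀ e ∈ G, e.card = t + 2)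
    (h2 : ∀ S ⊆ G, S.card = 8 → 8 * t + 2 < (vs S).card) :
    G.card ≤ fBES (t + 2) n (8 * t + 2) 8 := by
  apply le_csSup
  · refine ⟨Fintype.card (Finset (Fin n)), ?_⟩
    rintro m ⟨G, -, -, rfl⟩
    exact card_le_univ G
  · refine ⟨G, h1, ?_, rfl⟩
    rintro ⟨S, hS, h8, hv⟩
    exact absurd (h2 S hS h8) (not_lt.2 hv)

theorem main {t : ℕ} (ht : 2 ≤ t) :
    Filter.Tendsto (fun n : ℕ => (fBES (t + 2) n (8 * t + 2) 8 : ℝ) / (n : ℝ) ^ 2)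
      Filter.atTop (nhds (1 / (((t + 2 : ℕ) : ℝ) ^ 2 - ((t + 2 : ℕ) : ℝ)))) := by
  set r : ℝ := ((t + 2 : ℕ) : ℝ) with hr
  have hr4 : 4 ≤ r := by rw [hr]; exact_mod_cast (by omega : 4 ≤ t + 2)
  have hden : 0 < r ^ 2 - r := by nlinarith
  set l := 1 / (r ^ 2 - r) with hl
  have hl0 : 0 < l := by positivity
  have hQ : ∀ n : ℕ, (n.choose 2 : ℝ) / ((t + 2).choose 2 : ℝ) = l * n ^ 2 - l * n := by
    intro n
    rw [Nat.cast_choose_two, Nat.cast_choose_two, ← hr, hl]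
    have h1 : r ≠ 0 := by linarith
    have h2 : r - 1 ≠ 0 := by linarith
    have h3 : r ^ 2 - r = r * (r - 1) := by ring
    rw [h3]
    field_simp
  have hC0 : (0 : ℝ) < ((t + 2).choose 2 : ℝ) := by exact_mod_cast C0_pos t
  rw [tendsto_order]
  constructor
  · intro a ha
    obtain ⟨n0, h0⟩ := lower_bound ht (γ := (l - a) / 2) (by linarith)
    have hev : ∀ᶠ n : ℕ in Filter.atTop, 2 * l / (l - a) < n :=
      (tendsto_natCast_atTop_atTop (R := ℝ)).eventually_gt_atTop _
    filter_upwards [Filter.eventually_ge_atTop n0, hev] with n hn hn2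
    obtain ⟨G, h1, h2, h3⟩ := h0 n hn
    have h4 : (G.card : ℝ) ≤ fBES (t + 2) n (8 * t + 2) 8 := by exact_mod_cast le_fBES G h1 h2
    have hnpos : (0 : ℝ) < n := lt_of_le_of_lt (div_nonneg (by linarith) (by linarith)) hn2
    rw [hQ] at h3
    rw [div_lt_iff₀ (by linarith)] at hn2
    rw [lt_div_iff₀ (by positivity)]
    nlinarith
  · intro b hb
    have hev : ∀ᶠ n : ℕ in Filter.atTop, 168 / (b - l) < n :=
      (tendsto_natCast_atTop_atTop (R := ℝ)).eventually_gt_atTop _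
    filter_upwards [hev] with n hn2
    have hnpos : (0 : ℝ) < n := lt_of_le_of_lt (div_nonneg (by linarith) (by linarith)) hn2
    have h1 : (fBES (t + 2) n (8 * t + 2) 8 : ℝ) * ((t + 2).choose 2 : ℝ) ≤
        n.choose 2 + 168 * ((t + 2).choose 2 : ℝ) * n := by exact_mod_cast fBES_le ht
    have h2 : (fBES (t + 2) n (8 * t + 2) 8 : ℝ) ≤ l * n ^ 2 - l * n + 168 * n := by
      rw [← hQ n, ← sub_le_iff_le_add, le_div_iff₀ hC0]
      linarith
    rw [div_lt_iff₀ (by linarith)] at hn2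
    rw [div_lt_iff₀ (by positivity)]
    have : 0 < l * n := by positivity
    nlinarith

end BES

/-- For every `r ≥ 4`, `f^{(r)}(n; 8r-14, 8)/n²` converges to `1/(r²-r)`. -/
theorem brown_erdos_sos_k8 (r : ℕ) (hr : 4 ≤ r) :
    Filter.Tendsto (fun n : ℕ => (fBES r n (8 * r - 14) 8 : ℝ) / (n : ℝ) ^ 2)
      Filter.atTop (nhds (1 / ((r : ℝ) ^ 2 - r))) := by
  obtain ⟨t, rfl⟩ : ∃ t, r = t + 2 := ⟨r - 2, by omega⟩
  have h : 8 * (t + 2) - 14 = 8 * t + 2 := by omega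
  rw [h]
  exact BES.main (by omega)
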